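/- Suppose ℋ is a hereditary 3-graph property and for some integer L≥1, L = max{K∈ℕ : B_ℋ ∩ Irr(K) ≠ ∅}. Then for all sufficiently small ε₁>0 and all ε₂:ℕ→(0,1] tending to 0 sufficiently fast, L_ℋ(ε₁,ε₂) = L. -/

import Mathlib

open scoped Classical
open Finset

set_option maxHeartbeats 1000000

/-- A 3-uniform hypergraph on a finite vertex set of naturals. -/
structure ThreeGraph where
  verts : Finset ℕ
  edges : Finset (Finset ℕ)
  edges_sub : ∀ e ∈ edges, e ⊆ verts ∧ e.card = 3

/-- The set `Ē` of ordered triples corresponding to edges. -/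
def ThreeGraph.obar (H : ThreeGraph) : Finset (ℕ × ℕ × ℕ) :=
  (H.verts ×ˢ H.verts ×ˢ H.verts).filter fun p => ({p.1, p.2.1, p.2.2} : Finset ℕ) ∈ H.edges

/-- A bigraph `(U,V;E)`. -/
structure Bigraph where
  left : Finset ℕ
  right : Finset ℕ
  edges : Finset (ℕ × ℕ)
  edges_sub : edges ⊆ left ×ˢ right

noncomputable def Bigraph.density (B : Bigraph) : ℝ :=
  (B.edges.card : ℝ) / ((B.left.card : ℝ) * (B.right.card : ℝ))

noncomputable def Bigraph.gfun (B : Bigraph) (u w : ℕ) : ℝ :=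
  if (u, w) ∈ B.edges then 1 - B.density else -B.density

noncomputable def Bigraph.devSum (B : Bigraph) : ℝ :=
  ∑ u₀ ∈ B.left, ∑ u₁ ∈ B.left, ∑ w₀ ∈ B.right, ∑ w₁ ∈ B.right,
    B.gfun u₀ w₀ * B.gfun u₀ w₁ * B.gfun u₁ w₀ * B.gfun u₁ w₁

/-- `B` has `dev₂(ε,d)`. -/
def Bigraph.dev2 (B : Bigraph) (ε d : ℝ) : Prop :=
  |B.density - d| ≤ ε ∧ B.devSum ≤ ε * (B.left.card : ℝ) ^ 2 * (B.right.card : ℝ) ^ 2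

/-- `B` has `dev₂(ε)`, i.e. `dev₂(ε, d_B)`. -/
def Bigraph.dev2self (B : Bigraph) (ε : ℝ) : Prop := B.dev2 ε B.density

noncomputable def Bigraph.dBetween (B : Bigraph) (X Y : Finset ℕ) : ℝ :=
  ((B.edges ∩ X ×ˢ Y).card : ℝ) / ((X.card : ℝ) * (Y.card : ℝ))

/-- `ε`-regularity for a bigraph. -/
def Bigraph.EpsRegular (B : Bigraph) (ε : ℝ) : Prop :=
  ∀ X ⊆ B.left, ∀ Y ⊆ B.right,
    ε * (B.left.card : ℝ) ≤ (X.card : ℝ) → ε * (B.right.card : ℝ) ≤ (Y.card : ℝ) →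
      |B.density - B.dBetween X Y| ≤ ε

/-- Irreducibility: distinct vertices have distinct neighborhoods, on both sides. -/
def Bigraph.Irreducible (B : Bigraph) : Prop :=
  (∀ u ∈ B.left, ∀ u' ∈ B.left, (∀ v : ℕ, (u, v) ∈ B.edges ↔ (u', v) ∈ B.edges) → u = u') ∧
  (∀ v ∈ B.right, ∀ v' ∈ B.right, (∀ u : ℕ, (u, v) ∈ B.edges ↔ (u, v') ∈ B.edges) → v = v')

def Bigraph.leftNbhd (B : Bigraph) (v : ℕ) : Finset ℕ :=
  B.left.filter fun u => (u, v) ∈ B.edges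

/-- `B` contains an induced copy of the abstract bigraph on `Fin k × Fin k` given by `F`. -/
def Bigraph.HasInducedPattern (B : Bigraph) (k : ℕ) (F : Fin k → Fin k → Prop) : Prop :=
  ∃ u v : Fin k → ℕ, (∀ a, u a ∈ B.left) ∧ (∀ b, v b ∈ B.right) ∧
    ∀ a b, ((u a, v b) ∈ B.edges ↔ F a b)

/-- A triad `(X,Y,Z; E_XY, E_YZ, E_XZ)`. -/
structure Triad where
  X : Finset ℕ
  Y : Finset ℕ
  Z : Finset ℕ
  EXY : Finset (ℕ × ℕ)
  EYZ : Finset (ℕ × ℕ)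
  EXZ : Finset (ℕ × ℕ)
  hXY : EXY ⊆ X ×ˢ Y
  hYZ : EYZ ⊆ Y ×ˢ Z
  hXZ : EXZ ⊆ X ×ˢ Z

def Triad.K3 (G : Triad) : Finset (ℕ × ℕ × ℕ) :=
  (G.X ×ˢ G.Y ×ˢ G.Z).filter fun p =>
    (p.1, p.2.1) ∈ G.EXY ∧ (p.2.1, p.2.2) ∈ G.EYZ ∧ (p.1, p.2.2) ∈ G.EXZ

def Triad.bXY (G : Triad) : Bigraph := ⟨G.X, G.Y, G.EXY, G.hXY⟩
def Triad.bYZ (G : Triad) : Bigraph := ⟨G.Y, G.Z, G.EYZ, G.hYZ⟩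
def Triad.bXZ (G : Triad) : Bigraph := ⟨G.X, G.Z, G.EXZ, G.hXZ⟩

/-- `d_H(G)` where the (tri)graph is given by its set `R` of ordered triples. -/
noncomputable def relDensity (R : Finset (ℕ × ℕ × ℕ)) (G : Triad) : ℝ :=
  ((R ∩ G.K3).card : ℝ) / (G.K3.card : ℝ)

noncomputable def hFun (R : Finset (ℕ × ℕ × ℕ)) (G : Triad) (x y z : ℕ) : ℝ :=
  if (x, y, z) ∈ G.K3 then
    (if (x, y, z) ∈ R then 1 - relDensity R G else -(relDensity R G))
  else 0

noncomputable def devSum3 (R : Finset (ℕ × ℕ × ℕ)) (G : Triad) : ℝ :=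
  ∑ u₀ ∈ G.X, ∑ u₁ ∈ G.X, ∑ w₀ ∈ G.Y, ∑ w₁ ∈ G.Y, ∑ z₀ ∈ G.Z, ∑ z₁ ∈ G.Z,
    hFun R G u₀ w₀ z₀ * hFun R G u₀ w₀ z₁ * hFun R G u₀ w₁ z₀ * hFun R G u₀ w₁ z₁ *
      hFun R G u₁ w₀ z₀ * hFun R G u₁ w₀ z₁ * hFun R G u₁ w₁ z₀ * hFun R G u₁ w₁ z₁

/-- `(H,G)` has `dev_{2,3}(ε₁,ε₂)`, where the trigraph/3-graph is given by triples `R`. -/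
def dev23 (R : Finset (ℕ × ℕ × ℕ)) (G : Triad) (ε₁ ε₂ : ℝ) : Prop :=
  ∃ dXY dYZ dXZ : ℝ, 0 < dXY ∧ 0 < dYZ ∧ 0 < dXZ ∧
    G.bXY.dev2 ε₂ dXY ∧ G.bXZ.dev2 ε₂ dXZ ∧ G.bYZ.dev2 ε₂ dYZ ∧
    devSum3 R G ≤ ε₁ * dXY ^ 4 * dYZ ^ 4 * dXZ ^ 4 *
      (G.X.card : ℝ) ^ 2 * (G.Y.card : ℝ) ^ 2 * (G.Z.card : ℝ) ^ 2

/-- `G` is `μ`-homogeneous with respect to the triples `R`: `d_H(G) ∈ [0,μ) ∪ (1-μ,1]`. -/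
def homTriad (R : Finset (ℕ × ℕ × ℕ)) (G : Triad) (μ : ℝ) : Prop :=
  relDensity R G < μ ∨ 1 - μ < relDensity R G

/-- A `(t,ℓ)`-decomposition of `V`, with part-indices `ι` and pair-indices `κ`. -/
structure Decomp (V : Finset ℕ) (ι κ : Type) where
  part : ι → Finset ℕ
  part_sub : ∀ i, part i ⊆ V
  part_disj : ∀ i j, i ≠ j → Disjoint (part i) (part j)
  part_cover : ∀ x ∈ V, ∃ i, x ∈ part i
  pairs : ι → ι → κ → Finset (ℕ × ℕ)
  pairs_sub : ∀ i j α, pairs i j α ⊆ part i ×ˢ part j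
  pairs_disj : ∀ i j α β, α ≠ β → Disjoint (pairs i j α) (pairs i j β)
  pairs_cover : ∀ i j, ∀ p ∈ part i ×ˢ part j, ∃ α, p ∈ pairs i j α

def Decomp.pairBG {V : Finset ℕ} {ι κ : Type} (P : Decomp V ι κ) (i j : ι) (α : κ) : Bigraph :=
  ⟨P.part i, P.part j, P.pairs i j α, P.pairs_sub i j α⟩

/-- The triad `G^{ijk}_{α,β,γ} = (V_i,V_j,V_k; P^α_{ij}, P^β_{ik}, P^γ_{jk})`. -/
def Decomp.triadOf {V : Finset ℕ} {ι κ : Type} (P : Decomp V ι κ) (i j k : ι) (α β γ : κ) :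
    Triad :=
  ⟨P.part i, P.part j, P.part k, P.pairs i j α, P.pairs j k γ, P.pairs i k β,
    P.pairs_sub i j α, P.pairs_sub j k γ, P.pairs_sub i k β⟩

/-- `P` is a `(t,ℓ,ε₁,ε₂)`-decomposition. -/
def Decomp.isReg {V : Finset ℕ} {ι κ : Type} (P : Decomp V ι κ) (ε₁ ε₂ : ℝ) : Prop :=
  (1 - ε₁) * (V.card : ℝ) ^ 2 ≤
    (((V ×ˢ V).filter fun p =>
      ∃ i j α, p ∈ P.pairs i j α ∧ (P.pairBG i j α).dev2self ε₂).card : ℝ)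

/-- `P` is equitable. -/
def Decomp.isEquitable {V : Finset ℕ} {ι κ : Type} [Fintype κ]
    (P : Decomp V ι κ) (ε₁ ε₂ : ℝ) : Prop :=
  (∀ i j, (P.part i).card ≤ (P.part j).card + 1) ∧
  (1 - ε₁) * (V.card : ℝ) ^ 2 ≤
    (((V ×ˢ V).filter fun p =>
      ∃ i j α, p ∈ P.pairs i j α ∧
        (P.pairBG i j α).dev2 ε₂ (1 / (Fintype.card κ : ℝ))).card : ℝ)

/-- `P` is `dev_{2,3}(ε₁,ε₂)`-regular with respect to the triples `R`. -/
def Decomp.regWrt {V : Finset ℕ} {ι κ : Type} (P : Decomp V ι κ)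
    (R : Finset (ℕ × ℕ × ℕ)) (ε₁ ε₂ : ℝ) : Prop :=
  (1 - ε₁) * (V.card : ℝ) ^ 3 ≤
    (((V ×ˢ V ×ˢ V).filter fun p =>
      ∃ i j k α β γ, p ∈ (P.triadOf i j k α β γ).K3 ∧
        dev23 R (P.triadOf i j k α β γ) ε₁ ε₂).card : ℝ)

/-- The triad `G^{ijk}_{α,β,γ}` of `P` is `μ`-non-trivial. -/
def Decomp.nonTrivTriad {V : Finset ℕ} {t ℓ : ℕ} (P : Decomp V (Fin t) (Fin ℓ)) (μ : ℝ)
    (i j k : Fin t) (α β γ : Fin ℓ) : Prop :=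
  μ * (V.card : ℝ) / (t : ℝ) ≤ ((P.part i).card : ℝ) ∧
  μ * (V.card : ℝ) / (t : ℝ) ≤ ((P.part j).card : ℝ) ∧
  μ * (V.card : ℝ) / (t : ℝ) ≤ ((P.part k).card : ℝ) ∧
  μ * ((P.part i).card : ℝ) * ((P.part j).card : ℝ) / (ℓ : ℝ) ≤ ((P.pairs i j α).card : ℝ) ∧
  μ * ((P.part i).card : ℝ) * ((P.part k).card : ℝ) / (ℓ : ℝ) ≤ ((P.pairs i k β).card : ℝ) ∧
  μ * ((P.part j).card : ℝ) * ((P.part k).card : ℝ) / (ℓ : ℝ) ≤ ((P.pairs j k γ).card : ℝ)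

/-- `H` has a `dev_{2,3}(ε₁,ε₂)`-regular `(t,ℓ,ε₁,ε₂)`-decomposition. -/
def GoodDecomp (H : ThreeGraph) (t ℓ : ℕ) (ε₁ ε₂ : ℝ) : Prop :=
  ∃ P : Decomp H.verts (Fin t) (Fin ℓ), P.isReg ε₁ ε₂ ∧ P.regWrt H.obar ε₁ ε₂

def ThreeGraph.Iso (H₁ H₂ : ThreeGraph) : Prop :=
  ∃ f : ℕ → ℕ, Set.BijOn f ↑H₁.verts ↑H₂.verts ∧
    ∀ x ∈ H₁.verts, ∀ y ∈ H₁.verts, ∀ z ∈ H₁.verts,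
      (({x, y, z} : Finset ℕ) ∈ H₁.edges ↔ ({f x, f y, f z} : Finset ℕ) ∈ H₂.edges)

def ThreeGraph.induce (H : ThreeGraph) (W : Finset ℕ) : ThreeGraph where
  verts := H.verts ∩ W
  edges := H.edges.filter fun e => e ⊆ W
  edges_sub := by
    intro e he
    rw [Finset.mem_filter] at he
    obtain ⟨hsub, hcard⟩ := H.edges_sub e he.1
    exact ⟨fun x hx => Finset.mem_inter.mpr ⟨hsub hx, he.2 hx⟩, hcard⟩

/-- A hereditary property of 3-graphs. -/
def Hereditary (ℋ : Set ThreeGraph) : Prop :=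
  (∀ H₁ H₂ : ThreeGraph, ThreeGraph.Iso H₁ H₂ → H₁ ∈ ℋ → H₂ ∈ ℋ) ∧
  (∀ H ∈ ℋ, ∀ W : Finset ℕ, H.induce W ∈ ℋ)

/-- The statement `ψ(ε₁,ε₂,T,L,ℋ)`. -/
def psi (ε₁ : ℝ) (ε₂ : ℕ → ℝ) (T L : ℕ) (ℋ : Set ThreeGraph) : Prop :=
  ∃ n₀ : ℕ, ∀ H ∈ ℋ, n₀ ≤ H.verts.card →
    ∃ t ℓ : ℕ, 1 ≤ t ∧ t ≤ T ∧ 1 ≤ ℓ ∧ ℓ ≤ L ∧ GoodDecomp H t ℓ ε₁ (ε₂ ℓ)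

/-- `L_ℋ(ε₁,ε₂)`: minimal `L` such that `ψ(ε₁,ε₂,T,L,ℋ)` holds for some `T ≥ 1`. -/
noncomputable def Lfun (ℋ : Set ThreeGraph) (ε₁ : ℝ) (ε₂ : ℕ → ℝ) : ℕ :=
  sInf {L : ℕ | ∃ T : ℕ, 1 ≤ T ∧ psi ε₁ ε₂ T L ℋ}

def InZeroOne (f : ℕ → ℝ) : Prop := ∀ x, 0 < f x ∧ f x ≤ 1

/-- "For all sufficiently small `ε₁ > 0` and all `ε₂` tending to `0` sufficiently fast, `Φ`". -/
def SmallEps (Φ : ℝ → (ℕ → ℝ) → Prop) : Prop :=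
  ∃ e₁ : ℝ, 0 < e₁ ∧ ∀ ε₁ : ℝ, 0 < ε₁ → ε₁ < e₁ →
    ∃ δ : ℕ → ℝ, InZeroOne δ ∧
      ∀ ε₂ : ℕ → ℝ, InZeroOne ε₂ → (∀ x, ε₂ x ≤ δ x) → Φ ε₁ ε₂

/-- The `VC₂`-dimension of `H` is at least `k`. -/
def ThreeGraph.VC2AtLeast (H : ThreeGraph) (k : ℕ) : Prop :=
  ∃ a b : Fin k → ℕ, ∃ c : Finset (Fin k × Fin k) → ℕ,
    (∀ i, a i ∈ H.verts) ∧ (∀ i, b i ∈ H.verts) ∧ (∀ S, c S ∈ H.verts) ∧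
    ∀ (i j : Fin k) (S : Finset (Fin k × Fin k)),
      (({a i, b j, c S} : Finset ℕ) ∈ H.edges ↔ (i, j) ∈ S)

/-- `K₃[A,B,C]`: the triples meeting each of `A`, `B`, `C`. -/
def K3Parts (A B C : Finset ℕ) : Finset (Finset ℕ) :=
  (A ×ˢ B ×ˢ C).image fun p => ({p.1, p.2.1, p.2.2} : Finset ℕ)

/-- Neighborhood of `u` in the pair-set `W`, inside ambient set `V`. -/
def Nbhd (V : Finset ℕ) (W : Finset (ℕ × ℕ)) (u : ℕ) : Finset ℕ :=
  V.filter fun v => (u, v) ∈ W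

/-- An edge-colored bigraph `(U,V;E₀,E₁,E₂)`. -/
structure ECBigraph where
  left : Finset ℕ
  right : Finset ℕ
  E0 : Finset (ℕ × ℕ)
  E1 : Finset (ℕ × ℕ)
  E2 : Finset (ℕ × ℕ)
  disj01 : Disjoint E0 E1
  disj02 : Disjoint E0 E2
  disj12 : Disjoint E1 E2
  cover : E0 ∪ E1 ∪ E2 = left ×ˢ right

/-- `G` contains an `E₀/E₁`-copy of `U_bg(k)`. -/
def ECBigraph.CopyUbg (G : ECBigraph) (k : ℕ) : Prop :=
  ∃ u : Finset (Fin k) → ℕ, ∃ v : Fin k → ℕ,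
    (∀ S, u S ∈ G.left) ∧ (∀ i, v i ∈ G.right) ∧
    ∀ (S : Finset (Fin k)) (i : Fin k),
      (i ∈ S → (u S, v i) ∈ G.E1) ∧ (i ∉ S → (u S, v i) ∈ G.E0)

/-- `G` contains an `E₀/E₁`-copy of the bigraph `R`. -/
def ECBigraph.Copy01 (G : ECBigraph) (R : Bigraph) : Prop :=
  ∃ u v : ℕ → ℕ,
    (∀ a ∈ R.left, u a ∈ G.left) ∧ (∀ b ∈ R.right, v b ∈ G.right) ∧
    ∀ a ∈ R.left, ∀ b ∈ R.right,
      ((a, b) ∈ R.edges → (u a, v b) ∈ G.E1) ∧ ((a, b) ∉ R.edges → (u a, v b) ∈ G.E0)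

/-- `K₂[A,B]`: the crossing (unordered) pairs. -/
def pairsAB (A B : Finset ℕ) : Finset (Finset ℕ) :=
  (A ×ˢ B).image fun p => ({p.1, p.2} : Finset ℕ)

/-- A bipartite `U`-colored graph `Γ = (A ∪ B, (P_u)_{u ∈ U})`. -/
structure BipColored (U : Finset ℕ) where
  A : Finset ℕ
  B : Finset ℕ
  disjAB : Disjoint A B
  P : ℕ → Finset (Finset ℕ)
  P_disj : ∀ u ∈ U, ∀ u' ∈ U, u ≠ u' → Disjoint (P u) (P u')
  P_cover : U.biUnion P = pairsAB A B

/-- The bipartite graph `(A ∪ B, P_u)` of a color, as a bigraph (ordered pairs `P̄_u`). -/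
def BipColored.colorBG {U : Finset ℕ} (Γ : BipColored U) (u : ℕ) : Bigraph where
  left := Γ.A
  right := Γ.B
  edges := (Γ.A ×ˢ Γ.B).filter fun p => ({p.1, p.2} : Finset ℕ) ∈ Γ.P u
  edges_sub := Finset.filter_subset _ _

/-- `H` is an `(n,Γ)`-blowup of `G` with the explicit family `Cfam` of new vertex classes. -/
def IsBlowupWith (G : Bigraph) (n : ℕ) (Γ : BipColored G.left) (Cfam : ℕ → Finset ℕ)
    (H : ThreeGraph) : Prop :=
  (∀ v ∈ G.right, (Cfam v).card = n) ∧
  (∀ v ∈ G.right, ∀ v' ∈ G.right, v ≠ v' → Disjoint (Cfam v) (Cfam v')) ∧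
  (∀ v ∈ G.right, Disjoint (Cfam v) (Γ.A ∪ Γ.B)) ∧
  H.verts = Γ.A ∪ Γ.B ∪ G.right.biUnion Cfam ∧
  ∀ u ∈ G.left, ∀ v ∈ G.right, ∀ e ∈ Γ.P u, ∀ z ∈ Cfam v,
    (((u, v) ∈ G.edges → insert z e ∈ H.edges) ∧ ((u, v) ∉ G.edges → insert z e ∉ H.edges))

def IsBlowup (G : Bigraph) (n : ℕ) (Γ : BipColored G.left) (H : ThreeGraph) : Prop :=
  ∃ Cfam : ℕ → Finset ℕ, IsBlowupWith G n Γ Cfam H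

def ThreeGraph.ContainsInduced (H H' : ThreeGraph) : Prop :=
  ∃ W : Finset ℕ, ThreeGraph.Iso (H.induce W) H'

/-- The `G`-dimension of `H` is at least `n`. -/
def GDimAtLeast (G : Bigraph) (H : ThreeGraph) (n : ℕ) : Prop :=
  ∀ Γ : BipColored G.left, Γ.A.card = n → Γ.B.card = n →
    ∃ H' : ThreeGraph, IsBlowup G n Γ H' ∧ H.ContainsInduced H'

/-- `G ∈ B_ℋ`: `G` is irreducible and `ℋ` has infinite `G`-dimension. -/
def InBH (ℋ : Set ThreeGraph) (G : Bigraph) : Prop :=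
  G.Irreducible ∧ ∀ m : ℕ, ∃ H ∈ ℋ, GDimAtLeast G H m

/-- An encoding of the bigraph `R` in `(H,P)`, where `Rtrip = Ē(H)`. -/
def Encoding {V : Finset ℕ} {t ℓ : ℕ} (R : Bigraph) (Rtrip : Finset (ℕ × ℕ × ℕ))
    (P : Decomp V (Fin t) (Fin ℓ)) (ε₂ : ℝ) : Prop :=
  ∃ j₀ k₀ : Fin t, j₀ ≠ k₀ ∧
    ∃ f : ℕ → Fin ℓ, ∃ g : ℕ → Fin t × Fin ℓ × Fin ℓ,
      (∀ u ∈ R.left, (P.pairBG j₀ k₀ (f u)).dev2 ε₂ (1 / (ℓ : ℝ))) ∧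
      (∀ v ∈ R.right,
        (P.pairBG (g v).1 j₀ (g v).2.1).dev2 ε₂ (1 / (ℓ : ℝ)) ∧
        (P.pairBG (g v).1 k₀ (g v).2.2).dev2 ε₂ (1 / (ℓ : ℝ))) ∧
      ∀ u ∈ R.left, ∀ v ∈ R.right,
        (((u, v) ∈ R.edges →
          ((P.triadOf (g v).1 j₀ k₀ (g v).2.1 (g v).2.2 (f u)).K3.card : ℝ) / 2 ≤
            ((Rtrip ∩ (P.triadOf (g v).1 j₀ k₀ (g v).2.1 (g v).2.2 (f u)).K3).card : ℝ)) ∧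
         ((u, v) ∉ R.edges →
          ((Rtrip ∩ (P.triadOf (g v).1 j₀ k₀ (g v).2.1 (g v).2.2 (f u)).K3).card : ℝ) <
            ((P.triadOf (g v).1 j₀ k₀ (g v).2.1 (g v).2.2 (f u)).K3.card : ℝ) / 2))

def encodeSet (S : Finset ℕ) : ℕ := ∑ i ∈ S, 2 ^ i

/-- The bigraph `U_bg(k)` realized on `ℕ`, with subsets of `[k]` encoded in binary. -/
def Ubg (k : ℕ) : Bigraph where
  left := ((Finset.range k).powerset).image encodeSet
  right := Finset.range k
  edges := ((Finset.range k).powerset).biUnion fun S => S.image fun i => (encodeSet S, i)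
  edges_sub := by
    intro p hp
    simp only [Finset.mem_biUnion, Finset.mem_image, Finset.mem_powerset] at hp
    obtain ⟨S, hS, i, hi, rfl⟩ := hp
    refine Finset.mem_product.mpr ⟨?_, ?_⟩
    · exact Finset.mem_image.mpr ⟨S, Finset.mem_powerset.mpr hS, rfl⟩
    · exact hS hi

section Halving

variable {α : Type*} [Fintype α]

/-- The members of `S` that agree with `f` on all positions of rank below `t`. -/
noncomputable def versionSpace (r : α → ℕ) (S : Finset (Finset α)) (f : Finset α) (t : ℕ) :
    Finset (Finset α) :=
  S.filter fun g => ∀ p, r p < t → (p ∈ g ↔ p ∈ f)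

/-- The halving prediction of `p ∈ f`: the majority vote of the current version space. -/
def halvingPredict (r : α → ℕ) (S : Finset (Finset α)) (f : Finset α) (p : α) : Prop :=
  #(versionSpace r S f (r p)) < 2 * #((versionSpace r S f (r p)).filter (p ∈ ·))

lemma versionSpace_congr (r : α → ℕ) (S : Finset (Finset α)) {f f' : Finset α} {t : ℕ}
    (h : ∀ p, r p < t → (p ∈ f ↔ p ∈ f')) : versionSpace r S f t = versionSpace r S f' t := by
  unfold versionSpace
  refine Finset.filter_congr fun g _ => ?_
  refine forall_congr' fun p => imp_congr_right fun hp => ?_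
  rw [h p hp]

lemma halvingPredict_congr (r : α → ℕ) (S : Finset (Finset α))
    {f f' : Finset α} {p : α} (h : ∀ p', p' ≠ p → (p' ∈ f ↔ p' ∈ f')) :
    halvingPredict r S f p ↔ halvingPredict r S f' p := by
  unfold halvingPredict
  rw [versionSpace_congr r S (f := f) (f' := f')]
  intro p' hp'
  exact h p' (fun e => by simp [e] at hp')

/-- The positions at which the halving prediction is wrong. -/
noncomputable def halvingMistakes (r : α → ℕ) (S : Finset (Finset α)) (f : Finset α) : Finset α :=
  univ.filter fun p => ¬ (p ∈ f ↔ halvingPredict r S f p)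

lemma two_pow_halvingMistakes_mul_le {r : α → ℕ} (hr : Function.Injective r)
    (S : Finset (Finset α)) (f : Finset α) (t : ℕ) :
    2 ^ #((halvingMistakes r S f).filter (r · < t)) * #(versionSpace r S f t) ≤ #S := by
  induction t with
  | zero => simp [versionSpace]
  | succ t ih =>
    by_cases hp : ∃ p, r p = t
    · obtain ⟨p, rfl⟩ := hp
      have hvs : versionSpace r S f (r p + 1) =
          (versionSpace r S f (r p)).filter fun g => (p ∈ g ↔ p ∈ f) := by
        ext g
        simp only [versionSpace, mem_filter, and_assoc]
        refine and_congr_right fun _ => ⟨fun h => ⟨fun p' hp' => h p' (by omega), h p (by omega)⟩,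
          fun h p' hp' => ?_⟩
        rcases (Nat.lt_succ_iff_lt_or_eq.mp hp') with h' | h'
        · exact h.1 p' h'
        · rw [hr h']; exact h.2
      by_cases hm : p ∈ halvingMistakes r S f
      · have h1 : (halvingMistakes r S f).filter (r · < r p + 1) =
            insert p ((halvingMistakes r S f).filter (r · < r p)) := by
          ext p'
          simp only [mem_filter, mem_insert]
          constructor
          · rintro ⟨h, h'⟩
            rcases (Nat.lt_succ_iff_lt_or_eq.mp h') with h' | h'
            · exact Or.inr ⟨h, h'⟩
            · exact Or.inl (hr h')
          · rintro (rfl | ⟨h, h'⟩)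
            · exact ⟨hm, by omega⟩
            · exact ⟨h, by omega⟩
        have h2 : 2 * #(versionSpace r S f (r p + 1)) ≤ #(versionSpace r S f (r p)) := by
          rw [hvs]
          have hm' : ¬ (p ∈ f ↔ halvingPredict r S f p) := by
            simpa [halvingMistakes] using hm
          have hsplit := Finset.card_filter_add_card_filter_not (s := versionSpace r S f (r p))
            (fun g => p ∈ g)
          unfold halvingPredict at hm'
          by_cases hf : p ∈ f
          · simp only [hf, iff_true, true_iff, not_lt] at hm' ⊢
            exact hm'
          · simp only [hf, iff_false, false_iff, not_not] at hm' ⊢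
            omega
        rw [h1, card_insert_of_notMem (by simp), pow_succ, mul_assoc]
        exact (Nat.mul_le_mul_left _ h2).trans ih
      · have h1 : (halvingMistakes r S f).filter (r · < r p + 1) =
            (halvingMistakes r S f).filter (r · < r p) := by
          refine Finset.filter_congr fun p' hp' => ?_
          have : r p' ≠ r p := fun e => hm (hr e ▸ hp')
          omega
        rw [h1, hvs]
        exact (Nat.mul_le_mul_left _ (card_filter_le _ _)).trans ih
    · push Not at hp
      have e : ∀ p, r p < t + 1 ↔ r p < t := fun p => by have := hp p; omega
      have h2 : versionSpace r S f (t + 1) = versionSpace r S f t := by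
        simp only [versionSpace, e]
      rw [h2]
      simp only [e]
      exact ih

lemma two_pow_halvingMistakes_le {r : α → ℕ} (hr : Function.Injective r)
    {S : Finset (Finset α)} {f : Finset α} (hf : f ∈ S) :
    2 ^ #(halvingMistakes r S f) ≤ #S := by
  have h := two_pow_halvingMistakes_mul_le hr S f (univ.sup r + 1)
  have h1 : (halvingMistakes r S f).filter (r · < univ.sup r + 1) = halvingMistakes r S f :=
    Finset.filter_true_of_mem fun p _ => Nat.lt_succ_of_le (Finset.le_sup (mem_univ p))
  rw [h1] at h
  refine le_trans (Nat.le_mul_of_pos_right _ (card_pos.mpr ⟨f, ?_⟩)) h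
  simp [versionSpace, hf]

end Halving

section Zarankiewicz

/-- A subset of an `R × n` grid containing no `k × k` subgrid is sparse once `n` is large
compared with `R`. -/
lemma card_le_of_no_subgrid {R n k : ℕ} (s : Finset (Fin R × Fin n))
    (h : ∀ (A : Finset (Fin R)) (B : Finset (Fin n)), k ≤ #A → k ≤ #B → ¬ A ×ˢ B ⊆ s) :
    #s ≤ n * k + R * (2 ^ R * k) := by
  let col : Fin n → Finset (Fin R) := fun j => univ.filter fun i => (i, j) ∈ s
  have hs : #s = ∑ j, #(col j) := by
    rw [Finset.card_eq_sum_card_fiberwise (f := Prod.snd) (t := univ) (by intro _ _; simp)]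
    refine Finset.sum_congr rfl fun j _ => ?_
    refine Finset.card_bij (fun p _ => p.1) ?_ ?_ ?_
    · rintro ⟨i, j'⟩ hp
      simp only [mem_filter] at hp
      obtain ⟨hp, rfl⟩ := hp
      simp [col, hp]
    · rintro ⟨i, j'⟩ hp ⟨i', j''⟩ hp' h
      simp only [mem_filter] at hp hp'
      simp_all
    · intro i hi
      exact ⟨(i, j), by simpa [col] using hi, rfl⟩
  have hbig : #(univ.filter fun j => k ≤ #(col j)) ≤ 2 ^ R * k := by
    rw [Finset.card_eq_sum_card_fiberwise (f := col) (t := univ) (by intro _ _; simp)]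
    calc _ ≤ ∑ A : Finset (Fin R), k := by
          refine Finset.sum_le_sum fun A _ => ?_
          by_contra hlt
          push Not at hlt
          have hne : (((univ.filter fun j => k ≤ #(col j)).filter fun j => col j = A)).Nonempty :=
            card_pos.mp (by omega)
          obtain ⟨j0, hj0⟩ := hne
          simp only [mem_filter, mem_univ, true_and] at hj0
          refine h A _ (hj0.2 ▸ hj0.1) hlt.le ?_
          rintro ⟨i, j⟩ hij
          simp only [mem_product, mem_filter, mem_univ, true_and] at hij
          have : i ∈ col j := hij.2.2 ▸ hij.1
          simpa [col] using this
      _ = 2 ^ R * k := by simp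
  rw [hs, ← Finset.sum_filter_add_sum_filter_not univ fun j => k ≤ #(col j), add_comm]
  refine add_le_add ?_ ?_
  · calc _ ≤ ∑ j ∈ univ.filter (fun j => ¬ k ≤ #(col j)), k := by
          refine Finset.sum_le_sum fun j hj => ?_
          simp only [mem_filter] at hj
          omega
      _ ≤ n * k := by
          rw [Finset.sum_const, smul_eq_mul]
          exact Nat.mul_le_mul_right _ ((card_filter_le _ _).trans (by simp))
  · calc _ ≤ ∑ j ∈ univ.filter (fun j => k ≤ #(col j)), R :=
          Finset.sum_le_sum fun j _ => (card_le_univ _).trans (by simp)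
      _ ≤ R * (2 ^ R * k) := by
          rw [Finset.sum_const, smul_eq_mul, mul_comm]
          exact Nat.mul_le_mul_left _ hbig

/-- A set family all of whose shattered sets have size at most `D` has small cardinality. -/
lemma card_le_of_shatters_card_le {α : Type*} [Fintype α] [DecidableEq α] (𝒜 : Finset (Finset α)) (D a : ℕ)
    (h : ∀ s, 𝒜.Shatters s → #s ≤ D) :
    #𝒜 ≤ 2 ^ (a * D) * Real.exp (Fintype.card α / 2 ^ a) := by
  have h1 : #𝒜 ≤ #((univ : Finset (Finset α)).filter fun s => #s ≤ D) := by
    refine (card_le_card_shatterer 𝒜).trans (card_le_card fun s hs => ?_)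
    simp only [mem_filter, mem_univ, true_and]
    exact h s (mem_shatterer.mp hs)
  set x : ℝ := (1 / 2) ^ a with hx
  have hx0 : 0 < x := by positivity
  have hx1 : x ≤ 1 := pow_le_one₀ (by norm_num) (by norm_num)
  have h2 : (#((univ : Finset (Finset α)).filter fun s => #s ≤ D) : ℝ) * x ^ D ≤
      (1 + x) ^ Fintype.card α := by
    have h3 : (1 + x) ^ Fintype.card α = ∑ s : Finset α, x ^ #s := by
      have := Finset.sum_pow_mul_eq_add_pow x 1 (univ : Finset α)
      simp only [one_pow, mul_one, powerset_univ, card_univ] at this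
      rw [this, add_comm]
    rw [h3, ← nsmul_eq_mul, ← Finset.sum_const]
    refine le_trans (Finset.sum_le_sum (g := fun s => x ^ #s) fun s hs => ?_)
      (Finset.sum_le_sum_of_subset_of_nonneg (filter_subset _ _) fun _ _ _ => by positivity)
    exact pow_le_pow_of_le_one hx0.le hx1 (by simpa using hs)
  have h4 : (1 + x) ^ Fintype.card α ≤ Real.exp (Fintype.card α / 2 ^ a) := by
    calc _ ≤ (Real.exp x) ^ Fintype.card α := by
          gcongr
          linarith [Real.add_one_le_exp x]
      _ = _ := by
          rw [← Real.exp_nat_mul, hx, one_div, inv_pow]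
          rfl
  have h5 : (2 : ℝ) ^ (a * D) * x ^ D = 1 := by
    rw [hx, ← pow_mul, ← mul_pow]
    norm_num
  calc (#𝒜 : ℝ) ≤ #((univ : Finset (Finset α)).filter fun s => #s ≤ D) := by exact_mod_cast h1
    _ = 2 ^ (a * D) * (#((univ : Finset (Finset α)).filter fun s => #s ≤ D) * x ^ D) := by
        rw [mul_left_comm, h5, mul_one]
    _ ≤ _ := by gcongr; exact h2.trans h4

end Zarankiewicz

section Resampling

variable {ι W : Type*} [Fintype ι] [DecidableEq ι] [Fintype W]

/-- Swapping the value at the coordinate `i` with an extra variable. -/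
lemma sum_resample (i : ι) (g : (ι → W) → W → ℝ) :
    ∑ X : ι → W, ∑ x, g X x = ∑ X : ι → W, ∑ x, g (Function.update X i x) (X i) := by
  rw [← Fintype.sum_prod_type', ← Fintype.sum_prod_type']
  have hinv : Function.Involutive fun p : (ι → W) × W => (Function.update p.1 i p.2, p.1 i) := by
    rintro ⟨X, x⟩
    simp
  exact (Equiv.sum_comp hinv.toPerm fun p : (ι → W) × W => g p.1 p.2).symm

lemma sum_sum_update (i : ι) (g : (ι → W) → ℝ) :
    ∑ X : ι → W, ∑ x, g (Function.update X i x) = Fintype.card W * ∑ X, g X := by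
  rw [← sum_resample i fun X _ => g X, Finset.mul_sum]
  simp

end Resampling

/-- The grid `Fin k × Fin k` is shattered by the third coordinate of `E`. -/
def GridShattered {W : Type*} (E : W → W → W → Prop) (k : ℕ) : Prop :=
  ∃ x y : Fin k → W, ∀ S : Finset (Fin k × Fin k), ∃ z, ∀ i j, E (x i) (y j) z ↔ (i, j) ∈ S

section Trace

variable {W : Type*} [Fintype W] (E : W → W → W → Prop) {R n : ℕ}

noncomputable def gridTrace (X : Fin R → W) (Y : Fin n → W) (z : W) : Finset (Fin R × Fin n) :=
  univ.filter fun p => E (X p.1) (Y p.2) z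

noncomputable def gridTraces (X : Fin R → W) (Y : Fin n → W) : Finset (Finset (Fin R × Fin n)) :=
  univ.image (gridTrace E X Y)

variable {E}

lemma gridTraces_shatters_card_le {k : ℕ} (hE : ¬ GridShattered E k) (X : Fin R → W)
    (Y : Fin n → W) (s : Finset (Fin R × Fin n)) (hs : (gridTraces E X Y).Shatters s) :
    #s ≤ n * k + R * (2 ^ R * k) := by
  refine card_le_of_no_subgrid s fun A B hA hB hAB => hE ?_
  obtain ⟨A', hA', hAc⟩ := exists_subset_card_eq hA
  obtain ⟨B', hB', hBc⟩ := exists_subset_card_eq hB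
  let e := A'.orderEmbOfFin hAc
  let e' := B'.orderEmbOfFin hBc
  let m : Fin k × Fin k ↪ Fin R × Fin n := e.toEmbedding.prodMap e'.toEmbedding
  have hm : ∀ p, m p ∈ s := fun p => hAB <| mem_product.mpr
    ⟨hA' (orderEmbOfFin_mem _ hAc _), hB' (orderEmbOfFin_mem _ hBc _)⟩
  refine ⟨fun i => X (e i), fun j => Y (e' j), fun S => ?_⟩
  obtain ⟨u, hu, hsu⟩ := hs (t := S.map m) (by
    intro p hp
    obtain ⟨p', _, rfl⟩ := mem_map.mp hp
    exact hm p')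
  obtain ⟨z, -, rfl⟩ := mem_image.mp hu
  refine ⟨z, fun i j => ?_⟩
  have h1 : m (i, j) ∈ s ∩ gridTrace E X Y z ↔ m (i, j) ∈ S.map m := by rw [hsu]
  rw [mem_map' m, mem_inter] at h1
  rw [← h1]
  simp only [hm, true_and, gridTrace, mem_filter, mem_univ]
  rfl

lemma card_halvingMistakes_gridTrace_le {k : ℕ} (hE : ¬ GridShattered E k) (X : Fin R → W)
    (Y : Fin n → W) (z : W) (a : ℕ) {r : Fin R × Fin n → ℕ} (hr : Function.Injective r) :
    (#(halvingMistakes r (gridTraces E X Y) (gridTrace E X Y z)) : ℝ) ≤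
      a * (n * k + R * (2 ^ R * k)) + 2 * (R * n) / 2 ^ a := by
  set M := #(halvingMistakes r (gridTraces E X Y) (gridTrace E X Y z))
  have h1 := two_pow_halvingMistakes_le hr (S := gridTraces E X Y) (f := gridTrace E X Y z)
    (mem_image_of_mem _ (mem_univ _))
  have h2 := card_le_of_shatters_card_le (gridTraces E X Y) _ a
    (gridTraces_shatters_card_le hE X Y)
  have h3 : (2 : ℝ) ^ M ≤ 2 ^ (a * (n * k + R * (2 ^ R * k))) *
      Real.exp (Fintype.card (Fin R × Fin n) / 2 ^ a) :=
    le_trans (by exact_mod_cast h1) h2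
  have h4 := Real.log_le_log (by positivity) h3
  rw [Real.log_mul (by positivity) (by positivity), Real.log_exp, Real.log_pow, Real.log_pow] at h4
  have hl : (1 / 2 : ℝ) ≤ Real.log 2 := by linarith [Real.log_two_gt_d9]
  have h5 : (0 : ℝ) ≤ Fintype.card (Fin R × Fin n) / 2 ^ a := by positivity
  simp only [Fintype.card_prod, Fintype.card_fin] at h4 h5
  push_cast at h4 h5
  rw [mul_div_assoc]
  by_contra hlt
  push Not at hlt
  nlinarith

end Trace

/-- A 3-graph with bounded `VC₂`-dimension is, up to few triples, determined by a bounded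
colouring of the pairs. -/
lemma exists_pairColouring_size (k R n a : ℕ) (hR : 0 < R) (hn : 0 < n) :
    ∃ (K : Type) (_ : Fintype K), ∀ (W : Type) [Fintype W] (E : W → W → W → Prop),
      ¬ GridShattered E k → ∃ (q : W → W → K) (F : K → K → K → Prop),
        (#(univ.filter fun p : W × W × W =>
          ¬ (E p.1 p.2.1 p.2.2 ↔ F (q p.1 p.2.1) (q p.1 p.2.2) (q p.2.1 p.2.2))) : ℝ) ≤
          (a * (n * k + R * (2 ^ R * k)) + 2 * (R * n) / 2 ^ a) / (R * n) * Fintype.card W ^ 3 := by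
  refine ⟨Finset (Finset (Fin R × Fin n)) × Finset (Fin R × Fin n) × Finset (Fin R × Fin n),
    inferInstance, fun W _ E hE => ?_⟩
  rcases isEmpty_or_nonempty W with hW | hW
  · refine ⟨fun _ _ => default, fun _ _ _ => True, ?_⟩
    simp
  set M : ℝ := a * (n * k + R * (2 ^ R * k)) + 2 * (R * n) / 2 ^ a with hM
  have : Nonempty (Fin R) := ⟨⟨0, hR⟩⟩
  have : Nonempty (Fin n) := ⟨⟨0, hn⟩⟩
  let r : Fin R × Fin n → ℕ := fun p => (Fintype.equivFin (Fin R × Fin n) p : ℕ)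
  have hr : Function.Injective r := fun p p' h => (Fintype.equivFin _).injective (Fin.ext h)
  let g : Fin R × Fin n → (Fin R → W) → (Fin n → W) → W → ℝ := fun p X Y z =>
    if p ∈ halvingMistakes r (gridTraces E X Y) (gridTrace E X Y z) then 1 else 0
  have hRn : (0 : ℝ) < R * n := by positivity
  have hg : ∀ X Y z, ∑ p, g p X Y z ≤ M := fun X Y z => by
    have := card_halvingMistakes_gridTrace_le hE X Y z a hr
    simpa [g] using this
  have hpos : (0 : ℝ) < Fintype.card W := by exact_mod_cast Fintype.card_pos
  obtain ⟨⟨i, j⟩, hij⟩ : ∃ p, ∑ X, ∑ Y, ∑ z, g p X Y z ≤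
      M / (R * n) * (Fintype.card W : ℝ) ^ R * (Fintype.card W : ℝ) ^ n * Fintype.card W := by
    by_contra hcon
    push Not at hcon
    have h1 := Finset.sum_lt_sum_of_nonempty (s := univ) univ_nonempty fun p _ => hcon p
    have h2 : ∑ p, ∑ X, ∑ Y, ∑ z, g p X Y z ≤
        (Fintype.card W : ℝ) ^ R * ((Fintype.card W : ℝ) ^ n * (Fintype.card W * M)) := by
      rw [Finset.sum_comm]
      calc _ = ∑ X, ∑ Y, ∑ z, ∑ p, g p X Y z := by
            refine Finset.sum_congr rfl fun X _ => ?_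
            rw [Finset.sum_comm]
            refine Finset.sum_congr rfl fun Y _ => ?_
            rw [Finset.sum_comm]
        _ ≤ ∑ X : Fin R → W, ∑ Y : Fin n → W, ∑ z : W, M := by
            gcongr with X _ Y _ z _
            exact hg X Y z
        _ = _ := by simp
    refine absurd (h1.trans_le h2) (not_lt.mpr (le_of_eq ?_))
    simp only [sum_const, card_univ, Fintype.card_prod, Fintype.card_fin, nsmul_eq_mul]
    push_cast
    field_simp
  obtain ⟨X', Y', hXY⟩ : ∃ X' Y', ∑ x, ∑ y, ∑ z,
      g (i, j) (Function.update X' i x) (Function.update Y' j y) z ≤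
        M / (R * n) * (Fintype.card W : ℝ) ^ 3 := by
    by_contra hcon
    push Not at hcon
    have h1 : ∑ X' : Fin R → W, ∑ Y' : Fin n → W, M / (R * n) * (Fintype.card W : ℝ) ^ 3 <
        ∑ X', ∑ Y', ∑ x, ∑ y, ∑ z,
          g (i, j) (Function.update X' i x) (Function.update Y' j y) z :=
      Finset.sum_lt_sum_of_nonempty univ_nonempty fun X' _ =>
        Finset.sum_lt_sum_of_nonempty univ_nonempty fun Y' _ => hcon X' Y'
    have h2 : ∑ X', ∑ Y', ∑ x, ∑ y, ∑ z,
          g (i, j) (Function.update X' i x) (Function.update Y' j y) z =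
        Fintype.card W * (Fintype.card W * ∑ X, ∑ Y, ∑ z, g (i, j) X Y z) := by
      rw [Finset.mul_sum, ← sum_sum_update i fun X => Fintype.card W * ∑ Y, ∑ z, g (i, j) X Y z]
      refine Finset.sum_congr rfl fun X _ => ?_
      rw [Finset.sum_comm]
      refine Finset.sum_congr rfl fun x _ => ?_
      exact sum_sum_update j fun Y => ∑ z, g (i, j) (Function.update X i x) Y z
    rw [h2] at h1
    refine absurd h1 (not_lt.mpr ?_)
    simp only [sum_const, card_univ, Fintype.card_fun, Fintype.card_fin, nsmul_eq_mul]
    push_cast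
    calc _ ≤ (Fintype.card W : ℝ) * (Fintype.card W * (M / (R * n) * (Fintype.card W : ℝ) ^ R *
        (Fintype.card W : ℝ) ^ n * Fintype.card W)) := by gcongr
      _ = _ := by ring
  refine ⟨fun u v => (gridTraces E (Function.update X' i u) (Function.update Y' j v),
    univ.filter fun p => p.2 ≠ j ∧ E (Function.update X' i u p.1) (Y' p.2) v,
    univ.filter fun p => p.1 ≠ i ∧ p.2 = j ∧ E (X' p.1) u v),
    fun c c' c'' => halvingPredict r c.1 (c'.2.1 ∪ c''.2.2) (i, j), le_trans (le_of_eq ?_) hXY⟩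
  rw [Finset.card_filter]
  push_cast
  rw [Fintype.sum_prod_type]
  refine Finset.sum_congr rfl fun x _ => ?_
  rw [Fintype.sum_prod_type]
  refine Finset.sum_congr rfl fun y _ => Finset.sum_congr rfl fun z _ => ?_
  simp only [g]
  congr 1
  simp only [halvingMistakes, mem_filter, mem_univ, true_and, eq_iff_iff]
  rw [halvingPredict_congr r _ (f' := gridTrace E (Function.update X' i x)
    (Function.update Y' j y) z)]
  · simp [gridTrace]
  · rintro ⟨i', j'⟩ hne
    simp only [mem_union, mem_filter, mem_univ, true_and, gridTrace]
    by_cases hj : j' = j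
    · subst hj
      have hi : i' ≠ i := fun e => hne (by rw [e])
      simp [hi]
    · simp [hj]

theorem exists_pairColouring (k : ℕ) {η : ℝ} (hη : 0 < η) :
    ∃ (K : Type) (_ : Fintype K), ∀ (W : Type) [Fintype W] (E : W → W → W → Prop),
      ¬ GridShattered E k → ∃ (q : W → W → K) (F : K → K → K → Prop),
        (#(univ.filter fun p : W × W × W =>
          ¬ (E p.1 p.2.1 p.2.2 ↔ F (q p.1 p.2.1) (q p.1 p.2.2) (q p.2.1 p.2.2))) : ℝ) ≤
          η * Fintype.card W ^ 3 := by
  obtain ⟨a, ha⟩ := exists_nat_gt (6 / η)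
  obtain ⟨R, hR⟩ := exists_nat_gt (3 * a * k / η)
  obtain ⟨n, hn⟩ := exists_nat_gt (3 * a * 2 ^ R * k / η)
  have hR0 : (0 : ℝ) < R := lt_of_le_of_lt (by positivity) hR
  have hn0 : (0 : ℝ) < n := lt_of_le_of_lt (by positivity) hn
  obtain ⟨K, hK, h⟩ := exists_pairColouring_size k R n a (by exact_mod_cast hR0)
    (by exact_mod_cast hn0)
  refine ⟨K, hK, fun W _ E hE => ?_⟩
  obtain ⟨q, F, hqF⟩ := h W E hE
  refine ⟨q, F, hqF.trans ?_⟩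
  gcongr
  have ha' : (a : ℝ) < 2 ^ a := by exact_mod_cast Nat.lt_two_pow_self
  have h1 : 2 / 2 ^ a ≤ η / 3 := by
    rw [div_le_iff₀ (by positivity)]
    rw [div_lt_iff₀ hη] at ha
    nlinarith
  have h2 : a * k / R ≤ η / 3 := by
    rw [div_le_iff₀ hR0]
    rw [div_lt_iff₀ hη] at hR
    linarith
  have h3 : a * 2 ^ R * k / n ≤ η / 3 := by
    rw [div_le_iff₀ hn0]
    rw [div_lt_iff₀ hη] at hn
    linarith
  calc (a * (n * k + R * (2 ^ R * k)) + 2 * (R * n) / 2 ^ a) / (R * n) =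
      a * k / R + a * 2 ^ R * k / n + (2 / 2 ^ a : ℝ) := by field_simp
    _ ≤ η := by linarith

/-- Symmetric ternary relations. -/
structure TernarySymm {W : Type*} (E : W → W → W → Prop) : Prop where
  swap₁₂ : ∀ x y z, E x y z → E y x z
  swap₂₃ : ∀ x y z, E x y z → E x z y

/-- A colouring of ordered pairs in which the colour of `(y, x)` is determined by that of `(x, y)`
through an involution, together with a symmetric rule on colours of triangles. -/
structure SymmColouring (W K : Type) where
  q : W → W → K
  σ : K → K
  F : K → K → K → Prop
  σσ : ∀ a, σ (σ a) = a
  q_swap : ∀ x y, q y x = σ (q x y)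
  F_swap₂₃ : ∀ a b c, F a b c ↔ F b a (σ c)
  F_swap₁₂ : ∀ a b c, F a b c ↔ F (σ a) c b

/-- The triples whose membership in `E` is wrongly predicted. -/
noncomputable def SymmColouring.errors {W K : Type} [Fintype W] (Q : SymmColouring W K)
    (E : W → W → W → Prop) : Finset (W × W × W) :=
  univ.filter fun p => ¬ (E p.1 p.2.1 p.2.2 ↔ Q.F (Q.q p.1 p.2.1) (Q.q p.1 p.2.2) (Q.q p.2.1 p.2.2))

/-- The symmetrisation of an arbitrary colouring and prediction rule: all six orderings of the
triangle must vote for it. -/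
def SymmColouring.symmetrize {W K : Type} (q : W → W → K) (F : K → K → K → Prop) :
    SymmColouring W (K × K) where
  q x y := (q x y, q y x)
  σ := Prod.swap
  F a b c :=
    F a.1 b.1 c.1 ∧ F b.1 a.1 c.2 ∧ F a.2 c.1 b.1 ∧ F c.1 a.2 b.2 ∧ F b.2 c.2 a.1 ∧ F c.2 b.2 a.2
  σσ a := by simp
  q_swap x y := rfl
  F_swap₂₃ a b c := by simp only [Prod.fst_swap, Prod.snd_swap]; tauto
  F_swap₁₂ a b c := by simp only [Prod.fst_swap, Prod.snd_swap]; tauto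

theorem exists_symmColouring (k : ℕ) {η : ℝ} (hη : 0 < η) :
    ∃ (K : Type) (_ : Fintype K), ∀ (W : Type) [Fintype W] (E : W → W → W → Prop),
      TernarySymm E → ¬ GridShattered E k → ∃ Q : SymmColouring W K,
        (#(Q.errors E) : ℝ) ≤ η * Fintype.card W ^ 3 := by
  obtain ⟨K, hK, h⟩ := exists_pairColouring k (show 0 < η / 6 by positivity)
  refine ⟨K × K, inferInstance, fun W _ E hsymm hE => ?_⟩
  obtain ⟨q, F, hqF⟩ := h W E hE
  let B : Finset (W × W × W) := univ.filter fun p : W × W × W =>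
    ¬ (E p.1 p.2.1 p.2.2 ↔ F (q p.1 p.2.1) (q p.1 p.2.2) (q p.2.1 p.2.2))
  refine ⟨.symmetrize q F, ?_⟩
  have hsub : (SymmColouring.symmetrize q F).errors E ⊆
      ((((B ∪ B.image fun p => (p.1, p.2.2, p.2.1)) ∪ B.image fun p => (p.2.1, p.1, p.2.2)) ∪
        B.image fun p => (p.2.2, p.1, p.2.1)) ∪ B.image fun p => (p.2.1, p.2.2, p.1)) ∪
        B.image fun p => (p.2.2, p.2.1, p.1) := by
    rintro ⟨x, y, z⟩ hp
    simp only [SymmColouring.errors, mem_filter, mem_univ, true_and] at hp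
    have m : ∀ x y z, (x, y, z) ∉ B → (E x y z ↔ F (q x y) (q x z) (q y z)) := fun x y z h => by
      simpa [B] using h
    have e1 : E x y z ↔ E x z y := ⟨hsymm.swap₂₃ _ _ _, hsymm.swap₂₃ _ _ _⟩
    have e2 : E x y z ↔ E y x z := ⟨hsymm.swap₁₂ _ _ _, hsymm.swap₁₂ _ _ _⟩
    have e3 : E y x z ↔ E y z x := ⟨hsymm.swap₂₃ _ _ _, hsymm.swap₂₃ _ _ _⟩
    have e4 : E x z y ↔ E z x y := ⟨hsymm.swap₁₂ _ _ _, hsymm.swap₁₂ _ _ _⟩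
    have e5 : E z x y ↔ E z y x := ⟨hsymm.swap₂₃ _ _ _, hsymm.swap₂₃ _ _ _⟩
    by_contra hcon
    simp only [mem_union, not_or, mem_image, not_exists, not_and, Prod.forall, Prod.mk.injEq] at hcon
    obtain ⟨⟨⟨⟨⟨h1, h2⟩, h3⟩, h4⟩, h5⟩, h6⟩ := hcon
    have h2' := m x z y fun h => h2 _ _ _ h rfl rfl rfl
    have h3' := m y x z fun h => h3 _ _ _ h rfl rfl rfl
    have h4' := m y z x fun h => h4 _ _ _ h rfl rfl rfl
    have h5' := m z x y fun h => h5 _ _ _ h rfl rfl rfl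
    have h6' := m z y x fun h => h6 _ _ _ h rfl rfl rfl
    have h1' := m x y z h1
    exact hp ⟨fun h => ⟨h1'.1 h, h2'.1 (e1.1 h), h3'.1 (e2.1 h), h4'.1 (e3.1 (e2.1 h)),
      h5'.1 (e4.1 (e1.1 h)), h6'.1 (e5.1 (e4.1 (e1.1 h)))⟩, fun h => h1'.2 h.1⟩
  have hc : ∀ f : W × W × W → W × W × W, #(B.image f) ≤ #B := fun f => card_image_le
  have hle := card_le_card hsub
  have hB : (#B : ℝ) ≤ η / 6 * Fintype.card W ^ 3 := hqF
  have : #((SymmColouring.symmetrize q F).errors E) ≤ 6 * #B := hle.trans <| by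
    refine (card_union_le _ _).trans ?_
    have h1 := hc fun p => (p.2.2, p.2.1, p.1)
    have h2 := hc fun p => (p.2.1, p.2.2, p.1)
    have h3 := hc fun p => (p.2.2, p.1, p.2.1)
    have h4 := hc fun p => (p.2.1, p.1, p.2.2)
    have h5 := hc fun p => (p.1, p.2.2, p.2.1)
    refine (add_le_add_left (card_union_le _ _) _).trans ?_
    refine (add_le_add_left (add_le_add_left (card_union_le _ _) _) _).trans ?_
    refine (add_le_add_left (add_le_add_left (add_le_add_left (card_union_le _ _) _) _) _).trans ?_
    refine (add_le_add_left (add_le_add_left (add_le_add_left (add_le_add_left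
      (card_union_le _ _) _) _) _) _).trans ?_
    omega
  calc _ ≤ ((6 * #B : ℕ) : ℝ) := by exact_mod_cast this
    _ ≤ _ := by push_cast; linarith

section Regularity

variable {W K ι ι' : Type*}

/-- The indicator function of a colour. -/
noncomputable def colInd (q : W → W → K) (a : K) (x y : W) : ℝ := if q x y = a then 1 else 0

lemma colInd_nonneg (q : W → W → K) (a : K) (x y : W) : 0 ≤ colInd q a x y := by
  unfold colInd; split_ifs <;> norm_num

lemma colInd_le_one (q : W → W → K) (a : K) (x y : W) : colInd q a x y ≤ 1 := by
  unfold colInd; split_ifs <;> norm_num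

variable [Fintype W]

/-- The cell of label `i` of the partition given by the labelling `c`. -/
noncomputable def cell (c : W → ι) (i : ι) : Finset W := univ.filter fun x => c x = i

lemma mem_cell {c : W → ι} {i : ι} {x : W} : x ∈ cell c i ↔ c x = i := by simp [cell]

/-- The density of the colour `a` between two cells. -/
noncomputable def pdens (q : W → W → K) (c : W → ι) (i j : ι) (a : K) : ℝ :=
  (∑ x ∈ cell c i, ∑ y ∈ cell c j, colInd q a x y) / (#(cell c i) * #(cell c j))

/-- The discrepancy of the colour `a` between the cells `i` and `j` on the rectangle `X × Y`. -/
noncomputable def disc (q : W → W → K) (c : W → ι) (i j : ι) (a : K) (X Y : Finset W) : ℝ :=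
  ∑ x ∈ cell c i ∩ X, ∑ y ∈ cell c j ∩ Y, (colInd q a x y - pdens q c i j a)

lemma pdens_nonneg (q : W → W → K) (c : W → ι) (i j : ι) (a : K) : 0 ≤ pdens q c i j a :=
  div_nonneg (sum_nonneg fun _ _ => sum_nonneg fun _ _ => colInd_nonneg _ _ _ _) (by positivity)

lemma pdens_mul (q : W → W → K) (c : W → ι) (i j : ι) (a : K) :
    pdens q c i j a * (#(cell c i) * #(cell c j)) =
      ∑ x ∈ cell c i, ∑ y ∈ cell c j, colInd q a x y := by
  unfold pdens
  by_cases h : (#(cell c i) * #(cell c j) : ℝ) = 0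
  · rw [h, mul_zero]
    rcases mul_eq_zero.mp h with h | h
    · simp only [Nat.cast_eq_zero, card_eq_zero] at h
      simp [h]
    · simp only [Nat.cast_eq_zero, card_eq_zero] at h
      simp [h]
  · rw [div_mul_cancel₀ _ h]

lemma pdens_le_one (q : W → W → K) (c : W → ι) (i j : ι) (a : K) : pdens q c i j a ≤ 1 := by
  refine div_le_one_of_le₀ ?_ (by positivity)
  calc _ ≤ ∑ x ∈ cell c i, ∑ y ∈ cell c j, (1 : ℝ) := by
        gcongr
        exact colInd_le_one _ _ _ _
    _ = _ := by simp

section Energy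

variable [Fintype K]

/-- The energy of a partition with respect to a colouring. -/
noncomputable def energy (q : W → W → K) (c : W → ι) : ℝ :=
  ∑ a, ∑ x, ∑ y, pdens q c (c x) (c y) a ^ 2

lemma energy_nonneg (q : W → W → K) (c : W → ι) : 0 ≤ energy q c := by
  unfold energy; positivity

lemma energy_le (q : W → W → K) (c : W → ι) :
    energy q c ≤ Fintype.card K * (Fintype.card W : ℝ) ^ 2 := by
  calc energy q c ≤ ∑ a : K, ∑ x : W, ∑ y : W, (1 : ℝ) := by
        unfold energy
        gcongr with a _ x _ y _
        exact pow_le_one₀ (pdens_nonneg _ _ _ _ _) (pdens_le_one _ _ _ _ _)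
    _ = _ := by
      simp only [sum_const, card_univ, nsmul_eq_mul, mul_one]
      ring

end Energy

variable [Fintype ι]

lemma sum_sum_cell (c : W → ι) (h : W → W → ℝ) :
    ∑ x, ∑ y, h x y = ∑ i, ∑ j, ∑ x ∈ cell c i, ∑ y ∈ cell c j, h x y := by
  rw [← Finset.sum_fiberwise univ c fun x => ∑ y, h x y]
  refine Finset.sum_congr rfl fun i _ => ?_
  refine Eq.trans (Finset.sum_congr rfl fun x _ => ?_) Finset.sum_comm
  rw [← Finset.sum_fiberwise univ c fun y => h x y]
  rfl

lemma sum_mul_colInd (q : W → W → K) (c : W → ι) (a : K) (U : ι → ι → ℝ) :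
    ∑ x, ∑ y, U (c x) (c y) * colInd q a x y =
      ∑ x, ∑ y, U (c x) (c y) * pdens q c (c x) (c y) a := by
  rw [sum_sum_cell c, sum_sum_cell c]
  refine Finset.sum_congr rfl fun i _ => Finset.sum_congr rfl fun j _ => ?_
  trans U i j * ∑ x ∈ cell c i, ∑ y ∈ cell c j, colInd q a x y
  · rw [Finset.mul_sum]
    refine Finset.sum_congr rfl fun x hx => ?_
    rw [Finset.mul_sum]
    refine Finset.sum_congr rfl fun y hy => ?_
    rw [mem_cell.mp hx, mem_cell.mp hy]
  · rw [← pdens_mul]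
    trans ∑ x ∈ cell c i, ∑ y ∈ cell c j, U i j * pdens q c i j a
    · simp; ring
    · refine Finset.sum_congr rfl fun x hx => Finset.sum_congr rfl fun y hy => ?_
      rw [mem_cell.mp hx, mem_cell.mp hy]

variable [Fintype ι'] [Fintype K]

lemma sum_sq_dens_sub (q : W → W → K) (c : W → ι) (c' : W → ι') (π : ι' → ι)
    (hπ : ∀ x, π (c' x) = c x) :
    ∑ a, ∑ x, ∑ y, (pdens q c' (c' x) (c' y) a - pdens q c (c x) (c y) a) ^ 2 =
      energy q c' - energy q c := by
  unfold energy
  rw [← Finset.sum_sub_distrib]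
  refine Finset.sum_congr rfl fun a _ => ?_
  have h1 := sum_mul_colInd q c a fun i j => pdens q c i j a
  have h2 := sum_mul_colInd q c' a fun i j => pdens q c (π i) (π j) a
  simp only [hπ] at h2
  rw [h2] at h1
  have h3 : ∀ x y, (pdens q c' (c' x) (c' y) a - pdens q c (c x) (c y) a) ^ 2 =
      pdens q c' (c' x) (c' y) a ^ 2 - 2 * (pdens q c (c x) (c y) a * pdens q c' (c' x) (c' y) a) +
        pdens q c (c x) (c y) a * pdens q c (c x) (c y) a := fun x y => by ring
  simp only [h3, Finset.sum_add_distrib, Finset.sum_sub_distrib, ← Finset.mul_sum, h1]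
  have h4 : ∑ x, ∑ y, pdens q c (c x) (c y) a * pdens q c (c x) (c y) a =
      ∑ x, ∑ y, pdens q c (c x) (c y) a ^ 2 := by simp only [sq]
  rw [h4]
  ring

/-- If `c'` refines `c` and the sets of a family of rectangles, the total discrepancy of the family
is controlled by the energy increment. -/
lemma sum_disc_sq_le (q : W → W → K) (c : W → ι) (c' : W → ι') (π : ι' → ι)
    (hπ : ∀ x, π (c' x) = c x) (X Y : ι → ι → K → Finset W)
    (hX : ∀ x x', c' x = c' x' → ∀ j a, x ∈ X (c x) j a → x' ∈ X (c x) j a)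
    (hY : ∀ y y', c' y = c' y' → ∀ i a, y ∈ Y i (c y) a → y' ∈ Y i (c y) a) :
    (∑ i, ∑ j, ∑ a, |disc q c i j a (X i j a) (Y i j a)|) ^ 2 ≤
      Fintype.card K * (Fintype.card W : ℝ) ^ 2 * (energy q c' - energy q c) := by
  have hd : ∀ i j a, |disc q c i j a (X i j a) (Y i j a)| ≤ ∑ x ∈ cell c i, ∑ y ∈ cell c j,
      |pdens q c' (c' x) (c' y) a - pdens q c (c x) (c y) a| := by
    intro i j a
    let U : ι' → ι' → ℝ := fun p p' =>
      if (∃ x, c' x = p ∧ c x = i ∧ x ∈ X i j a) ∧ (∃ y, c' y = p' ∧ c y = j ∧ y ∈ Y i j a) then 1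
        else 0
    have hU : ∀ x y, U (c' x) (c' y) =
        if x ∈ cell c i ∩ X i j a ∧ y ∈ cell c j ∩ Y i j a then 1 else 0 := by
      intro x y
      simp only [U]
      congr 1
      simp only [mem_inter, mem_cell, eq_iff_iff]
      refine and_congr ⟨?_, fun h => ⟨x, rfl, h⟩⟩ ⟨?_, fun h => ⟨y, rfl, h⟩⟩
      · rintro ⟨x', hx', rfl, hxX⟩
        exact ⟨by rw [← hπ, ← hx', hπ], hX _ _ hx' _ _ hxX⟩
      · rintro ⟨y', hy', rfl, hyY⟩
        exact ⟨by rw [← hπ, ← hy', hπ], hY _ _ hy' _ _ hyY⟩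
    have h0 : ∀ g : W → W → ℝ, ∑ x, ∑ y, U (c' x) (c' y) * g x y =
        ∑ x ∈ cell c i ∩ X i j a, ∑ y ∈ cell c j ∩ Y i j a, g x y := by
      intro g
      rw [← Finset.sum_filter_add_sum_filter_not univ (fun x => x ∈ cell c i ∩ X i j a)]
      rw [Finset.filter_univ_mem, add_eq_left.mpr]
      · refine Finset.sum_congr rfl fun x hx => ?_
        rw [← Finset.sum_filter_add_sum_filter_not univ (fun y => y ∈ cell c j ∩ Y i j a)]
        rw [Finset.filter_univ_mem, add_eq_left.mpr]
        · refine Finset.sum_congr rfl fun y hy => ?_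
          rw [hU, if_pos ⟨hx, hy⟩, one_mul]
        · refine Finset.sum_eq_zero fun y hy => ?_
          rw [hU, if_neg (fun h => (mem_filter.mp hy).2 h.2), zero_mul]
      · refine Finset.sum_eq_zero fun x hx => Finset.sum_eq_zero fun y _ => ?_
        rw [hU, if_neg (fun h => (mem_filter.mp hx).2 h.1), zero_mul]
    have h1 : disc q c i j a (X i j a) (Y i j a) = ∑ x ∈ cell c i ∩ X i j a,
        ∑ y ∈ cell c j ∩ Y i j a, (pdens q c' (c' x) (c' y) a - pdens q c (c x) (c y) a) := by
      have := sum_mul_colInd q c' a U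
      rw [h0, h0] at this
      simp only [disc, Finset.sum_sub_distrib, this]
      congr 1
      refine Finset.sum_congr rfl fun x hx => Finset.sum_congr rfl fun y hy => ?_
      rw [mem_cell.mp (mem_inter.mp hx).1, mem_cell.mp (mem_inter.mp hy).1]
    rw [h1]
    calc _ ≤ ∑ x ∈ cell c i ∩ X i j a, ∑ y ∈ cell c j ∩ Y i j a,
          |pdens q c' (c' x) (c' y) a - pdens q c (c x) (c y) a| :=
          (abs_sum_le_sum_abs _ _).trans (Finset.sum_le_sum fun _ _ => abs_sum_le_sum_abs _ _)
      _ ≤ ∑ x ∈ cell c i, ∑ y ∈ cell c j ∩ Y i j a,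
          |pdens q c' (c' x) (c' y) a - pdens q c (c x) (c y) a| :=
          Finset.sum_le_sum_of_subset_of_nonneg inter_subset_left fun _ _ _ =>
            sum_nonneg fun _ _ => abs_nonneg _
      _ ≤ _ := Finset.sum_le_sum fun _ _ =>
          Finset.sum_le_sum_of_subset_of_nonneg inter_subset_left fun _ _ _ => abs_nonneg _
  have hS : ∑ i, ∑ j, ∑ a, |disc q c i j a (X i j a) (Y i j a)| ≤
      ∑ p : K × W × W, |pdens q c' (c' p.2.1) (c' p.2.2) p.1 - pdens q c (c p.2.1) (c p.2.2) p.1| := by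
    calc _ ≤ ∑ i, ∑ j, ∑ a, ∑ x ∈ cell c i, ∑ y ∈ cell c j,
          |pdens q c' (c' x) (c' y) a - pdens q c (c x) (c y) a| := by
          gcongr with i _ j _ a _
          exact hd i j a
      _ = ∑ a, ∑ i, ∑ j, ∑ x ∈ cell c i, ∑ y ∈ cell c j,
          |pdens q c' (c' x) (c' y) a - pdens q c (c x) (c y) a| := by
          rw [Finset.sum_comm' (s' := fun _ => univ) (t' := univ) (by simp)]
          rw [Finset.sum_congr rfl fun i _ => Finset.sum_comm]
          rw [Finset.sum_comm]
          rw [Finset.sum_congr rfl fun a _ => Finset.sum_comm]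
      _ = _ := by
          rw [Fintype.sum_prod_type]
          refine Finset.sum_congr rfl fun a _ => ?_
          rw [Fintype.sum_prod_type, sum_sum_cell c]
  calc _ ≤ (∑ p : K × W × W,
        |pdens q c' (c' p.2.1) (c' p.2.2) p.1 - pdens q c (c p.2.1) (c p.2.2) p.1|) ^ 2 := by
        gcongr
    _ ≤ #(univ : Finset (K × W × W)) * ∑ p : K × W × W,
        |pdens q c' (c' p.2.1) (c' p.2.2) p.1 - pdens q c (c p.2.1) (c p.2.2) p.1| ^ 2 :=
        sq_sum_le_card_mul_sum_sq
    _ = _ := by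
        rw [← sum_sq_dens_sub q c c' π hπ, Fintype.sum_prod_type]
        simp only [Fintype.sum_prod_type, sq_abs, card_univ, Fintype.card_prod]
        push_cast
        ring

end Regularity

/-- A bound for the number of cells after `s` refinement steps. -/
def refineBound (m : ℕ) : ℕ → ℕ
  | 0 => 1
  | s + 1 => refineBound m s * (2 ^ (refineBound m s * m) * 2 ^ (refineBound m s * m))

/-- A weak regularity lemma: all colours have small discrepancy on almost all pairs of cells. -/
theorem exists_regular_labelling (K : Type) [Fintype K] {ε : ℝ} (hε : 0 < ε) :
    ∃ T : ℕ, ∀ (W : Type) [Fintype W] (q : W → W → K), ∃ t, 1 ≤ t ∧ t ≤ T ∧ ∃ c : W → Fin t,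
      ∀ X Y : Fin t → Fin t → K → Finset W,
        ∑ i, ∑ j, ∑ a, |disc q c i j a (X i j a) (Y i j a)| ≤ ε * (Fintype.card W : ℝ) ^ 2 := by
  obtain ⟨s, hs⟩ := exists_nat_gt ((Fintype.card K : ℝ) ^ 2 / ε ^ 2)
  have hT : ∀ s, 1 ≤ refineBound (Fintype.card K) s := by
    intro s
    induction s with
    | zero => exact le_rfl
    | succ s ih =>
      unfold refineBound
      exact Nat.one_le_iff_ne_zero.mpr (by positivity)
  refine ⟨refineBound (Fintype.card K) s, fun W _ q => ?_⟩
  rcases isEmpty_or_nonempty W with hW | hW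
  · exact ⟨1, le_rfl, hT s, fun _ => 0, fun X Y => by
      have : ∀ s : Finset W, s = ∅ := fun s => Finset.eq_empty_of_isEmpty s
      simp [disc, this (cell _ _ ∩ _)]⟩
  have key : ∀ s : ℕ, ∃ t, 1 ≤ t ∧ t ≤ refineBound (Fintype.card K) s ∧ ∃ c : W → Fin t,
      (∀ X Y : Fin t → Fin t → K → Finset W,
        ∑ i, ∑ j, ∑ a, |disc q c i j a (X i j a) (Y i j a)| ≤ ε * (Fintype.card W : ℝ) ^ 2) ∨
      s * ε ^ 2 * (Fintype.card W : ℝ) ^ 2 ≤ Fintype.card K * energy q c := by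
    intro s
    induction s with
    | zero =>
      refine ⟨1, le_rfl, le_rfl, fun _ => 0, Or.inr ?_⟩
      have := energy_nonneg q (fun _ : W => (0 : Fin 1))
      simp only [Nat.cast_zero, zero_mul]
      positivity
    | succ s ih =>
      obtain ⟨t, ht, htT, c, hc⟩ := ih
      by_cases hgood : ∀ X Y : Fin t → Fin t → K → Finset W,
        ∑ i, ∑ j, ∑ a, |disc q c i j a (X i j a) (Y i j a)| ≤ ε * (Fintype.card W : ℝ) ^ 2
      · refine ⟨t, ht, htT.trans ?_, c, Or.inl hgood⟩
        rw [refineBound]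
        exact Nat.le_mul_of_pos_right _ (by positivity)
      · have hen := hc.resolve_left hgood
        push Not at hgood
        obtain ⟨X, Y, hXY⟩ := hgood
        let ι' := Fin t × (Fin t × K → Bool) × (Fin t × K → Bool)
        let e := Fintype.equivFin ι'
        let c' : W → Fin (Fintype.card ι') := fun x => e (c x, fun p => decide (x ∈ X (c x) p.1 p.2),
          fun p => decide (x ∈ Y p.1 (c x) p.2))
        have hinc := sum_disc_sq_le q c c' (fun p => (e.symm p).1) (by simp [c']) X Y
          (by
            intro x x' h j a hx
            simp only [c', EmbeddingLike.apply_eq_iff_eq] at h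
            rw [Prod.mk.injEq, Prod.mk.injEq, funext_iff, funext_iff] at h
            have := h.2.1 (j, a)
            rw [← h.1] at this
            simpa [hx] using this)
          (by
            intro x x' h j a hx
            simp only [c', EmbeddingLike.apply_eq_iff_eq] at h
            rw [Prod.mk.injEq, Prod.mk.injEq, funext_iff, funext_iff] at h
            have := h.2.2 (j, a)
            rw [← h.1] at this
            simpa [hx] using this)
        refine ⟨Fintype.card ι', ?_, ?_, c', Or.inr ?_⟩
        · exact Fintype.card_pos_iff.mpr ⟨c' hW.some |> e.symm⟩
        · simp only [ι', Fintype.card_prod, Fintype.card_fun, Fintype.card_bool, Fintype.card_fin]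
          unfold refineBound
          gcongr <;> norm_num
        · have hn : (0 : ℝ) < (Fintype.card W : ℝ) ^ 2 := by
            have : 0 < Fintype.card W := Fintype.card_pos
            positivity
          have h1 : (ε * (Fintype.card W : ℝ) ^ 2) ^ 2 ≤
              Fintype.card K * (Fintype.card W : ℝ) ^ 2 * (energy q c' - energy q c) :=
            le_trans (by gcongr) hinc
          have h2 : ε ^ 2 * (Fintype.card W : ℝ) ^ 2 ≤
              Fintype.card K * (energy q c' - energy q c) := by
            refine le_of_mul_le_mul_right ?_ hn
            calc _ = (ε * (Fintype.card W : ℝ) ^ 2) ^ 2 := by ring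
              _ ≤ _ := h1
              _ = _ := by ring
          push_cast
          linarith
  obtain ⟨t, ht, htT, c, hc | hc⟩ := key s
  · exact ⟨t, ht, htT, c, hc⟩
  · exfalso
    have hn : (0 : ℝ) < (Fintype.card W : ℝ) ^ 2 := by
      have : 0 < Fintype.card W := Fintype.card_pos
      positivity
    rw [div_lt_iff₀ (by positivity)] at hs
    have h1 : Fintype.card K * energy q c ≤ (Fintype.card K : ℝ) ^ 2 * (Fintype.card W : ℝ) ^ 2 := by
      calc _ ≤ (Fintype.card K : ℝ) * (Fintype.card K * (Fintype.card W : ℝ) ^ 2) := by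
            gcongr
            exact energy_le q c
        _ = _ := by ring
    nlinarith

section WeightedMean

variable {S W : Type*} [Fintype S] [Fintype W]

/-- The mean of `h` over maps `S → W` with independent coordinates of laws `ω s`. -/
noncomputable def wmean (ω : S → W → ℝ) (h : (S → W) → ℝ) : ℝ :=
  ∑ ψ : S → W, (∏ s, ω s (ψ s)) * h ψ

/-- Each `ω s` is a probability vector. -/
structure IsLaw (ω : S → W → ℝ) : Prop where
  nonneg : ∀ s x, 0 ≤ ω s x
  sum_eq : ∀ s, ∑ x, ω s x = 1

variable {ω : S → W → ℝ}

lemma IsLaw.prod_nonneg (hω : IsLaw ω) (ψ : S → W) : 0 ≤ ∏ s, ω s (ψ s) :=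
  Finset.prod_nonneg fun _ _ => hω.nonneg _ _

lemma wmean_const (hω : IsLaw ω) (c : ℝ) : wmean ω (fun _ => c) = c := by
  unfold wmean
  rw [← Finset.sum_mul]
  have h := Finset.prod_univ_sum (fun _ : S => (univ : Finset W)) ω
  simp only [hω.sum_eq, prod_const_one, Fintype.piFinset_univ] at h
  rw [← h, one_mul]

lemma wmean_mono (hω : IsLaw ω) {h h' : (S → W) → ℝ} (hh : ∀ ψ, h ψ ≤ h' ψ) :
    wmean ω h ≤ wmean ω h' :=
  Finset.sum_le_sum fun ψ _ => mul_le_mul_of_nonneg_left (hh ψ) (hω.prod_nonneg ψ)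

lemma wmean_add (h h' : (S → W) → ℝ) :
    wmean ω (fun ψ => h ψ + h' ψ) = wmean ω h + wmean ω h' := by
  simp only [wmean, mul_add, Finset.sum_add_distrib]

lemma wmean_mul_left (c : ℝ) (h : (S → W) → ℝ) :
    wmean ω (fun ψ => c * h ψ) = c * wmean ω h := by
  simp only [wmean, Finset.mul_sum, mul_left_comm]

lemma wmean_sum {ι : Type*} (s : Finset ι) (h : ι → (S → W) → ℝ) :
    wmean ω (fun ψ => ∑ i ∈ s, h i ψ) = ∑ i ∈ s, wmean ω (h i) := by
  simp only [wmean, Finset.mul_sum]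
  rw [Finset.sum_comm]

lemma abs_wmean_le (hω : IsLaw ω) {h : (S → W) → ℝ} {c : ℝ} (hh : ∀ ψ, |h ψ| ≤ c) :
    |wmean ω h| ≤ c := by
  rw [abs_le]
  constructor
  · rw [← wmean_const hω (-c)]
    exact wmean_mono hω fun ψ => (abs_le.mp (hh ψ)).1
  · rw [← wmean_const hω c]
    exact wmean_mono hω fun ψ => (abs_le.mp (hh ψ)).2

lemma wmean_update (hω : IsLaw ω) (s : S) (h : (S → W) → ℝ) :
    wmean ω h = wmean ω fun ψ => ∑ x, ω s x * h (Function.update ψ s x) := by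
  have hw : ∀ (ψ : S → W) x, (∏ s', ω s' (Function.update ψ s x s')) * ω s (ψ s) =
      (∏ s', ω s' (ψ s')) * ω s x := by
    intro ψ x
    rw [← Finset.mul_prod_erase univ _ (mem_univ s), ← Finset.mul_prod_erase univ
      (fun s' => ω s' (ψ s')) (mem_univ s), Function.update_self]
    have : ∏ s' ∈ univ.erase s, ω s' (Function.update ψ s x s') =
        ∏ s' ∈ univ.erase s, ω s' (ψ s') := by
      refine Finset.prod_congr rfl fun s' hs' => ?_
      rw [Function.update_of_ne (ne_of_mem_erase hs')]
    rw [this]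
    ring
  calc wmean ω h = ∑ ψ : S → W, ∑ x, (∏ s', ω s' (ψ s')) * ω s x * h ψ := by
        unfold wmean
        refine Finset.sum_congr rfl fun ψ _ => ?_
        rw [← Finset.sum_mul, ← Finset.mul_sum, hω.sum_eq, mul_one]
    _ = ∑ ψ : S → W, ∑ x, (∏ s', ω s' (Function.update ψ s x s')) * ω s (ψ s) *
          h (Function.update ψ s x) := sum_resample s _
    _ = _ := by
        unfold wmean
        refine Finset.sum_congr rfl fun ψ _ => ?_
        rw [Finset.mul_sum]
        refine Finset.sum_congr rfl fun x _ => ?_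
        rw [hw]
        ring

end WeightedMean

section Counting

variable {S W J : Type*} [Fintype S] [Fintype W]

/-- A finite graph pattern on `S` with edges indexed by `J`, each with a prescribed relation on
`W`. -/
structure Pattern (S W J : Type*) where
  src : J → S
  tgt : J → S
  rel : J → W → W → Prop
  ne : ∀ j, src j ≠ tgt j
  simple : ∀ j k, src j ∈ ({src k, tgt k} : Set S) → tgt j ∈ ({src k, tgt k} : Set S) → j = k

/-- The map `ψ` respects the edges in `A`. -/
def Pattern.Respects (P : Pattern S W J) (A : Finset J) (ψ : S → W) : Prop :=
  ∀ j ∈ A, P.rel j (ψ (P.src j)) (ψ (P.tgt j))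

/-- The edges behave like random relations of densities `p`, up to an error `ε` in cut norm. -/
def Pattern.CutClose (P : Pattern S W J) (ω : S → W → ℝ) (p : J → ℝ) (ε : ℝ) : Prop :=
  ∀ j, ∀ X Y : Finset W, |∑ x ∈ X, ∑ y ∈ Y, ω (P.src j) x * ω (P.tgt j) y *
    ((if P.rel j x y then 1 else 0) - p j)| ≤ ε

lemma Pattern.abs_wmean_respects_sub_prod_le (P : Pattern S W J) {ω : S → W → ℝ} (hω : IsLaw ω)
    {p : J → ℝ} (hp : ∀ j, 0 ≤ p j ∧ p j ≤ 1) {ε : ℝ} (hcut : P.CutClose ω p ε) (A : Finset J) :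
    |wmean ω (fun ψ => if P.Respects A ψ then 1 else 0) - ∏ j ∈ A, p j| ≤ #A * ε := by
  induction A using Finset.induction_on with
  | empty => simp [Pattern.Respects, wmean_const hω]
  | insert j A hj ih =>
    have hε : 0 ≤ ε := (abs_nonneg _).trans (hcut j ∅ ∅)
    rw [Finset.prod_insert hj, card_insert_of_notMem hj]
    set g : (S → W) → ℝ := fun ψ => if P.Respects A ψ then 1 else 0 with hg
    have hsplit : (fun ψ => if P.Respects (insert j A) ψ then (1 : ℝ) else 0) = fun ψ =>
        ((if P.rel j (ψ (P.src j)) (ψ (P.tgt j)) then 1 else 0) - p j) * g ψ + p j * g ψ := by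
      funext ψ
      have : P.Respects (insert j A) ψ ↔ P.rel j (ψ (P.src j)) (ψ (P.tgt j)) ∧ P.Respects A ψ := by
        simp [Pattern.Respects]
      simp only [this, hg]
      split_ifs <;> simp_all
    have hmain : |wmean ω fun ψ =>
        ((if P.rel j (ψ (P.src j)) (ψ (P.tgt j)) then 1 else 0) - p j) * g ψ| ≤ ε := by
      rw [wmean_update hω (P.src j)]
      simp only [Function.update_self, Function.update_of_ne (P.ne j).symm]
      rw [wmean_update hω (P.tgt j)]
      refine abs_wmean_le hω fun ψ => ?_
      let X : Finset W := univ.filter fun x => ∀ j' ∈ A,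
        P.src j' ≠ P.tgt j → P.tgt j' ≠ P.tgt j →
          P.rel j' (Function.update ψ (P.src j) x (P.src j'))
            (Function.update ψ (P.src j) x (P.tgt j'))
      let Y : Finset W := univ.filter fun y => ∀ j' ∈ A,
        (P.src j' = P.tgt j ∨ P.tgt j' = P.tgt j) →
          P.rel j' (Function.update ψ (P.tgt j) y (P.src j'))
            (Function.update ψ (P.tgt j) y (P.tgt j'))
      have hXY : ∀ x y, g (Function.update (Function.update ψ (P.tgt j) y) (P.src j) x) =
          (if x ∈ X then 1 else 0) * (if y ∈ Y then 1 else 0) := by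
        intro x y
        have : P.Respects A (Function.update (Function.update ψ (P.tgt j) y) (P.src j) x) ↔
            x ∈ X ∧ y ∈ Y := by
          simp only [X, Y, mem_filter, mem_univ, true_and, Pattern.Respects]
          rw [← forall_and]
          refine forall_congr' fun j' => ?_
          rw [← imp_and]
          refine imp_congr_right fun hj' => ?_
          by_cases hcase : P.src j' = P.tgt j ∨ P.tgt j' = P.tgt j
          · have hne : P.src j' ≠ P.src j ∧ P.tgt j' ≠ P.src j := by
              have hjj' : j' ≠ j := fun e => hj (e ▸ hj')
              constructor
              · intro e
                rcases hcase with h | h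
                · exact P.ne j (e.symm.trans h)
                · exact hjj' (P.simple j' j (by simp [e]) (by simp [h]))
              · intro e
                rcases hcase with h | h
                · exact hjj' (P.simple j' j (by simp [h]) (by simp [e]))
                · exact P.ne j (e.symm.trans h)
            rw [Function.update_of_ne hne.1, Function.update_of_ne hne.2]
            refine ⟨fun h => ⟨fun h1 h2 => absurd hcase (by tauto), fun _ => h⟩,
              fun h => h.2 hcase⟩
          · push Not at hcase
            have e : ∀ s, s ≠ P.tgt j →
                Function.update (Function.update ψ (P.tgt j) y) (P.src j) x s =
                  Function.update ψ (P.src j) x s := by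
              intro s hs
              by_cases h : s = P.src j
              · subst h; simp
              · rw [Function.update_of_ne h, Function.update_of_ne h, Function.update_of_ne hs]
            rw [e _ hcase.1, e _ hcase.2]
            refine ⟨fun h => ⟨fun _ _ => h, fun h' => absurd h' (by tauto)⟩,
              fun h => h.1 hcase.1 hcase.2⟩
        simp only [hg, this]
        split_ifs <;> simp_all
      refine le_trans (le_of_eq ?_) (hcut j X Y)
      congr 1
      simp only [Function.update_self, hXY]
      have hmem : ∀ (A : Finset W) (g : W → ℝ),
          ∑ x ∈ A, g x = ∑ x, (if x ∈ A then 1 else 0) * g x := by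
        intro A g
        simp
      rw [hmem X, Finset.sum_congr rfl fun x _ => congrArg _ (hmem Y _)]
      simp only [Finset.mul_sum]
      rw [Finset.sum_comm]
      refine Finset.sum_congr rfl fun x _ => Finset.sum_congr rfl fun y _ => ?_
      ring
    rw [hsplit, wmean_add, wmean_mul_left]
    have hpj := hp j
    calc _ = |wmean ω (fun ψ =>
          ((if P.rel j (ψ (P.src j)) (ψ (P.tgt j)) then 1 else 0) - p j) * g ψ) +
          p j * (wmean ω g - ∏ j ∈ A, p j)| := by congr 1; ring
      _ ≤ ε + p j * |wmean ω g - ∏ j ∈ A, p j| := by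
          refine (abs_add_le _ _).trans (add_le_add hmain ?_)
          rw [abs_mul, abs_of_nonneg hpj.1]
      _ ≤ ε + 1 * (#A * ε) := by
          gcongr
          exact hpj.2
      _ = _ := by push_cast; ring

end Counting

section Doubling

/-- The map that agrees with `ψ` on `D` and with `ψ'` elsewhere. -/
noncomputable def mix {S W : Type*} (D : Finset S) (ψ ψ' : S → W) : S → W := fun s => if s ∈ D then ψ s else ψ' s

lemma mix_mix {S W : Type*} (D : Finset S) (ψ ψ' ψ'' : S → W) : mix D (mix D ψ ψ') ψ'' = mix D ψ ψ'' := by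
  funext s
  simp only [mix]
  split_ifs <;> rfl

lemma mix_mix_mix {S W : Type*} (D : Finset S) (ψ ψ' : S → W) : mix D (mix D ψ ψ') (mix D ψ' ψ) = ψ := by
  funext s
  simp only [mix]
  split_ifs <;> rfl

variable {S W J : Type*} [Fintype S] [Fintype W] {ω : S → W → ℝ}

lemma wmean_nonneg (hω : IsLaw ω) {h : (S → W) → ℝ} (hh : ∀ ψ, 0 ≤ h ψ) : 0 ≤ wmean ω h :=
  Finset.sum_nonneg fun ψ _ => mul_nonneg (hω.prod_nonneg ψ) (hh ψ)

lemma wmean_mono_of_pos (hω : IsLaw ω) {h h' : (S → W) → ℝ}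
    (hh : ∀ ψ, (∀ s, 0 < ω s (ψ s)) → h ψ ≤ h' ψ) : wmean ω h ≤ wmean ω h' := by
  refine Finset.sum_le_sum fun ψ _ => ?_
  by_cases hψ : ∀ s, 0 < ω s (ψ s)
  · exact mul_le_mul_of_nonneg_left (hh ψ hψ) (hω.prod_nonneg ψ)
  · push Not at hψ
    obtain ⟨s, hs⟩ := hψ
    rw [Finset.prod_eq_zero (mem_univ s) (le_antisymm hs (hω.nonneg _ _)), zero_mul, zero_mul]

lemma wmean_wmean_mix (D : Finset S) (F : (S → W) → (S → W) → ℝ) :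
    wmean ω (fun ψ => wmean ω fun ψ' => F ψ ψ') =
      wmean ω (fun ψ => wmean ω fun ψ' => F (mix D ψ ψ') (mix D ψ' ψ)) := by
  simp only [wmean, Finset.mul_sum]
  rw [← Fintype.sum_prod_type', ← Fintype.sum_prod_type']
  have hinv : Function.Involutive fun p : (S → W) × (S → W) => (mix D p.1 p.2, mix D p.2 p.1) := by
    rintro ⟨ψ, ψ'⟩
    simp [mix_mix_mix]
  rw [← Equiv.sum_comp hinv.toPerm]
  refine Finset.sum_congr rfl fun p _ => ?_
  simp only [Function.Involutive.coe_toPerm]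
  rw [← mul_assoc, ← mul_assoc, ← Finset.prod_mul_distrib, ← Finset.prod_mul_distrib]
  congr 1
  refine Finset.prod_congr rfl fun s _ => ?_
  simp only [mix]
  split_ifs
  · rfl
  · exact mul_comm _ _

lemma sq_wmean_mul_le (hω : IsLaw ω) (b h : (S → W) → ℝ) :
    wmean ω (fun ψ => b ψ * h ψ) ^ 2 ≤ wmean ω (fun ψ => b ψ ^ 2) * wmean ω (fun ψ => h ψ ^ 2) :=
  Finset.sum_sq_le_sum_mul_sum_of_sq_le_mul _
    (fun ψ _ => mul_nonneg (hω.prod_nonneg ψ) (sq_nonneg _))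
    (fun ψ _ => mul_nonneg (hω.prod_nonneg ψ) (sq_nonneg _)) fun ψ _ => le_of_eq (by ring)

/-- Cauchy–Schwarz, doubling the coordinates outside `D`. -/
lemma sq_wmean_mul_le_of_mix (hω : IsLaw ω) (D : Finset S) (b G : (S → W) → ℝ)
    (hb : ∀ ψ ψ', b (mix D ψ ψ') = b ψ) :
    wmean ω (fun ψ => b ψ * G ψ) ^ 2 ≤
      wmean ω (fun ψ => b ψ ^ 2) * wmean ω (fun ψ => wmean ω fun ψ' => G ψ * G (mix D ψ ψ')) := by
  have h1 : wmean ω (fun ψ => b ψ * G ψ) =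
      wmean ω fun ψ => b ψ * wmean ω fun ψ' => G (mix D ψ ψ') := by
    have := wmean_wmean_mix (ω := ω) D fun ψ _ => b ψ * G ψ
    simp only [wmean_const hω, hb, wmean_mul_left] at this
    exact this
  have h2 : wmean ω (fun ψ => (wmean ω fun ψ' => G (mix D ψ ψ')) ^ 2) =
      wmean ω fun ψ => wmean ω fun ψ' => G ψ * G (mix D ψ ψ') := by
    have := wmean_wmean_mix (ω := ω) D fun ψ _ => G ψ * wmean ω fun ψ' => G (mix D ψ ψ')
    simp only [wmean_const hω, mix_mix] at this
    simp only [wmean_mul_left]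
    rw [this]
    congr 1
    funext ψ
    rw [sq, ← wmean_mul_left]
    congr 1
    funext ψ'
    ring
  rw [h1, ← h2]
  exact sq_wmean_mul_le hω _ _

lemma wmean_sumElim (h : (S ⊕ S → W) → ℝ) :
    wmean (Sum.elim ω ω) h = wmean ω fun ψ => wmean ω fun ψ' => h (Sum.elim ψ ψ') := by
  simp only [wmean, Finset.mul_sum]
  rw [← Fintype.sum_prod_type']
  refine Eq.symm (Finset.sum_equiv (Equiv.sumArrowEquivProdArrow S S W).symm (by simp) fun p _ => ?_)
  simp only [Fintype.prod_sum_type, Sum.elim_inl, Sum.elim_inr,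
    Equiv.sumArrowEquivProdArrow, Equiv.coe_fn_symm_mk]
  ring

/-- The edges with both ends in `D`. -/
noncomputable def Pattern.inside [Fintype J] (P : Pattern S W J) (D : Finset S) : Finset J :=
  univ.filter fun j => P.src j ∈ D ∧ P.tgt j ∈ D

/-- Two copies of the pattern `P` glued along `D`. -/
noncomputable def Pattern.double [Fintype J] (P : Pattern S W J) (D : Finset S) :
    Pattern (S ⊕ S) W (J ⊕ {j // j ∉ P.inside D}) where
  src := Sum.elim (fun j => Sum.inl (P.src j)) fun j =>
    if P.src j ∈ D then Sum.inl (P.src j) else Sum.inr (P.src j)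
  tgt := Sum.elim (fun j => Sum.inl (P.tgt j)) fun j =>
    if P.tgt j ∈ D then Sum.inl (P.tgt j) else Sum.inr (P.tgt j)
  rel := Sum.elim P.rel fun j => P.rel j
  ne := by
    rintro (j | ⟨j, hj⟩)
    · simpa using P.ne j
    · have := P.ne j
      simp only [Sum.elim_inr]
      split_ifs <;> simp_all
  simple := by
    rintro (j | ⟨j, hj⟩) (j' | ⟨j', hj'⟩) h1 h2
    · simp only [Sum.elim_inl, Set.mem_insert_iff, Set.mem_singleton_iff, Sum.inl.injEq] at h1 h2
      rw [P.simple j j' h1 h2]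
    · exfalso
      simp only [Pattern.inside, mem_filter, mem_univ, true_and, Sum.elim_inl, Sum.elim_inr,
        Set.mem_insert_iff, Set.mem_singleton_iff] at h1 h2 hj'
      have := P.ne j
      have := P.ne j'
      split_ifs at h1 h2 <;> simp_all
    · exfalso
      simp only [Pattern.inside, mem_filter, mem_univ, true_and, Sum.elim_inl, Sum.elim_inr,
        Set.mem_insert_iff, Set.mem_singleton_iff] at h1 h2 hj
      split_ifs at h1 h2 <;> simp_all
    · simp only [Sum.elim_inr, Set.mem_insert_iff, Set.mem_singleton_iff] at h1 h2
      have hinj : ∀ s s' : S, (if s ∈ D then (Sum.inl s : S ⊕ S) else Sum.inr s) =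
          (if s' ∈ D then Sum.inl s' else Sum.inr s') → s = s' := by
        intro s s' h
        split_ifs at h <;> simp_all
      have := P.simple j j' (h1.imp (hinj _ _) (hinj _ _)) (h2.imp (hinj _ _) (hinj _ _))
      subst this
      rfl

lemma Pattern.wmean_bad_sq_le [Fintype J] (P : Pattern S W J) (hω : IsLaw ω) {p : J → ℝ}
    (hp : ∀ j, 0 ≤ p j ∧ p j ≤ 1) {ε : ℝ} (hcut : P.CutClose ω p ε) (hε : 0 ≤ ε) (D : Finset S)
    (b : (S → W) → Prop) (hb : ∀ ψ ψ', b (mix D ψ ψ') ↔ b ψ) {θ : ℝ} (hθ0 : 0 ≤ θ)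
    (hθ : wmean ω (fun ψ => if b ψ ∧ P.Respects (P.inside D) ψ then 1 else 0) ≤
      θ * ∏ j ∈ P.inside D, p j) :
    wmean ω (fun ψ => if b ψ ∧ P.Respects univ ψ then 1 else 0) ^ 2 ≤
      θ * ((∏ j, p j) ^ 2 + 2 * Fintype.card J * ε) := by
  have hin : ∀ ψ ψ', P.Respects (P.inside D) (mix D ψ ψ') ↔ P.Respects (P.inside D) ψ := by
    intro ψ ψ'
    refine forall_congr' fun j => imp_congr_right fun hj => ?_
    simp only [Pattern.inside, mem_filter, mem_univ, true_and] at hj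
    simp [mix, hj]
  have h1 := sq_wmean_mul_le_of_mix hω D
    (fun ψ => if b ψ ∧ P.Respects (P.inside D) ψ then 1 else 0)
    (fun ψ => if P.Respects univ ψ then 1 else 0) (fun ψ ψ' => by simp only [hb, hin])
  have h2 : (fun ψ => (if b ψ ∧ P.Respects (P.inside D) ψ then (1 : ℝ) else 0) *
      (if P.Respects univ ψ then 1 else 0)) = fun ψ => if b ψ ∧ P.Respects univ ψ then 1 else 0 := by
    funext ψ
    have : P.Respects univ ψ → P.Respects (P.inside D) ψ := fun h j _ => h j (mem_univ _)
    split_ifs <;> simp_all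
  have h3 : (fun ψ => (if b ψ ∧ P.Respects (P.inside D) ψ then (1 : ℝ) else 0) ^ 2) =
      fun ψ => if b ψ ∧ P.Respects (P.inside D) ψ then 1 else 0 := by
    funext ψ
    split_ifs <;> simp
  rw [h2, h3] at h1
  have hω2 : IsLaw (Sum.elim ω ω) :=
    ⟨by rintro (s | s) x <;> exact hω.nonneg s x, by rintro (s | s) <;> exact hω.sum_eq s⟩
  have hcut2 : (P.double D).CutClose (Sum.elim ω ω)
      (Sum.elim p fun j : {j // j ∉ P.inside D} => p j) ε := by
    have he : ∀ s : S, Sum.elim ω ω (if s ∈ D then (Sum.inl s : S ⊕ S) else Sum.inr s) = ω s := by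
      intro s
      split_ifs <;> rfl
    rintro (j | j) X Y
    · exact hcut j X Y
    · simp only [Pattern.double, Sum.elim_inr, he]
      exact hcut j X Y
  have h4 := (P.double D).abs_wmean_respects_sub_prod_le hω2 (by
    rintro (j | j)
    · exact hp j
    · exact hp j) hcut2 univ
  rw [wmean_sumElim, Fintype.prod_sum_type] at h4
  simp only [Sum.elim_inl, Sum.elim_inr] at h4
  have h5 : ∀ ψ ψ', (if P.Respects univ ψ then (1 : ℝ) else 0) *
      (if P.Respects univ (mix D ψ ψ') then 1 else 0) =
        if (P.double D).Respects univ (Sum.elim ψ ψ') then 1 else 0 := by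
    intro ψ ψ'
    have : (P.double D).Respects univ (Sum.elim ψ ψ') ↔
        P.Respects univ ψ ∧ P.Respects univ (mix D ψ ψ') := by
      have he : ∀ s : S, Sum.elim ψ ψ' (if s ∈ D then (Sum.inl s : S ⊕ S) else Sum.inr s) =
          mix D ψ ψ' s := by
        intro s
        simp only [mix]
        split_ifs <;> rfl
      simp only [Pattern.Respects, mem_univ, true_imp_iff, Sum.forall, Pattern.double,
        Sum.elim_inl, Sum.elim_inr, he]
      refine and_congr_right fun hψ => ⟨fun h j => ?_, fun h j => h j⟩
      by_cases hj : j ∈ P.inside D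
      · exact (hin ψ ψ').mpr (fun j _ => hψ j) j hj
      · exact h ⟨j, hj⟩
    simp only [this]
    split_ifs <;> simp_all
  simp only [← h5] at h4
  set N := wmean ω fun ψ => wmean ω fun ψ' => (if P.Respects univ ψ then (1 : ℝ) else 0) *
      (if P.Respects univ (mix D ψ ψ') then 1 else 0)
  set pin := ∏ j ∈ P.inside D, p j with hpin
  set pout := ∏ j : {j // j ∉ P.inside D}, p j with hpout
  have hprod : pin * pout = ∏ j, p j := by
    rw [hpout, Finset.prod_subtype (univ.filter fun j => j ∉ P.inside D) (p := fun j => j ∉ P.inside D)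
      (by simp) p |>.symm, hpin]
    rw [← Finset.prod_filter_mul_prod_filter_not univ (fun j => j ∈ P.inside D)]
    simp
  have hpin0 : 0 ≤ pin := Finset.prod_nonneg fun j _ => (hp j).1
  have hpin1 : pin ≤ 1 := Finset.prod_le_one (fun j _ => (hp j).1) fun j _ => (hp j).2
  have hcard : (#(univ : Finset (J ⊕ {j // j ∉ P.inside D})) : ℝ) ≤ 2 * Fintype.card J := by
    rw [card_univ, Fintype.card_sum]
    have : Fintype.card {j // j ∉ P.inside D} ≤ Fintype.card J := Fintype.card_subtype_le _
    push_cast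
    have : (Fintype.card {j // j ∉ P.inside D} : ℝ) ≤ Fintype.card J := by exact_mod_cast this
    linarith
  have hN : N ≤ (∏ j, p j) * pout + 2 * Fintype.card J * ε := by
    have := (abs_le.mp h4).2
    nlinarith [mul_le_mul_of_nonneg_right hcard hε]
  have hP0 : 0 ≤ ∏ j, p j := Finset.prod_nonneg fun j _ => (hp j).1
  have hN0 : 0 ≤ N := wmean_nonneg hω fun ψ => wmean_nonneg hω fun ψ' =>
    mul_nonneg (by split_ifs <;> norm_num) (by split_ifs <;> norm_num)
  calc _ ≤ _ := h1
    _ ≤ θ * pin * ((∏ j, p j) * pout + 2 * Fintype.card J * ε) := by gcongr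
    _ = θ * ((∏ j, p j) * (pin * pout) + pin * (2 * Fintype.card J * ε)) := by ring
    _ ≤ θ * ((∏ j, p j) * (pin * pout) + 1 * (2 * Fintype.card J * ε)) := by gcongr
    _ = _ := by rw [hprod]; ring

/-- A pattern with positive densities can be embedded injectively while avoiding finitely many bad
events, each of which is rare relative to the edges it involves. -/
theorem Pattern.exists_embedding [Fintype J] {T : Type*} [Fintype T] (P : Pattern S W J)
    (hω : IsLaw ω) {p : J → ℝ} (hp : ∀ j, 0 < p j ∧ p j ≤ 1) {ε : ℝ} (hcut : P.CutClose ω p ε)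
    (hε : 0 ≤ ε) (D : T → Finset S) (b : T → (S → W) → Prop)
    (hb : ∀ τ ψ ψ', b τ (mix (D τ) ψ ψ') ↔ b τ ψ) {θ : ℝ} (hθ0 : 0 ≤ θ)
    (hθ : ∀ τ, wmean ω (fun ψ => if b τ ψ ∧ P.Respects (P.inside (D τ)) ψ then 1 else 0) ≤
      θ * ∏ j ∈ P.inside (D τ), p j)
    {δ : ℝ} (hδ : ∀ s x, ω s x ≤ δ) (h1 : 8 * Fintype.card J * ε ≤ ∏ j, p j)
    (h2 : 2 * Fintype.card J * ε ≤ (∏ j, p j) ^ 2) (h3 : 32 * (Fintype.card T : ℝ) ^ 2 * θ ≤ 1)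
    (h4 : 8 * (Fintype.card S : ℝ) ^ 2 * δ ≤ ∏ j, p j) :
    ∃ ψ : S → W, Function.Injective ψ ∧ (∀ s, 0 < ω s (ψ s)) ∧
      (∀ j, P.rel j (ψ (P.src j)) (ψ (P.tgt j))) ∧ ∀ τ, ¬ b τ ψ := by
  by_contra hcon
  push Not at hcon
  have hp' : ∀ j, 0 ≤ p j ∧ p j ≤ 1 := fun j => ⟨(hp j).1.le, (hp j).2⟩
  set ρ := ∏ j, p j with hρ
  have hρ0 : 0 < ρ := Finset.prod_pos fun j _ => (hp j).1
  set N : T → ℝ := fun τ => wmean ω fun ψ => if b τ ψ ∧ P.Respects univ ψ then 1 else 0 with hN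
  have hcount := (abs_le.mp (P.abs_wmean_respects_sub_prod_le hω hp' hcut univ)).1
  rw [card_univ] at hcount
  have hle : wmean ω (fun ψ => if P.Respects univ ψ then 1 else 0) ≤ wmean ω (fun ψ =>
      (∑ τ, if b τ ψ ∧ P.Respects univ ψ then 1 else 0) +
        ∑ s : S × S, if s.1 ≠ s.2 ∧ ψ s.1 = ψ s.2 then 1 else 0) := by
    refine wmean_mono_of_pos hω fun ψ hψ => ?_
    have n1 : 0 ≤ ∑ τ, (if b τ ψ ∧ P.Respects univ ψ then 1 else 0 : ℝ) := by positivity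
    have n2 : 0 ≤ ∑ s : S × S, (if s.1 ≠ s.2 ∧ ψ s.1 = ψ s.2 then 1 else 0 : ℝ) := by positivity
    by_cases hR : P.Respects univ ψ
    · rw [if_pos hR]
      by_cases hinj : Function.Injective ψ
      · obtain ⟨τ, hτ⟩ := hcon ψ hinj hψ fun j => hR j (mem_univ j)
        have := Finset.single_le_sum (f := fun τ => (if b τ ψ ∧ P.Respects univ ψ then 1 else 0 : ℝ))
          (fun τ _ => by positivity) (mem_univ τ)
        simp only [hτ, hR, and_self, if_true] at this n1 ⊢
        simp only [and_true] at this ⊢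
        linarith
      · simp only [Function.Injective, not_forall] at hinj
        obtain ⟨s, s', hss, hne⟩ := hinj
        have := Finset.single_le_sum
          (f := fun s : S × S => (if s.1 ≠ s.2 ∧ ψ s.1 = ψ s.2 then 1 else 0 : ℝ))
          (fun s _ => by positivity) (mem_univ (s, s'))
        simp only [hss, hne, ne_eq, not_false_eq_true, and_self, if_true] at this
        linarith
    · rw [if_neg hR]
      positivity
  rw [wmean_add, wmean_sum, wmean_sum] at hle
  have hdeg : ∀ s : S × S, wmean ω (fun ψ => if s.1 ≠ s.2 ∧ ψ s.1 = ψ s.2 then 1 else 0) ≤ δ := by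
    rintro ⟨s, s'⟩
    by_cases hne : s = s'
    · simp only [hne, ne_eq, not_true_eq_false, false_and, if_false, wmean_const hω]
      obtain ⟨x, -⟩ : ∃ x : W, x ∈ (univ : Finset W) := by
        by_contra hemp
        push Not at hemp
        have := hω.sum_eq s
        rw [Finset.sum_eq_zero fun x hx => absurd hx (hemp x)] at this
        norm_num at this
      exact (hω.nonneg s x).trans (hδ s x)
    · rw [wmean_update hω s, ← wmean_const hω δ]
      refine wmean_mono hω fun ψ => ?_
      simp only [ne_eq, hne, not_false_eq_true, true_and, Function.update_self,
        Function.update_of_ne (Ne.symm hne), mul_ite, mul_one, mul_zero]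
      rw [Finset.sum_ite_eq' univ]
      simpa using hδ _ _
  have hbad : ∀ τ, Fintype.card T * N τ ≤ ρ / 4 := by
    intro τ
    have hsq := P.wmean_bad_sq_le hω hp' hcut hε (D τ) (b τ) (hb τ) hθ0 (hθ τ)
    refine le_of_abs_le (abs_le_of_sq_le_sq (by
      calc (Fintype.card T * N τ) ^ 2 = (Fintype.card T : ℝ) ^ 2 * N τ ^ 2 := by ring
        _ ≤ (Fintype.card T : ℝ) ^ 2 * (θ * (ρ ^ 2 + ρ ^ 2)) := by
            gcongr
            exact hsq.trans (by gcongr)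
        _ = (32 * (Fintype.card T : ℝ) ^ 2 * θ) * (ρ ^ 2 / 16) := by ring
        _ ≤ 1 * (ρ ^ 2 / 16) := by gcongr
        _ = (ρ / 4) ^ 2 := by ring) (by positivity))
  have hbad' : ∑ τ, N τ ≤ ρ / 4 := by
    rcases isEmpty_or_nonempty T with hT | hT
    · simp only [univ_eq_empty, sum_empty]
      positivity
    · have hT0 : (0 : ℝ) < Fintype.card T := by exact_mod_cast Fintype.card_pos
      have := Finset.sum_le_sum fun τ (_ : τ ∈ (univ : Finset T)) => hbad τ
      rw [← Finset.mul_sum, sum_const, card_univ, nsmul_eq_mul] at this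
      exact le_of_mul_le_mul_left this hT0
  have hdeg' := Finset.sum_le_sum fun s (_ : s ∈ (univ : Finset (S × S))) => hdeg s
  rw [sum_const, card_univ, Fintype.card_prod, nsmul_eq_mul] at hdeg'
  push_cast at hdeg'
  nlinarith

end Doubling

section Blowup

lemma wmean_three {S W : Type*} [Fintype S] [Fintype W] {ω : S → W → ℝ} (hω : IsLaw ω)
    {s₁ s₂ s₃ : S} (h₁₂ : s₁ ≠ s₂) (h₁₃ : s₁ ≠ s₃) (h₂₃ : s₂ ≠ s₃) (h : W → W → W → ℝ) :
    wmean ω (fun ψ => h (ψ s₁) (ψ s₂) (ψ s₃)) =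
      ∑ x, ∑ y, ∑ z, ω s₁ x * ω s₂ y * ω s₃ z * h x y z := by
  rw [wmean_update hω s₁]
  simp only [Function.update_self, Function.update_of_ne h₁₂.symm, Function.update_of_ne h₁₃.symm]
  rw [wmean_update hω s₂]
  simp only [Function.update_self, Function.update_of_ne h₂₃.symm]
  rw [wmean_update hω s₃]
  simp only [Function.update_self]
  rw [wmean_const hω]
  simp only [Finset.mul_sum]
  rw [Finset.sum_comm_cycle]
  refine Finset.sum_congr rfl fun x _ => ?_
  rw [Finset.sum_comm]
  refine Finset.sum_congr rfl fun y _ => Finset.sum_congr rfl fun z _ => by ring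

variable {W K ι : Type*} [Fintype W]

/-- All rectangles have small discrepancy in the colour `a` between the cells `i` and `j`. -/
def RegPair (q : W → W → K) (c : W → ι) (i j : ι) (a : K) (ε : ℝ) : Prop :=
  ∀ X Y : Finset W, |disc q c i j a X Y| ≤ ε * (#(cell c i) * #(cell c j))

/-- The triples in given cells with given colours on which `E` disagrees with `F`. -/
noncomputable def triadErr (E : W → W → W → Prop) (q : W → W → K) (F : K → K → K → Prop) (c : W → ι)
    (i j k : ι) (a b d : K) : Finset (W × W × W) :=
  univ.filter fun p => (c p.1 = i ∧ c p.2.1 = j ∧ c p.2.2 = k) ∧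
    (q p.1 p.2.1 = a ∧ q p.1 p.2.2 = b ∧ q p.2.1 p.2.2 = d) ∧ ¬(E p.1 p.2.1 p.2.2 ↔ F a b d)

/-- The uniform law on a cell. -/
noncomputable def cellLaw (c : W → ι) (i : ι) (x : W) : ℝ := if c x = i then (#(cell c i) : ℝ)⁻¹ else 0

lemma cellLaw_nonneg (c : W → ι) (i : ι) (x : W) : 0 ≤ cellLaw c i x := by
  unfold cellLaw; positivity

lemma sum_cellLaw_mul (c : W → ι) (i : ι) (h : W → ℝ) :
    ∑ x, cellLaw c i x * h x = (#(cell c i) : ℝ)⁻¹ * ∑ x ∈ cell c i, h x := by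
  simp only [cellLaw, cell, Finset.sum_filter, Finset.mul_sum]
  refine Finset.sum_congr rfl fun x _ => ?_
  split_ifs <;> simp

lemma sum_cellLaw (c : W → ι) (i : ι) (hi : 0 < #(cell c i)) : ∑ x, cellLaw c i x = 1 := by
  have := sum_cellLaw_mul c i fun _ => 1
  simp only [mul_one, sum_const, nsmul_eq_mul] at this
  rw [this]
  exact inv_mul_cancel₀ (by positivity)

lemma sum_sum_cellLaw_disc (q : W → W → K) (c : W → ι) (i j : ι) (a : K) (X Y : Finset W) :
    ∑ x ∈ X, ∑ y ∈ Y, cellLaw c i x * cellLaw c j y *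
        ((if q x y = a then 1 else 0) - pdens q c i j a) =
      (#(cell c i) : ℝ)⁻¹ * (#(cell c j) : ℝ)⁻¹ * disc q c i j a X Y := by
  have key : ∀ (i : ι) (X : Finset W) (h : W → ℝ), ∑ x ∈ X, cellLaw c i x * h x =
      (#(cell c i) : ℝ)⁻¹ * ∑ x ∈ cell c i ∩ X, h x := by
    intro i X h
    simp only [cellLaw, ite_mul, zero_mul]
    rw [← Finset.sum_filter, ← Finset.mul_sum]
    congr 2
    ext x
    simp [mem_cell, and_comm]
  simp only [mul_assoc, ← Finset.mul_sum, key, disc, colInd]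

lemma sum_cellLaw_triadErr (E : W → W → W → Prop) (q : W → W → K) (F : K → K → K → Prop)
    (c : W → ι) (i j k : ι) (a b d : K) :
    ∑ x, ∑ y, ∑ z, cellLaw c i x * cellLaw c j y * cellLaw c k z *
      (if (¬(E x y z ↔ F a b d)) ∧ q x y = a ∧ q x z = b ∧ q y z = d then 1 else 0) =
    (#(cell c i) : ℝ)⁻¹ * (#(cell c j) : ℝ)⁻¹ * (#(cell c k) : ℝ)⁻¹ *
      #(triadErr E q F c i j k a b d) := by
  rw [triadErr, Finset.card_filter]
  push_cast
  rw [Fintype.sum_prod_type]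
  simp only [Fintype.sum_prod_type, Finset.mul_sum]
  refine Finset.sum_congr rfl fun x _ => Finset.sum_congr rfl fun y _ =>
    Finset.sum_congr rfl fun z _ => ?_
  simp only [cellLaw]
  by_cases hx : c x = i <;> by_cases hy : c y = j <;> by_cases hz : c z = k <;> simp [hx, hy, hz]
  congr 1
  exact propext (by tauto)

/-- The complete pattern used to find blowups. -/
def blowupPattern {U I : Type*} (m : ℕ) (q : W → W → K) (a : U → K) (b d : I → K)
    (Γ : Fin m → Fin m → U) : Pattern (Fin m ⊕ Fin m ⊕ (I × Fin m)) W
      ((Fin m × Fin m) ⊕ (Fin m × (I × Fin m)) ⊕ (Fin m × (I × Fin m))) where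
  src := Sum.elim (fun e => Sum.inl e.1)
    (Sum.elim (fun e => Sum.inl e.1) fun e => Sum.inr (Sum.inl e.1))
  tgt := Sum.elim (fun e => Sum.inr (Sum.inl e.2))
    (Sum.elim (fun e => Sum.inr (Sum.inr e.2)) fun e => Sum.inr (Sum.inr e.2))
  rel := Sum.elim (fun e x y => q x y = a (Γ e.1 e.2))
    (Sum.elim (fun e x y => q x y = b e.2.1) fun e x y => q x y = d e.2.1)
  ne := by rintro (e | e | e) <;> simp
  simple := by
    rintro (⟨e, e'⟩ | ⟨e, e'⟩ | ⟨e, e'⟩) (⟨f, f'⟩ | ⟨f, f'⟩ | ⟨f, f'⟩) <;> simp <;> tauto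

end Blowup

section Blowup

/-- The colour `a` is regular and not too sparse between the cells `i` and `j`. -/
structure GoodPair {W K ι : Type*} [Fintype W] (q : W → W → K) (c : W → ι) (c₀ ε : ℝ) (i j : ι)
    (a : K) : Prop where
  reg : RegPair q c i j a ε
  dens : c₀ ≤ pdens q c i j a

theorem exists_blowup {U I : Type*} [Fintype I] (m : ℕ) :
    ∃ θ : ℝ, 0 < θ ∧ ∀ c₀ : ℝ, 0 < c₀ → c₀ ≤ 1 → ∃ ε : ℝ, 0 < ε ∧ ∀ c₁ : ℝ, 0 < c₁ →
      ∃ n₀ : ℕ, ∀ {W K ι : Type*} [Fintype W]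
      (E : W → W → W → Prop) (q : W → W → K) (F : K → K → K → Prop) (c : W → ι) (i j : ι)
      (a : U → K) (k : I → ι) (b d : I → K),
      n₀ ≤ Fintype.card W →
      (∀ u, GoodPair q c c₀ ε i j (a u)) → (∀ v, GoodPair q c c₀ ε i (k v) (b v)) →
      (∀ v, GoodPair q c c₀ ε j (k v) (d v)) →
      c₁ * Fintype.card W ≤ #(cell c i) → c₁ * Fintype.card W ≤ #(cell c j) →
      (∀ v, c₁ * Fintype.card W ≤ #(cell c (k v))) →
      (∀ u v, (#(triadErr E q F c i j (k v) (a u) (b v) (d v)) : ℝ) ≤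
        θ * (#(cell c i) * #(cell c j) * #(cell c (k v))) *
          (pdens q c i j (a u) * pdens q c i (k v) (b v) * pdens q c j (k v) (d v))) →
      ∀ Γ : Fin m → Fin m → U, ∃ ψ : Fin m ⊕ Fin m ⊕ (I × Fin m) → W, Function.Injective ψ ∧
        ∀ s t v, E (ψ (Sum.inl s)) (ψ (Sum.inr (Sum.inl t))) (ψ (Sum.inr (Sum.inr v))) ↔
          F (a (Γ s t)) (b v.1) (d v.1) := by
  let T := Fin m × Fin m × (I × Fin m)
  let J := (Fin m × Fin m) ⊕ (Fin m × (I × Fin m)) ⊕ (Fin m × (I × Fin m))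
  let S := Fin m ⊕ Fin m ⊕ (I × Fin m)
  let θ : ℝ := (32 * (Fintype.card T : ℝ) ^ 2 + 1)⁻¹
  refine ⟨θ, by positivity, fun c₀ hc₀ hc₀1 => ?_⟩
  let pm : ℝ := c₀ ^ Fintype.card J
  have hpm : 0 < pm := by positivity
  have hpm1 : pm ≤ 1 := pow_le_one₀ hc₀.le hc₀1
  let ε : ℝ := pm ^ 2 / (8 * Fintype.card J + 1)
  refine ⟨ε, by positivity, fun c₁ hc₁ => ?_⟩
  obtain ⟨n₀, hn₀⟩ := exists_nat_gt (8 * (Fintype.card S : ℝ) ^ 2 / (c₁ * pm))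
  refine ⟨n₀ + 1, ?_⟩
  intro W K ι _ E q F c i j a k b d hn ha hb hd hi hj hk herr Γ
  have hn0 : (0 : ℝ) < Fintype.card W := by
    have : 0 < Fintype.card W := by omega
    exact_mod_cast this
  have hc1n : 0 < c₁ * Fintype.card W := by positivity
  let κ : S → ι := Sum.elim (fun _ => i) (Sum.elim (fun _ => j) fun v => k v.1)
  have hκ : ∀ s, c₁ * Fintype.card W ≤ #(cell c (κ s)) := by
    rintro (s | s | s)
    · exact hi
    · exact hj
    · exact hk _
  have hκ0 : ∀ s, 0 < #(cell c (κ s)) := fun s => by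
    have := hc1n.trans_le (hκ s)
    exact_mod_cast this
  let ω : S → W → ℝ := fun s => cellLaw c (κ s)
  have hω : IsLaw ω := ⟨fun s x => cellLaw_nonneg _ _ _, fun s => sum_cellLaw c _ (hκ0 s)⟩
  let P := blowupPattern m q a b d Γ
  let p : J → ℝ := Sum.elim (fun e => pdens q c i j (a (Γ e.1 e.2)))
    (Sum.elim (fun e => pdens q c i (k e.2.1) (b e.2.1)) fun e => pdens q c j (k e.2.1) (d e.2.1))
  have hp0 : ∀ e, c₀ ≤ p e := by
    rintro (e | e | e)
    · exact (ha _).dens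
    · exact (hb _).dens
    · exact (hd _).dens
  have hp : ∀ e, 0 < p e ∧ p e ≤ 1 := by
    refine fun e => ⟨hc₀.trans_le (hp0 e), ?_⟩
    rcases e with e | e | e <;> exact pdens_le_one _ _ _ _ _
  have hpp : pm ≤ ∏ e, p e := by
    calc pm = ∏ _e : J, c₀ := by simp [pm]
      _ ≤ _ := Finset.prod_le_prod (fun _ _ => hc₀.le) fun e _ => hp0 e
  have hpp2 : pm ^ 2 ≤ (∏ e, p e) ^ 2 := by gcongr
  have hdisc : ∀ (i j : ι) (a : K) (X Y : Finset W), 0 < #(cell c i) → 0 < #(cell c j) →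
      RegPair q c i j a ε → |∑ x ∈ X, ∑ y ∈ Y, cellLaw c i x * cellLaw c j y *
        ((if q x y = a then 1 else 0) - pdens q c i j a)| ≤ ε := by
    intro i j a X Y hi hj h
    have hi' : (0 : ℝ) < #(cell c i) := by exact_mod_cast hi
    have hj' : (0 : ℝ) < #(cell c j) := by exact_mod_cast hj
    rw [sum_sum_cellLaw_disc, abs_mul, abs_of_nonneg (by positivity)]
    calc _ ≤ (#(cell c i) : ℝ)⁻¹ * (#(cell c j) : ℝ)⁻¹ * (ε * (#(cell c i) * #(cell c j))) := by
          gcongr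
          exact h X Y
      _ = ε := by field_simp
  have hcut : P.CutClose ω p ε := by
    rintro (e | e | e) X Y
    · exact hdisc i j _ X Y (hκ0 (Sum.inl e.1)) (hκ0 (Sum.inr (Sum.inl e.2))) (ha _).reg
    · exact hdisc i _ _ X Y (hκ0 (Sum.inl e.1)) (hκ0 (Sum.inr (Sum.inr e.2))) (hb _).reg
    · exact hdisc j _ _ X Y (hκ0 (Sum.inr (Sum.inl e.1))) (hκ0 (Sum.inr (Sum.inr e.2))) (hd _).reg
  let D : T → Finset S := fun τ =>
    {Sum.inl τ.1, Sum.inr (Sum.inl τ.2.1), Sum.inr (Sum.inr τ.2.2)}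
  let bad : T → (S → W) → Prop := fun τ ψ =>
    ¬(E (ψ (Sum.inl τ.1)) (ψ (Sum.inr (Sum.inl τ.2.1))) (ψ (Sum.inr (Sum.inr τ.2.2))) ↔
      F (a (Γ τ.1 τ.2.1)) (b τ.2.2.1) (d τ.2.2.1))
  have hin : ∀ τ, P.inside (D τ) = {Sum.inl (τ.1, τ.2.1), Sum.inr (Sum.inl (τ.1, τ.2.2)),
      Sum.inr (Sum.inr (τ.2.1, τ.2.2))} := by
    rintro ⟨s, t, v⟩
    ext (⟨e, e'⟩ | ⟨e, e'⟩ | ⟨e, e'⟩) <;>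
      simp [P, Pattern.inside, D, blowupPattern]
  have hbad : ∀ τ, wmean ω (fun ψ => if bad τ ψ ∧ P.Respects (P.inside (D τ)) ψ then 1 else 0) ≤
      θ * ∏ e ∈ P.inside (D τ), p e := by
    rintro ⟨s, t, v⟩
    rw [hin]
    have hi' : (0 : ℝ) < #(cell c i) := by exact_mod_cast hκ0 (Sum.inl s)
    have hj' : (0 : ℝ) < #(cell c j) := by exact_mod_cast hκ0 (Sum.inr (Sum.inl t))
    have hk' : (0 : ℝ) < #(cell c (k v.1)) := by exact_mod_cast hκ0 (Sum.inr (Sum.inr v))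
    have h1 := wmean_three hω (s₁ := Sum.inl s) (s₂ := Sum.inr (Sum.inl t))
      (s₃ := Sum.inr (Sum.inr v)) nofun nofun nofun fun x y z =>
        if (¬(E x y z ↔ F (a (Γ s t)) (b v.1) (d v.1))) ∧ q x y = a (Γ s t) ∧ q x z = b v.1 ∧
          q y z = d v.1 then 1 else 0
    have h2 := sum_cellLaw_triadErr E q F c i j (k v.1) (a (Γ s t)) (b v.1) (d v.1)
    have h3 : (fun ψ : S → W => if bad (s, t, v) ψ ∧ P.Respects {Sum.inl (s, t),
        Sum.inr (Sum.inl (s, v)), Sum.inr (Sum.inr (t, v))} ψ then (1 : ℝ) else 0) = fun ψ =>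
        if (¬(E (ψ (Sum.inl s)) (ψ (Sum.inr (Sum.inl t))) (ψ (Sum.inr (Sum.inr v))) ↔
            F (a (Γ s t)) (b v.1) (d v.1))) ∧
          q (ψ (Sum.inl s)) (ψ (Sum.inr (Sum.inl t))) = a (Γ s t) ∧
          q (ψ (Sum.inl s)) (ψ (Sum.inr (Sum.inr v))) = b v.1 ∧
          q (ψ (Sum.inr (Sum.inl t))) (ψ (Sum.inr (Sum.inr v))) = d v.1 then 1 else 0 := by
      funext ψ
      simp [bad, P, Pattern.Respects, blowupPattern]
    simp only [] at h3 ⊢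
    rw [h3, h1]
    refine (le_of_eq h2).trans ?_
    rw [Finset.prod_insert (by simp), Finset.prod_insert (by simp), Finset.prod_singleton]
    calc _ ≤ (#(cell c i) : ℝ)⁻¹ * (#(cell c j) : ℝ)⁻¹ * (#(cell c (k v.1)) : ℝ)⁻¹ *
          (θ * (#(cell c i) * #(cell c j) * #(cell c (k v.1))) *
          (pdens q c i j (a (Γ s t)) * pdens q c i (k v.1) (b v.1) *
            pdens q c j (k v.1) (d v.1))) := by
          gcongr
          exact herr _ _
      _ = θ * (pdens q c i j (a (Γ s t)) * pdens q c i (k v.1) (b v.1) *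
            pdens q c j (k v.1) (d v.1)) := by field_simp
      _ = _ := by simp only [p, Sum.elim_inl, Sum.elim_inr]; ring
  have hε8 : 8 * Fintype.card J * ε ≤ pm ^ 2 := by
    have : 8 * Fintype.card J * ε = (8 * Fintype.card J / (8 * Fintype.card J + 1)) * pm ^ 2 := by
      simp only [ε]; ring
    rw [this]
    refine mul_le_of_le_one_left (by positivity) ?_
    rw [div_le_one (by positivity)]
    linarith
  have hJε : 0 ≤ Fintype.card J * ε := by positivity
  obtain ⟨ψ, h1, h2, h3, h4⟩ := P.exists_embedding hω hp hcut (by positivity) D bad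
    (by
      intro τ ψ ψ'
      simp [bad, mix, D])
    (θ := θ) (by positivity) (fun τ => by convert hbad τ) (δ := (c₁ * Fintype.card W)⁻¹)
    (by
      intro s x
      simp only [ω, cellLaw]
      split_ifs
      · exact inv_anti₀ hc1n (hκ s)
      · positivity)
    (by nlinarith [hpp]) (by nlinarith)
    (by
      simp only [θ]
      rw [← div_eq_mul_inv, div_le_one (by positivity)]
      linarith)
    (by
      refine le_trans ?_ hpp
      rw [← div_eq_mul_inv, div_le_iff₀ hc1n]
      have h5 : (n₀ : ℝ) ≤ Fintype.card W := by
        exact_mod_cast (Nat.le_succ n₀).trans hn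
      have h6 := (hn₀.le.trans h5)
      rw [div_le_iff₀ (by positivity)] at h6
      linarith)
  exact ⟨ψ, h1, fun s t v => not_not.mp (h4 (s, t, v))⟩

end Blowup

section Rounding

/-- The `0/1`-valued indicator of a proposition. -/
noncomputable def ind (P : Prop) : ℝ := if P then 1 else 0

lemma ind_nonneg (P : Prop) : 0 ≤ ind P := by unfold ind; split_ifs <;> norm_num

lemma ind_le_one (P : Prop) : ind P ≤ 1 := by unfold ind; split_ifs <;> norm_num

lemma ind_true {P : Prop} (h : P) : ind P = 1 := if_pos h

lemma ind_false {P : Prop} (h : ¬P) : ind P = 0 := if_neg h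

variable {A C : Type*} [Fintype A]

/-- The mass of the class `γ`. -/
noncomputable def classMass (p : A → ℝ) (κ : A → C) (γ : C) : ℝ := ∑ a, ind (κ a = γ) * p a

/-- The transition kernel that resamples an element within its class. -/
noncomputable def resample (p : A → ℝ) (κ : A → C) (a a' : A) : ℝ :=
  ind (κ a = κ a') * (p a' / classMass p κ (κ a'))

lemma classMass_nonneg {p : A → ℝ} (hp : ∀ a, 0 ≤ p a) (κ : A → C) (γ : C) :
    0 ≤ classMass p κ γ :=
  sum_nonneg fun a _ => mul_nonneg (ind_nonneg _) (hp a)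

lemma resample_nonneg {p : A → ℝ} (hp : ∀ a, 0 ≤ p a) (κ : A → C) (a a' : A) :
    0 ≤ resample p κ a a' :=
  mul_nonneg (ind_nonneg _) (div_nonneg (hp _) (classMass_nonneg hp _ _))

lemma mul_resample_symm (p : A → ℝ) (κ : A → C) (a a' : A) :
    p a * resample p κ a a' = p a' * resample p κ a' a := by
  unfold resample ind
  by_cases h : κ a = κ a'
  · rw [if_pos h, if_pos h.symm, h]; ring
  · rw [if_neg h, if_neg (Ne.symm h)]; ring

lemma sum_resample_le_one (p : A → ℝ) (κ : A → C) (a : A) :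
    ∑ a', resample p κ a a' ≤ 1 := by
  have h : ∀ a', resample p κ a a' = ind (κ a' = κ a) * p a' / classMass p κ (κ a) := by
    intro a'
    unfold resample ind
    by_cases h : κ a = κ a'
    · rw [if_pos h, if_pos h.symm, h]; ring
    · rw [if_neg h, if_neg (Ne.symm h)]; ring
  simp only [h]
  rw [← Finset.sum_div]
  exact div_self_le_one _

lemma sum_mul_resample_le {p : A → ℝ} (hp : ∀ a, 0 ≤ p a) (κ : A → C) (b : A) :
    ∑ a, p a * resample p κ a b ≤ p b := by
  simp only [mul_resample_symm p κ _ b, ← Finset.mul_sum]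
  exact mul_le_of_le_one_right (hp b) (sum_resample_le_one p κ b)

/-- A predicate can be replaced by one depending only on the class, at a cost measured by the
resampling kernel. -/
lemma exists_classPredicate [Fintype C] {p : A → ℝ} (hp : ∀ a, 0 ≤ p a) (κ : A → C) (F : A → Prop) :
    ∃ φ : C → Prop, ∑ a, p a * ind (¬(F a ↔ φ (κ a))) ≤
      ∑ a, ∑ a', p a * resample p κ a a' * ind (¬(F a ↔ F a')) := by
  have key : ∀ γ : C, ∃ v : Prop, ∑ a with κ a = γ, p a * ind (¬(F a ↔ v)) ≤
      ∑ a with κ a = γ, ∑ a', p a * resample p κ a a' * ind (¬(F a ↔ F a')) := by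
    intro γ
    have hR : 0 ≤ ∑ a with κ a = γ, ∑ a', p a * resample p κ a a' * ind (¬(F a ↔ F a')) :=
      sum_nonneg fun a _ => sum_nonneg fun a' _ =>
        mul_nonneg (mul_nonneg (hp a) (resample_nonneg hp _ _ _)) (ind_nonneg _)
    have hm : classMass p κ γ = ∑ a with κ a = γ, p a := by
      unfold classMass ind
      rw [Finset.sum_filter]
      exact Finset.sum_congr rfl fun a _ => by split_ifs <;> simp
    rcases (classMass_nonneg hp κ γ).eq_or_lt with h0 | h0
    · refine ⟨True, le_trans ?_ hR⟩
      calc _ ≤ ∑ a with κ a = γ, p a :=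
            Finset.sum_le_sum fun a _ => mul_le_of_le_one_right (hp a) (ind_le_one _)
        _ = 0 := by rw [← hm, ← h0]
    · by_contra hcon
      simp only [not_exists, not_le] at hcon
      set R := ∑ a with κ a = γ, ∑ a', p a * resample p κ a a' * ind (¬(F a ↔ F a')) with hRdef
      have h1 : R = ∑ a' with κ a' = γ, p a' / classMass p κ γ *
          ∑ a with κ a = γ, p a * ind (¬(F a ↔ F a')) := by
        rw [hRdef, Finset.sum_comm]
        simp only [Finset.sum_filter _ (s := univ), Finset.mul_sum]
        rw [← Finset.sum_filter]
        rw [Finset.sum_filter]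
        refine Finset.sum_congr rfl fun a' _ => ?_
        by_cases h' : κ a' = γ
        · rw [if_pos h']
          refine Finset.sum_congr rfl fun a _ => ?_
          by_cases h : κ a = γ
          · rw [if_pos h, if_pos h, resample, h', h, ind_true rfl]; ring
          · rw [if_neg h, if_neg h, mul_zero]
        · rw [if_neg h']
          refine Finset.sum_eq_zero fun a _ => ?_
          by_cases h : κ a = γ
          · rw [if_pos h, resample, ind_false (by rw [h]; exact Ne.symm h')]; ring
          · rw [if_neg h]
      have h2 : ∑ a' with κ a' = γ, p a' / classMass p κ γ * R = R := by
        rw [← Finset.sum_mul, ← Finset.sum_div, ← hm, div_self h0.ne', one_mul]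
      obtain ⟨a₀, ha₀, hpa₀⟩ : ∃ a ∈ (univ.filter fun a => κ a = γ), 0 < p a := by
        by_contra hz
        push Not at hz
        rw [hm] at h0
        exact absurd (Finset.sum_nonpos hz) (not_le.mpr h0)
      have h3 : ∑ a' with κ a' = γ, p a' / classMass p κ γ * R <
          ∑ a' with κ a' = γ, p a' / classMass p κ γ *
            ∑ a with κ a = γ, p a * ind (¬(F a ↔ F a')) :=
        Finset.sum_lt_sum
          (fun a' _ => mul_le_mul_of_nonneg_left (hcon (F a')).le (div_nonneg (hp _) h0.le))
          ⟨a₀, ha₀, mul_lt_mul_of_pos_left (hcon (F a₀)) (div_pos hpa₀ h0)⟩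
      linarith
  choose φ hφ using key
  refine ⟨φ, ?_⟩
  rw [← Finset.sum_fiberwise univ κ, ← Finset.sum_fiberwise univ κ fun a =>
    ∑ a', p a * resample p κ a a' * ind (¬(F a ↔ F a'))]
  refine Finset.sum_le_sum fun γ _ => le_trans (le_of_eq ?_) (hφ γ)
  refine Finset.sum_congr rfl fun a ha => ?_
  rw [(mem_filter.mp ha).2]

variable {B D C' C'' : Type*} [Fintype B] [Fintype D]

lemma classMass_prod (p : A → ℝ) (p' : B → ℝ) (κ : A → C) (κ' : B → C') (γ : C) (γ' : C') :
    classMass (fun t : A × B => p t.1 * p' t.2) (fun t => (κ t.1, κ' t.2)) (γ, γ') =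
      classMass p κ γ * classMass p' κ' γ' := by
  unfold classMass
  rw [Fintype.sum_prod_type, Finset.sum_mul_sum]
  refine Finset.sum_congr rfl fun a _ => Finset.sum_congr rfl fun b _ => ?_
  unfold ind
  by_cases h : κ a = γ <;> by_cases h' : κ' b = γ' <;> simp [h, h']

lemma resample_prod (p : A → ℝ) (p' : B → ℝ) (κ : A → C) (κ' : B → C') (t t' : A × B) :
    resample (fun t : A × B => p t.1 * p' t.2) (fun t => (κ t.1, κ' t.2)) t t' =
      resample p κ t.1 t'.1 * resample p' κ' t.2 t'.2 := by
  unfold resample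
  rw [classMass_prod]
  have : ind ((κ t.1, κ' t.2) = (κ t'.1, κ' t'.2)) = ind (κ t.1 = κ t'.1) * ind (κ' t.2 = κ' t'.2) := by
    unfold ind
    by_cases h : κ t.1 = κ t'.1 <;> by_cases h' : κ' t.2 = κ' t'.2 <;> simp [h, h']
  rw [this, mul_div_mul_comm]
  ring

lemma sum_reorder₁ (f : A → B → D → A → B → D → ℝ) :
    ∑ a, ∑ b, ∑ d, ∑ a', ∑ b', ∑ d', f a b d a' b' d' =
      ∑ b, ∑ b', ∑ a', ∑ d, ∑ a, ∑ d', f a b d a' b' d' := by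
  let e : A × B × D × A × B × D ≃ B × B × A × D × A × D :=
    ⟨fun t => (t.2.1, t.2.2.2.2.1, t.2.2.2.1, t.2.2.1, t.1, t.2.2.2.2.2),
      fun t => (t.2.2.2.2.1, t.1, t.2.2.2.1, t.2.2.1, t.2.1, t.2.2.2.2.2), fun _ => rfl, fun _ => rfl⟩
  have := Fintype.sum_equiv e (fun t => f t.1 t.2.1 t.2.2.1 t.2.2.2.1 t.2.2.2.2.1 t.2.2.2.2.2)
    (fun t => f t.2.2.2.2.1 t.1 t.2.2.2.1 t.2.2.1 t.2.1 t.2.2.2.2.2) fun _ => rfl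
  simpa only [Fintype.sum_prod_type] using this

lemma sum_reorder₂ (f : A → B → D → A → B → D → ℝ) :
    ∑ a, ∑ b, ∑ d, ∑ a', ∑ b', ∑ d', f a b d a' b' d' =
      ∑ d, ∑ d', ∑ a', ∑ b', ∑ a, ∑ b, f a b d a' b' d' := by
  let e : A × B × D × A × B × D ≃ D × D × A × B × A × B :=
    ⟨fun t => (t.2.2.1, t.2.2.2.2.2, t.2.2.2.1, t.2.2.2.2.1, t.1, t.2.1),
      fun t => (t.2.2.2.2.1, t.2.2.2.2.2, t.1, t.2.2.1, t.2.2.2.1, t.2.1), fun _ => rfl, fun _ => rfl⟩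
  have := Fintype.sum_equiv e (fun t => f t.1 t.2.1 t.2.2.1 t.2.2.2.1 t.2.2.2.2.1 t.2.2.2.2.2)
    (fun t => f t.2.2.2.2.1 t.2.2.2.2.2 t.1 t.2.2.1 t.2.2.2.1 t.2.1) fun _ => rfl
  simpa only [Fintype.sum_prod_type] using this

/-- Rounding a ternary predicate to one that depends only on the classes of its arguments. -/
lemma exists_classPredicate₃ [Fintype C] {p : A → ℝ} {p' : B → ℝ} {p'' : D → ℝ}
    (hp : ∀ a, 0 ≤ p a) (hp' : ∀ a, 0 ≤ p' a) (hp'' : ∀ a, 0 ≤ p'' a)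
    (κ : A → C) (κ' : B → C) (κ'' : D → C) (F : A → B → D → Prop) :
    ∃ φ : C → C → C → Prop,
      ∑ a, ∑ b, ∑ d, p a * p' b * p'' d * ind (¬(F a b d ↔ φ (κ a) (κ' b) (κ'' d))) ≤
      (∑ a, ∑ a', ∑ b, ∑ d, p a * resample p κ a a' * p' b * p'' d * ind (¬(F a b d ↔ F a' b d))) +
      (∑ b, ∑ b', ∑ a, ∑ d, p' b * resample p' κ' b b' * p a * p'' d *
        ind (¬(F a b d ↔ F a b' d))) +
      ∑ d, ∑ d', ∑ a, ∑ b, p'' d * resample p'' κ'' d d' * p a * p' b *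
        ind (¬(F a b d ↔ F a b d')) := by
  obtain ⟨φ, hφ⟩ := exists_classPredicate (p := fun t : A × B × D => p t.1 * (p' t.2.1 * p'' t.2.2))
    (fun t => mul_nonneg (hp _) (mul_nonneg (hp' _) (hp'' _)))
    (fun t => (κ t.1, κ' t.2.1, κ'' t.2.2)) fun t => F t.1 t.2.1 t.2.2
  refine ⟨fun x y z => φ (x, y, z), ?_⟩
  have hr : ∀ t t' : A × B × D, resample (fun t : A × B × D => p t.1 * (p' t.2.1 * p'' t.2.2))
      (fun t => (κ t.1, κ' t.2.1, κ'' t.2.2)) t t' = resample p κ t.1 t'.1 *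
        (resample p' κ' t.2.1 t'.2.1 * resample p'' κ'' t.2.2 t'.2.2) := by
    intro t t'
    have h1 := resample_prod p (fun t : B × D => p' t.1 * p'' t.2) κ
      (fun t => (κ' t.1, κ'' t.2)) t t'
    rw [resample_prod p' p'' κ' κ''] at h1
    exact h1
  simp only [hr, Fintype.sum_prod_type] at hφ
  have hs := resample_nonneg hp κ
  have hs' := resample_nonneg hp' κ'
  have hs'' := resample_nonneg hp'' κ''
  calc ∑ a, ∑ b, ∑ d, p a * p' b * p'' d * ind (¬(F a b d ↔ φ (κ a, κ' b, κ'' d))) ≤ _ := by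
        refine le_trans (le_of_eq ?_) hφ
        simp only [mul_assoc]
    _ ≤ ∑ a, ∑ b, ∑ d, ∑ a', ∑ b', ∑ d', (p a * (p' b * p'' d) * (resample p κ a a' *
          (resample p' κ' b b' * resample p'' κ'' d d')) * ind (¬(F a b d ↔ F a' b d)) +
        p a * (p' b * p'' d) * (resample p κ a a' *
          (resample p' κ' b b' * resample p'' κ'' d d')) * ind (¬(F a' b d ↔ F a' b' d)) +
        p a * (p' b * p'' d) * (resample p κ a a' *
          (resample p' κ' b b' * resample p'' κ'' d d')) * ind (¬(F a' b' d ↔ F a' b' d'))) := by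
        refine sum_le_sum fun a _ => sum_le_sum fun b _ => sum_le_sum fun d _ =>
          sum_le_sum fun a' _ => sum_le_sum fun b' _ => sum_le_sum fun d' _ => ?_
        rw [← mul_add, ← mul_add]
        refine mul_le_mul_of_nonneg_left ?_ (mul_nonneg (mul_nonneg (hp a)
          (mul_nonneg (hp' b) (hp'' d))) (mul_nonneg (hs _ _) (mul_nonneg (hs' _ _) (hs'' _ _))))
        unfold ind
        by_cases h1 : F a b d <;> by_cases h2 : F a' b d <;> by_cases h3 : F a' b' d <;>
          by_cases h4 : F a' b' d' <;> simp [h1, h2, h3, h4]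
    _ ≤ _ := by
        simp only [sum_add_distrib]
        refine add_le_add (add_le_add ?_ ?_) ?_
        · refine sum_le_sum fun a _ => ?_
          rw [Finset.sum_comm_cycle]
          refine sum_le_sum fun a' _ => sum_le_sum fun b _ => sum_le_sum fun d _ => ?_
          have e : ∀ b' d', p a * (p' b * p'' d) * (resample p κ a a' *
              (resample p' κ' b b' * resample p'' κ'' d d')) * ind (¬(F a b d ↔ F a' b d)) =
              (p a * resample p κ a a' * p' b * p'' d * ind (¬(F a b d ↔ F a' b d))) *
                (resample p' κ' b b' * resample p'' κ'' d d') := fun b' d' => by ring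
          simp only [e, ← Finset.mul_sum]
          rw [← Finset.sum_mul]
          refine mul_le_of_le_one_right ?_ (mul_le_one₀ (sum_resample_le_one p' _ _)
            (sum_nonneg fun _ _ => hs'' _ _) (sum_resample_le_one p'' _ _))
          exact mul_nonneg (mul_nonneg (mul_nonneg (mul_nonneg (hp a) (hs _ _)) (hp' b)) (hp'' d))
            (ind_nonneg _)
        · rw [sum_reorder₁]
          refine sum_le_sum fun b _ => sum_le_sum fun b' _ => sum_le_sum fun a' _ =>
            sum_le_sum fun d _ => ?_
          have e : ∀ a d', p a * (p' b * p'' d) * (resample p κ a a' *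
              (resample p' κ' b b' * resample p'' κ'' d d')) * ind (¬(F a' b d ↔ F a' b' d)) =
              (p a * resample p κ a a') * resample p'' κ'' d d' *
                (p' b * resample p' κ' b b' * p'' d * ind (¬(F a' b d ↔ F a' b' d))) :=
            fun b' d' => by ring
          simp only [e, ← Finset.sum_mul, ← Finset.mul_sum]
          have h0 : 0 ≤ p' b * resample p' κ' b b' * p'' d * ind (¬(F a' b d ↔ F a' b' d)) :=
            mul_nonneg (mul_nonneg (mul_nonneg (hp' b) (hs' _ _)) (hp'' d)) (ind_nonneg _)
          calc _ ≤ p a' * 1 * (p' b * resample p' κ' b b' * p'' d *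
                ind (¬(F a' b d ↔ F a' b' d))) := by
                refine mul_le_mul_of_nonneg_right (mul_le_mul (sum_mul_resample_le hp _ _)
                  (sum_resample_le_one p'' _ _) (sum_nonneg fun _ _ => hs'' _ _) (hp _)) h0
            _ = _ := by ring
        · rw [sum_reorder₂]
          refine sum_le_sum fun d _ => sum_le_sum fun d' _ => sum_le_sum fun a' _ =>
            sum_le_sum fun b' _ => ?_
          have e : ∀ a b, p a * (p' b * p'' d) * (resample p κ a a' *
              (resample p' κ' b b' * resample p'' κ'' d d')) * ind (¬(F a' b' d ↔ F a' b' d')) =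
              (p a * resample p κ a a') * (p' b * resample p' κ' b b') *
                (p'' d * resample p'' κ'' d d' * ind (¬(F a' b' d ↔ F a' b' d'))) :=
            fun b' d' => by ring
          simp only [e, ← Finset.sum_mul, ← Finset.mul_sum]
          have h0 : 0 ≤ p'' d * resample p'' κ'' d d' * ind (¬(F a' b' d ↔ F a' b' d')) :=
            mul_nonneg (mul_nonneg (hp'' d) (hs'' _ _)) (ind_nonneg _)
          calc _ ≤ p a' * p' b' * (p'' d * resample p'' κ'' d d' *
                ind (¬(F a' b' d ↔ F a' b' d'))) := by
                refine mul_le_mul_of_nonneg_right (mul_le_mul (sum_mul_resample_le hp _ _)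
                  (sum_mul_resample_le hp' _ _)
                  (sum_nonneg fun _ _ => mul_nonneg (hp' _) (hs' _ _)) (hp _)) h0
            _ = _ := by ring

end Rounding

section ContextDistance

lemma SymmColouring.pdens_swap {W K ι : Type} [Fintype W] (Q : SymmColouring W K) (c : W → ι)
    (i j : ι) (a : K) :
    pdens Q.q c j i (Q.σ a) = pdens Q.q c i j a := by
  unfold pdens
  rw [Finset.sum_comm, mul_comm (#(cell c j) : ℝ)]
  congr 1
  refine Finset.sum_congr rfl fun x _ => Finset.sum_congr rfl fun y _ => ?_
  unfold colInd
  rw [Q.q_swap x y]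
  congr 1
  exact propext ⟨fun h => by rw [← Q.σσ (Q.q x y), h, Q.σσ], fun h => by rw [h]⟩

lemma sum_pdens_le_one {W K ι : Type} [Fintype W] [Fintype K] (q : W → W → K) (c : W → ι)
    (i j : ι) : ∑ a, pdens q c i j a ≤ 1 := by
  unfold pdens
  rw [← Finset.sum_div]
  refine div_le_one_of_le₀ ?_ (by positivity)
  rw [Finset.sum_comm]
  calc _ ≤ ∑ x ∈ cell c i, ∑ y ∈ cell c j, (1 : ℝ) := by
        refine sum_le_sum fun x _ => ?_
        rw [Finset.sum_comm]
        refine sum_le_sum fun y _ => ?_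
        simp [colInd]
    _ = _ := by simp

variable {W K ι C : Type} [Fintype W] [Fintype K] [Fintype ι]

lemma sum_card_cell (c : W → ι) : ∑ i, (#(cell c i) : ℝ) = Fintype.card W := by
  rw [← Nat.cast_sum]
  congr 1
  exact (Finset.card_eq_sum_card_fiberwise fun x _ => mem_univ (c x)).symm

/-- The probability-like weight of contexts `(k, b, d)` that distinguish `a'` from `a`. -/
noncomputable def SymmColouring.contextDist (Q : SymmColouring W K) (c : W → ι) (i j : ι) (a a' : K) :
    ℝ :=
  ∑ k, (#(cell c k) : ℝ) * ∑ b, ∑ d, pdens Q.q c i k b * pdens Q.q c j k d *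
    ind (¬(Q.F a b d ↔ Q.F a' b d))

lemma sum_context_le (q : W → W → K) (c : W → ι) (i j : ι) (h : ι → K → K → ℝ)
    (h1 : ∀ k b d, h k b d ≤ 1) :
    ∑ k, (#(cell c k) : ℝ) * ∑ b, ∑ d, pdens q c i k b * pdens q c j k d * h k b d ≤
      (Fintype.card W : ℝ) := by
  rw [← sum_card_cell c]
  refine sum_le_sum fun k _ => mul_le_of_le_one_right (by positivity) ?_
  calc _ ≤ ∑ b, ∑ d, pdens q c i k b * pdens q c j k d := by
        refine sum_le_sum fun b _ => sum_le_sum fun d _ => mul_le_of_le_one_right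
          (mul_nonneg (pdens_nonneg _ _ _ _ _) (pdens_nonneg _ _ _ _ _)) (h1 k b d)
    _ = (∑ b, pdens q c i k b) * ∑ d, pdens q c j k d := by rw [Finset.sum_mul_sum]
    _ ≤ 1 := mul_le_one₀ (sum_pdens_le_one _ _ _ _) (sum_nonneg fun _ _ => pdens_nonneg _ _ _ _ _)
        (sum_pdens_le_one _ _ _ _)

lemma SymmColouring.contextDist_le (Q : SymmColouring W K) (c : W → ι) (i j : ι) (a a' : K) :
    Q.contextDist c i j a a' ≤ Fintype.card W :=
  sum_context_le _ _ _ _ _ fun _ _ _ => ind_le_one _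

lemma SymmColouring.contextDist_comm (Q : SymmColouring W K) (c : W → ι) (i j : ι) (a a' : K) :
    Q.contextDist c i j a a' = Q.contextDist c i j a' a := by
  unfold contextDist
  simp only [iff_comm]

lemma SymmColouring.contextDist_triangle (Q : SymmColouring W K) (c : W → ι) (i j : ι)
    (a a' a'' : K) :
    Q.contextDist c i j a a'' ≤ Q.contextDist c i j a a' + Q.contextDist c i j a' a'' := by
  unfold contextDist
  rw [← Finset.sum_add_distrib]
  refine sum_le_sum fun k _ => ?_
  rw [← mul_add, ← Finset.sum_add_distrib]
  refine mul_le_mul_of_nonneg_left (sum_le_sum fun b _ => ?_) (by positivity)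
  rw [← Finset.sum_add_distrib]
  refine sum_le_sum fun d _ => ?_
  rw [← mul_add]
  refine mul_le_mul_of_nonneg_left ?_ (mul_nonneg (pdens_nonneg _ _ _ _ _) (pdens_nonneg _ _ _ _ _))
  unfold ind
  by_cases h1 : Q.F a b d <;> by_cases h2 : Q.F a' b d <;> by_cases h3 : Q.F a'' b d <;>
    simp [h1, h2, h3]

lemma SymmColouring.contextDist_eq₂ (Q : SymmColouring W K) (c : W → ι) (i k : ι) (b b' : K) :
    Q.contextDist c i k b b' = ∑ j, (#(cell c j) : ℝ) * ∑ a, ∑ d, pdens Q.q c i j a * pdens Q.q c j k d *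
      ind (¬(Q.F a b d ↔ Q.F a b' d)) := by
  let e : K ≃ K := ⟨Q.σ, Q.σ, Q.σσ, Q.σσ⟩
  unfold contextDist
  refine Finset.sum_congr rfl fun j _ => ?_
  congr 1
  refine Finset.sum_congr rfl fun a _ => ?_
  refine (Fintype.sum_equiv e _ _ fun d => ?_).symm
  show _ = pdens Q.q c i j a * pdens Q.q c k j (Q.σ d) *
    ind (¬(Q.F b a (Q.σ d) ↔ Q.F b' a (Q.σ d)))
  rw [Q.pdens_swap, ← Q.F_swap₂₃, ← Q.F_swap₂₃]

lemma SymmColouring.contextDist_eq₃ (Q : SymmColouring W K) (c : W → ι) (j k : ι) (d d' : K) :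
    Q.contextDist c j k d d' = ∑ i, (#(cell c i) : ℝ) * ∑ a, ∑ b, pdens Q.q c i j a * pdens Q.q c i k b *
      ind (¬(Q.F a b d ↔ Q.F a b d')) := by
  let e : K ≃ K := ⟨Q.σ, Q.σ, Q.σσ, Q.σσ⟩
  unfold contextDist
  refine Finset.sum_congr rfl fun i _ => ?_
  congr 1
  refine (Fintype.sum_equiv e _ _ fun a => ?_).symm
  refine Fintype.sum_equiv e _ _ fun b => ?_
  show _ = pdens Q.q c j i (Q.σ a) * pdens Q.q c k i (Q.σ b) *
    ind (¬(Q.F d (Q.σ a) (Q.σ b) ↔ Q.F d' (Q.σ a) (Q.σ b)))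
  rw [Q.pdens_swap, Q.pdens_swap, ← Q.F_swap₂₃, ← Q.F_swap₂₃, ← Q.F_swap₁₂, ← Q.F_swap₁₂]

/-- Resampling colours within classes of contextually close colours changes little. -/
lemma SymmColouring.sum_resample_contextDist_le (Q : SymmColouring W K) (c : W → ι)
    (κ : ι → ι → K → C) (good : ι → ι → K → Prop) {α β : ℝ} (hα : 0 ≤ α)
    (hgood : ∀ i j a a', good i j a → good i j a' → κ i j a = κ i j a' →
      Q.contextDist c i j a a' ≤ α * (Fintype.card W : ℝ))
    (hbad : ∑ i, ∑ j, (#(cell c i) : ℝ) * #(cell c j) * ∑ a, pdens Q.q c i j a * ind (¬good i j a) ≤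
      β * (Fintype.card W : ℝ) ^ 2) :
    ∑ i, ∑ j, (#(cell c i) : ℝ) * #(cell c j) * ∑ a, ∑ a', pdens Q.q c i j a *
      resample (pdens Q.q c i j) (κ i j) a a' * Q.contextDist c i j a a' ≤
      (α + 2 * β) * (Fintype.card W : ℝ) ^ 3 := by
  set n : ℝ := (Fintype.card W : ℝ) with hn
  have hn0 : 0 ≤ n := by positivity
  have hp := fun i j => pdens_nonneg Q.q c i j
  have key : ∀ i j, ∑ a, ∑ a', pdens Q.q c i j a *
      resample (pdens Q.q c i j) (κ i j) a a' * Q.contextDist c i j a a' ≤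
      α * n + 2 * n * ∑ a, pdens Q.q c i j a * ind (¬good i j a) := by
    intro i j
    have hr := resample_nonneg (hp i j) (κ i j)
    have h1 : ∀ a a', pdens Q.q c i j a * resample (pdens Q.q c i j) (κ i j) a a' *
        Q.contextDist c i j a a' ≤ pdens Q.q c i j a * resample (pdens Q.q c i j) (κ i j) a a' *
        (α * n + n * ind (¬good i j a) + n * ind (¬good i j a')) := by
      intro a a'
      by_cases hk : κ i j a = κ i j a'
      · refine mul_le_mul_of_nonneg_left ?_ (mul_nonneg (hp i j a) (hr _ _))
        by_cases hg : good i j a <;> by_cases hg' : good i j a' <;>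
          simp only [ind, hg, hg', not_true_eq_false, not_false_eq_true, if_true, if_false]
        · simpa using hgood i j a a' hg hg' hk
        all_goals
          have := Q.contextDist_le c i j a a'
          nlinarith [mul_nonneg hα hn0]
      · have : resample (pdens Q.q c i j) (κ i j) a a' = 0 := by
          rw [resample, ind_false hk, zero_mul]
        rw [this]; simp
    calc _ ≤ ∑ a, ∑ a', pdens Q.q c i j a * resample (pdens Q.q c i j) (κ i j) a a' *
        (α * n + n * ind (¬good i j a) + n * ind (¬good i j a')) :=
          sum_le_sum fun a _ => sum_le_sum fun a' _ => h1 a a'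
      _ = ∑ a, (pdens Q.q c i j a * (α * n + n * ind (¬good i j a))) *
            ∑ a', resample (pdens Q.q c i j) (κ i j) a a' +
          ∑ a', (n * ind (¬good i j a')) *
            ∑ a, pdens Q.q c i j a * resample (pdens Q.q c i j) (κ i j) a a' := by
          simp only [Finset.mul_sum]
          rw [Finset.sum_comm (s := univ) (t := univ) (f := fun a' a => n * ind (¬good i j a') *
            (pdens Q.q c i j a * resample (pdens Q.q c i j) (κ i j) a a')), ← sum_add_distrib]
          refine sum_congr rfl fun a _ => ?_
          rw [← sum_add_distrib]
          exact sum_congr rfl fun a' _ => by ring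
      _ ≤ ∑ a, (pdens Q.q c i j a * (α * n + n * ind (¬good i j a))) * 1 +
          ∑ a', (n * ind (¬good i j a')) * pdens Q.q c i j a' := by
          refine add_le_add (sum_le_sum fun a _ => mul_le_mul_of_nonneg_left
            (sum_resample_le_one _ _ _) ?_) (sum_le_sum fun a' _ => mul_le_mul_of_nonneg_left
            (sum_mul_resample_le (hp i j) _ _) ?_)
          · exact mul_nonneg (hp i j a) (add_nonneg (mul_nonneg hα hn0)
              (mul_nonneg hn0 (ind_nonneg _)))
          · exact mul_nonneg hn0 (ind_nonneg _)
      _ = α * n * (∑ a, pdens Q.q c i j a) + 2 * n * ∑ a, pdens Q.q c i j a * ind (¬good i j a) := by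
          simp only [Finset.mul_sum, ← sum_add_distrib]
          exact sum_congr rfl fun a _ => by ring
      _ ≤ α * n * 1 + 2 * n * ∑ a, pdens Q.q c i j a * ind (¬good i j a) := by
          gcongr
          exact sum_pdens_le_one _ _ _ _
      _ = _ := by ring
  calc _ ≤ ∑ i, ∑ j, (#(cell c i) : ℝ) * #(cell c j) *
        (α * n + 2 * n * ∑ a, pdens Q.q c i j a * ind (¬good i j a)) := by
        gcongr with i _ j _
        exact key i j
    _ = α * n * ((∑ i, (#(cell c i) : ℝ)) * ∑ j, (#(cell c j) : ℝ)) + 2 * n *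
        ∑ i, ∑ j, (#(cell c i) : ℝ) * #(cell c j) * ∑ a, pdens Q.q c i j a * ind (¬good i j a) := by
        rw [Finset.sum_mul_sum]
        rw [Finset.mul_sum univ (fun i => ∑ j, (#(cell c i) : ℝ) * (#(cell c j) : ℝ)) (α * n), 
          Finset.mul_sum univ _ (2 * n), ← sum_add_distrib]
        refine sum_congr rfl fun i _ => ?_
        rw [Finset.mul_sum univ _ (α * n), Finset.mul_sum univ _ (2 * n), ← sum_add_distrib]
        exact sum_congr rfl fun j _ => by ring
    _ ≤ α * n * (n * n) + 2 * n * (β * n ^ 2) := by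
        rw [sum_card_cell]
        gcongr
    _ = _ := by ring

lemma mul_sum_sum_mul_sum (w : ℝ) (f : K → K → ℝ) (u : ι → ℝ) (g : ι → K → K → K → K → ℝ) :
    w * ∑ a, ∑ a', f a a' * ∑ k, u k * ∑ b, ∑ d, g k a a' b d =
      ∑ k, w * u k * ∑ a, ∑ a', ∑ b, ∑ d, f a a' * g k a a' b d := by
  have h1 : ∀ a a', f a a' * ∑ k, u k * ∑ b, ∑ d, g k a a' b d =
      ∑ k, u k * ∑ b, ∑ d, f a a' * g k a a' b d := by
    intro a a'
    rw [Finset.mul_sum]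
    refine sum_congr rfl fun k _ => ?_
    simp only [Finset.mul_sum]
    exact sum_congr rfl fun b _ => sum_congr rfl fun d _ => by ring
  calc _ = w * ∑ a, ∑ k, ∑ a', u k * ∑ b, ∑ d, f a a' * g k a a' b d := by
        congr 1
        refine sum_congr rfl fun a _ => ?_
        rw [Finset.sum_comm]
        exact sum_congr rfl fun a' _ => h1 a a'
    _ = ∑ k, w * ∑ a, ∑ a', u k * ∑ b, ∑ d, f a a' * g k a a' b d := by
        rw [Finset.sum_comm, Finset.mul_sum]
    _ = _ := by
        refine sum_congr rfl fun k _ => ?_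
        simp only [← Finset.mul_sum]
        ring

/-- The total mass of coloured triads on which the rule is not determined by the classes. -/
theorem SymmColouring.exists_classRule [Fintype C] (Q : SymmColouring W K) (c : W → ι)
    (κ : ι → ι → K → C) (good : ι → ι → K → Prop) {α β : ℝ} (hα : 0 ≤ α)
    (hgood : ∀ i j a a', good i j a → good i j a' → κ i j a = κ i j a' →
      Q.contextDist c i j a a' ≤ α * (Fintype.card W : ℝ))
    (hbad : ∑ i, ∑ j, (#(cell c i) : ℝ) * #(cell c j) * ∑ a, pdens Q.q c i j a * ind (¬good i j a) ≤
      β * (Fintype.card W : ℝ) ^ 2) :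
    ∃ φ : ι → ι → ι → C → C → C → Prop,
      ∑ i, ∑ j, ∑ k, (#(cell c i) : ℝ) * #(cell c j) * #(cell c k) * ∑ a, ∑ b, ∑ d,
        pdens Q.q c i j a * pdens Q.q c i k b * pdens Q.q c j k d *
          ind (¬(Q.F a b d ↔ φ i j k (κ i j a) (κ i k b) (κ j k d))) ≤
      3 * (α + 2 * β) * (Fintype.card W : ℝ) ^ 3 := by
  have hp := fun i j => pdens_nonneg Q.q c i j
  have h1 := Q.sum_resample_contextDist_le c κ good hα hgood hbad
  choose φ hφ using fun i j k => exists_classPredicate₃ (hp i j) (hp i k) (hp j k) (κ i j) (κ i k)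
    (κ j k) Q.F
  refine ⟨φ, ?_⟩
  set M := ∑ i, ∑ j, (#(cell c i) : ℝ) * #(cell c j) * ∑ a, ∑ a', pdens Q.q c i j a *
      resample (pdens Q.q c i j) (κ i j) a a' * Q.contextDist c i j a a' with hM
  have hM1 : M = ∑ i, ∑ j, ∑ k, (#(cell c i) : ℝ) * #(cell c j) * #(cell c k) *
      ∑ a, ∑ a', ∑ b, ∑ d, pdens Q.q c i j a * resample (pdens Q.q c i j) (κ i j) a a' *
        pdens Q.q c i k b * pdens Q.q c j k d * ind (¬(Q.F a b d ↔ Q.F a' b d)) := by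
    refine sum_congr rfl fun i _ => sum_congr rfl fun j _ => ?_
    unfold contextDist
    rw [mul_sum_sum_mul_sum]
    simp only [mul_assoc]
  have hM2 : M = ∑ i, ∑ j, ∑ k, (#(cell c i) : ℝ) * #(cell c j) * #(cell c k) *
      ∑ b, ∑ b', ∑ a, ∑ d, pdens Q.q c i k b * resample (pdens Q.q c i k) (κ i k) b b' *
        pdens Q.q c i j a * pdens Q.q c j k d * ind (¬(Q.F a b d ↔ Q.F a b' d)) := by
    rw [hM]
    refine sum_congr rfl fun i _ => ?_
    rw [Finset.sum_comm]
    refine sum_congr rfl fun k _ => ?_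
    simp only [Q.contextDist_eq₂]
    rw [mul_sum_sum_mul_sum]
    refine sum_congr rfl fun j _ => ?_
    simp only [mul_assoc]
    ring
  have hM3 : M = ∑ i, ∑ j, ∑ k, (#(cell c i) : ℝ) * #(cell c j) * #(cell c k) *
      ∑ d, ∑ d', ∑ a, ∑ b, pdens Q.q c j k d * resample (pdens Q.q c j k) (κ j k) d d' *
        pdens Q.q c i j a * pdens Q.q c i k b * ind (¬(Q.F a b d ↔ Q.F a b d')) := by
    rw [hM]
    calc _ = ∑ j, ∑ k, ∑ i, (#(cell c i) : ℝ) * #(cell c j) * #(cell c k) *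
      ∑ d, ∑ d', ∑ a, ∑ b, pdens Q.q c j k d * resample (pdens Q.q c j k) (κ j k) d d' *
        pdens Q.q c i j a * pdens Q.q c i k b * ind (¬(Q.F a b d ↔ Q.F a b d')) := by
          refine sum_congr rfl fun j _ => sum_congr rfl fun k _ => ?_
          simp only [Q.contextDist_eq₃]
          rw [mul_sum_sum_mul_sum]
          refine sum_congr rfl fun i _ => ?_
          simp only [mul_assoc]
          ring
      _ = ∑ j, ∑ i, ∑ k, (#(cell c i) : ℝ) * #(cell c j) * #(cell c k) *
      ∑ d, ∑ d', ∑ a, ∑ b, pdens Q.q c j k d * resample (pdens Q.q c j k) (κ j k) d d' *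
        pdens Q.q c i j a * pdens Q.q c i k b * ind (¬(Q.F a b d ↔ Q.F a b d')) :=
          sum_congr rfl fun j _ => Finset.sum_comm
      _ = _ := Finset.sum_comm
  calc _ ≤ M + M + M := by
        nth_rewrite 1 [hM1]
        nth_rewrite 1 [hM2]
        rw [hM3]
        simp only [← sum_add_distrib, ← mul_add]
        refine sum_le_sum fun i _ => sum_le_sum fun j _ => sum_le_sum fun k _ => ?_
        refine mul_le_mul_of_nonneg_left ?_ (by positivity)
        simpa only [← sum_add_distrib] using hφ i j k
    _ ≤ _ := by linarith

end ContextDistance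

section BadMass

variable {W K ι : Type} [Fintype W] [Fintype K] [Fintype ι]

/-- A good colour between two cells that are not too small. -/
structure GoodColour (q : W → W → K) (c : W → ι) (c₀ c₁ ε : ℝ) (i j : ι) (a : K) : Prop where
  pair : GoodPair q c c₀ ε i j a
  left : c₁ * Fintype.card W ≤ #(cell c i)
  right : c₁ * Fintype.card W ≤ #(cell c j)

/-- A coloured triad all of whose pairs are good and on which few errors occur. -/
structure GoodTriad (E : W → W → W → Prop) (q : W → W → K) (F : K → K → K → Prop) (c : W → ι)
    (c₀ c₁ ε θ : ℝ) (i j k : ι) (a b d : K) : Prop where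
  fst : GoodColour q c c₀ c₁ ε i j a
  snd : GoodColour q c c₀ c₁ ε i k b
  trd : GoodColour q c c₀ c₁ ε j k d
  err : (#(triadErr E q F c i j k a b d) : ℝ) ≤ θ * (#(cell c i) * #(cell c j) * #(cell c k)) *
    (pdens q c i j a * pdens q c i k b * pdens q c j k d)

lemma sum_pairs_irregular_le (q : W → W → K) (c : W → ι) {ε ε₀ : ℝ} (hε : 0 < ε)
    (hreg : ∀ X Y : ι → ι → K → Finset W,
      ∑ i, ∑ j, ∑ a, |disc q c i j a (X i j a) (Y i j a)| ≤ ε₀ * (Fintype.card W : ℝ) ^ 2) :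
    ∑ i, ∑ j, ∑ a, (#(cell c i) : ℝ) * #(cell c j) * ind (¬RegPair q c i j a ε) ≤
      ε₀ / ε * (Fintype.card W : ℝ) ^ 2 := by
  have h : ∀ i j a, ∃ X Y : Finset W, ε * ((#(cell c i) : ℝ) * #(cell c j) *
      ind (¬RegPair q c i j a ε)) ≤ |disc q c i j a X Y| := by
    intro i j a
    by_cases hr : RegPair q c i j a ε
    · exact ⟨∅, ∅, by rw [ind_false (not_not.mpr hr)]; simp⟩
    · have hr' := hr
      unfold RegPair at hr'
      simp only [not_forall, not_le] at hr'
      obtain ⟨X, Y, hXY⟩ := hr'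
      exact ⟨X, Y, by rw [ind_true hr, mul_one]; exact hXY.le⟩
  choose X Y hXY using h
  rw [div_mul_eq_mul_div, le_div_iff₀ hε, mul_comm]
  calc _ ≤ ∑ i, ∑ j, ∑ a, |disc q c i j a (X i j a) (Y i j a)| := by
        simp only [Finset.mul_sum (s := univ)]
        exact sum_le_sum fun i _ => sum_le_sum fun j _ => sum_le_sum fun a _ => hXY i j a
    _ ≤ _ := hreg X Y

lemma sum_not_goodColour_le (q : W → W → K) (c : W → ι) {c₀ c₁ ε ε₀ : ℝ} (hε : 0 < ε)
    (hc₀ : 0 ≤ c₀) (hc₁ : 0 ≤ c₁)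
    (hreg : ∀ X Y : ι → ι → K → Finset W,
      ∑ i, ∑ j, ∑ a, |disc q c i j a (X i j a) (Y i j a)| ≤ ε₀ * (Fintype.card W : ℝ) ^ 2) :
    ∑ i, ∑ j, (#(cell c i) : ℝ) * #(cell c j) * ∑ a, pdens q c i j a *
      ind (¬GoodColour q c c₀ c₁ ε i j a) ≤
      (ε₀ / ε + c₀ * Fintype.card K + 2 * (c₁ * Fintype.card ι)) * (Fintype.card W : ℝ) ^ 2 := by
  set n : ℝ := (Fintype.card W : ℝ) with hn
  have hp := fun i j => pdens_nonneg q c i j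
  have h1 : ∀ i j a, (#(cell c i) : ℝ) * #(cell c j) * (pdens q c i j a *
      ind (¬GoodColour q c c₀ c₁ ε i j a)) ≤
      (#(cell c i) : ℝ) * #(cell c j) * ind (¬RegPair q c i j a ε) +
      (#(cell c i) : ℝ) * #(cell c j) * c₀ +
      (c₁ * n * #(cell c j) * pdens q c i j a + #(cell c i) * (c₁ * n) * pdens q c i j a) := by
    intro i j a
    have hw : 0 ≤ (#(cell c i) : ℝ) * #(cell c j) := by positivity
    have e1 : 0 ≤ c₁ * n * #(cell c j) * pdens q c i j a :=
      mul_nonneg (by positivity) (hp i j a)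
    have e2 : 0 ≤ #(cell c i) * (c₁ * n) * pdens q c i j a :=
      mul_nonneg (by positivity) (hp i j a)
    have e3 : 0 ≤ (#(cell c i) : ℝ) * #(cell c j) * ind (¬RegPair q c i j a ε) :=
      mul_nonneg hw (ind_nonneg _)
    have e4 : 0 ≤ (#(cell c i) : ℝ) * #(cell c j) * c₀ := mul_nonneg hw hc₀
    by_cases hg : GoodColour q c c₀ c₁ ε i j a
    · rw [ind_false (not_not.mpr hg)]; linarith
    rw [ind_true hg, mul_one]
    by_cases hr : RegPair q c i j a ε
    · by_cases hd : c₀ ≤ pdens q c i j a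
      · by_cases hl : c₁ * n ≤ #(cell c i)
        · have hr' : ¬ c₁ * n ≤ #(cell c j) := fun hh => hg ⟨⟨hr, hd⟩, hl, hh⟩
          have := mul_le_mul_of_nonneg_right (mul_le_mul_of_nonneg_left (not_le.mp hr').le
            (Nat.cast_nonneg (α := ℝ) #(cell c i))) (hp i j a)
          linarith
        · have := mul_le_mul_of_nonneg_right (mul_le_mul_of_nonneg_right (not_le.mp hl).le
            (Nat.cast_nonneg (α := ℝ) #(cell c j))) (hp i j a)
          linarith
      · have := mul_le_mul_of_nonneg_left (not_le.mp hd).le hw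
        linarith
    · rw [ind_true hr]
      have := mul_le_of_le_one_right hw (pdens_le_one q c i j a)
      linarith
  have h2 : ∑ i, ∑ j, (#(cell c i) : ℝ) * #(cell c j) = n * n := by
    rw [← Finset.sum_mul_sum, sum_card_cell]
  calc _ ≤ ∑ i, ∑ j, (∑ a, (#(cell c i) : ℝ) * #(cell c j) * ind (¬RegPair q c i j a ε) +
        (#(cell c i) : ℝ) * #(cell c j) * (c₀ * Fintype.card K) +
        (c₁ * n * #(cell c j) + #(cell c i) * (c₁ * n))) := by
        refine sum_le_sum fun i _ => sum_le_sum fun j _ => ?_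
        rw [Finset.mul_sum]
        refine (sum_le_sum fun a _ => h1 i j a).trans ?_
        rw [sum_add_distrib, sum_add_distrib, sum_add_distrib, ← Finset.mul_sum]
        have hs := sum_pdens_le_one q c i j
        refine add_le_add (add_le_add le_rfl ?_) (add_le_add ?_ ?_)
        · simp only [sum_const, card_univ, nsmul_eq_mul]
          linarith
        · rw [← Finset.mul_sum]; exact mul_le_of_le_one_right (by positivity) hs
        · rw [← Finset.mul_sum]; exact mul_le_of_le_one_right (by positivity) hs
    _ = (∑ i, ∑ j, ∑ a, (#(cell c i) : ℝ) * #(cell c j) * ind (¬RegPair q c i j a ε)) +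
        (∑ i, ∑ j, (#(cell c i) : ℝ) * #(cell c j)) * (c₀ * Fintype.card K) +
        2 * (c₁ * Fintype.card ι * (n * n)) := by
        simp only [sum_add_distrib, sum_const, ← Finset.mul_sum, ← Finset.sum_mul,
          sum_card_cell, card_univ, nsmul_eq_mul]
        rw [← hn]
        ring
    _ ≤ _ := by
        rw [h2]
        have := sum_pairs_irregular_le q c hε hreg
        nlinarith

lemma triad_lift₁ (q : W → W → K) (c : W → ι) (f : ι → ι → K → ℝ) (hf : ∀ i j a, 0 ≤ f i j a) :
    ∑ i, ∑ j, ∑ k, (#(cell c i) : ℝ) * #(cell c j) * #(cell c k) * ∑ a, ∑ b, ∑ d,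
      pdens q c i j a * pdens q c i k b * pdens q c j k d * f i j a ≤
    Fintype.card W * ∑ i, ∑ j, (#(cell c i) : ℝ) * #(cell c j) * ∑ a, pdens q c i j a * f i j a := by
  have hp := fun i j => pdens_nonneg q c i j
  have h : ∀ i j k, ∑ a, ∑ b, ∑ d,
      pdens q c i j a * pdens q c i k b * pdens q c j k d * f i j a ≤
      ∑ a, pdens q c i j a * f i j a := by
    intro i j k
    refine sum_le_sum fun a _ => ?_
    calc _ = (pdens q c i j a * f i j a) * ((∑ b, pdens q c i k b) * ∑ d, pdens q c j k d) := by
          rw [Finset.sum_mul_sum]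
          simp only [Finset.mul_sum]
          exact sum_congr rfl fun b _ => sum_congr rfl fun d _ => by ring
      _ ≤ _ := mul_le_of_le_one_right (mul_nonneg (hp _ _ _) (hf _ _ _))
          (mul_le_one₀ (sum_pdens_le_one _ _ _ _) (sum_nonneg fun _ _ => hp _ _ _)
            (sum_pdens_le_one _ _ _ _))
  calc _ ≤ ∑ i, ∑ j, ∑ k, (#(cell c i) : ℝ) * #(cell c j) * #(cell c k) *
        ∑ a, pdens q c i j a * f i j a := by
        exact sum_le_sum fun i _ => sum_le_sum fun j _ => sum_le_sum fun k _ =>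
          mul_le_mul_of_nonneg_left (h i j k) (by positivity)
    _ = _ := by
        rw [← sum_card_cell c, Finset.mul_sum]
        refine sum_congr rfl fun i _ => ?_
        rw [Finset.mul_sum]
        refine sum_congr rfl fun j _ => ?_
        rw [Finset.sum_mul]
        exact sum_congr rfl fun k _ => by ring

lemma triad_lift₂ (q : W → W → K) (c : W → ι) (f : ι → ι → K → ℝ) (hf : ∀ i j a, 0 ≤ f i j a) :
    ∑ i, ∑ j, ∑ k, (#(cell c i) : ℝ) * #(cell c j) * #(cell c k) * ∑ a, ∑ b, ∑ d,
      pdens q c i j a * pdens q c i k b * pdens q c j k d * f i k b ≤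
    Fintype.card W * ∑ i, ∑ j, (#(cell c i) : ℝ) * #(cell c j) * ∑ a, pdens q c i j a * f i j a := by
  have hp := fun i j => pdens_nonneg q c i j
  have h : ∀ i j k, ∑ a, ∑ b, ∑ d,
      pdens q c i j a * pdens q c i k b * pdens q c j k d * f i k b ≤
      ∑ b, pdens q c i k b * f i k b := by
    intro i j k
    rw [Finset.sum_comm]
    refine sum_le_sum fun b _ => ?_
    calc _ = (pdens q c i k b * f i k b) * ((∑ a, pdens q c i j a) * ∑ d, pdens q c j k d) := by
          rw [Finset.sum_mul_sum]
          simp only [Finset.mul_sum]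
          exact sum_congr rfl fun b _ => sum_congr rfl fun d _ => by ring
      _ ≤ _ := mul_le_of_le_one_right (mul_nonneg (hp _ _ _) (hf _ _ _))
          (mul_le_one₀ (sum_pdens_le_one _ _ _ _) (sum_nonneg fun _ _ => hp _ _ _)
            (sum_pdens_le_one _ _ _ _))
  calc _ ≤ ∑ i, ∑ j, ∑ k, (#(cell c i) : ℝ) * #(cell c j) * #(cell c k) *
        ∑ b, pdens q c i k b * f i k b := by
        exact sum_le_sum fun i _ => sum_le_sum fun j _ => sum_le_sum fun k _ =>
          mul_le_mul_of_nonneg_left (h i j k) (by positivity)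
    _ = _ := by
        rw [← sum_card_cell c, Finset.mul_sum]
        refine sum_congr rfl fun i _ => ?_
        rw [Finset.mul_sum, Finset.sum_comm]
        refine sum_congr rfl fun k _ => ?_
        rw [Finset.sum_mul]
        exact sum_congr rfl fun j _ => by ring

lemma triad_lift₃ (q : W → W → K) (c : W → ι) (f : ι → ι → K → ℝ) (hf : ∀ i j a, 0 ≤ f i j a) :
    ∑ i, ∑ j, ∑ k, (#(cell c i) : ℝ) * #(cell c j) * #(cell c k) * ∑ a, ∑ b, ∑ d,
      pdens q c i j a * pdens q c i k b * pdens q c j k d * f j k d ≤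
    Fintype.card W * ∑ i, ∑ j, (#(cell c i) : ℝ) * #(cell c j) * ∑ a, pdens q c i j a * f i j a := by
  have hp := fun i j => pdens_nonneg q c i j
  have h : ∀ i j k, ∑ a, ∑ b, ∑ d,
      pdens q c i j a * pdens q c i k b * pdens q c j k d * f j k d ≤
      ∑ d, pdens q c j k d * f j k d := by
    intro i j k
    calc _ = ((∑ a, pdens q c i j a) * ∑ b, pdens q c i k b) * ∑ d, pdens q c j k d * f j k d := by
          rw [Finset.sum_mul_sum]
          simp only [Finset.sum_mul]
          refine sum_congr rfl fun a _ => sum_congr rfl fun b _ => ?_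
          rw [Finset.mul_sum]
          exact sum_congr rfl fun d _ => by ring
      _ ≤ _ := mul_le_of_le_one_left (sum_nonneg fun d _ => mul_nonneg (hp _ _ _) (hf _ _ _))
          (mul_le_one₀ (sum_pdens_le_one _ _ _ _) (sum_nonneg fun _ _ => hp _ _ _)
            (sum_pdens_le_one _ _ _ _))
  calc _ ≤ ∑ i, ∑ j, ∑ k, (#(cell c i) : ℝ) * #(cell c j) * #(cell c k) *
        ∑ d, pdens q c j k d * f j k d := by
        exact sum_le_sum fun i _ => sum_le_sum fun j _ => sum_le_sum fun k _ =>
          mul_le_mul_of_nonneg_left (h i j k) (by positivity)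
    _ = _ := by
        rw [← sum_card_cell c, Finset.sum_mul]
        refine sum_congr rfl fun i _ => ?_
        rw [Finset.mul_sum]
        refine sum_congr rfl fun j _ => ?_
        rw [Finset.mul_sum]
        exact sum_congr rfl fun k _ => by ring

lemma sum_triadErr (E : W → W → W → Prop) (q : W → W → K) (F : K → K → K → Prop) (c : W → ι) :
    ∑ i, ∑ j, ∑ k, ∑ a, ∑ b, ∑ d, #(triadErr E q F c i j k a b d) =
      #(univ.filter fun p : W × W × W =>
        ¬(E p.1 p.2.1 p.2.2 ↔ F (q p.1 p.2.1) (q p.1 p.2.2) (q p.2.1 p.2.2))) := by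
  have := Finset.card_eq_sum_card_fiberwise (s := univ.filter fun p : W × W × W =>
        ¬(E p.1 p.2.1 p.2.2 ↔ F (q p.1 p.2.1) (q p.1 p.2.2) (q p.2.1 p.2.2)))
    (t := (univ : Finset (ι × ι × ι × K × K × K)))
    (f := fun p => (c p.1, c p.2.1, c p.2.2, q p.1 p.2.1, q p.1 p.2.2, q p.2.1 p.2.2))
    fun _ _ => mem_univ _
  rw [this, Fintype.sum_prod_type]
  simp only [Fintype.sum_prod_type]
  refine sum_congr rfl fun i _ => sum_congr rfl fun j _ => sum_congr rfl fun k _ =>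
    sum_congr rfl fun a _ => sum_congr rfl fun b _ => sum_congr rfl fun d _ => ?_
  congr 1
  ext p
  simp only [triadErr, mem_filter, mem_univ, true_and, Prod.mk.injEq]
  constructor
  · rintro ⟨⟨rfl, rfl, rfl⟩, ⟨rfl, rfl, rfl⟩, h⟩
    exact ⟨h, rfl, rfl, rfl, rfl, rfl, rfl⟩
  · rintro ⟨h, rfl, rfl, rfl, rfl, rfl, rfl⟩
    exact ⟨⟨rfl, rfl, rfl⟩, ⟨rfl, rfl, rfl⟩, h⟩

/-- The total mass of the coloured triads that are not good. -/
theorem SymmColouring.sum_not_goodTriad_le (Q : SymmColouring W K) (E : W → W → W → Prop)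
    (c : W → ι) {c₀ c₁ ε ε₀ θ η : ℝ} (hε : 0 < ε) (hc₀ : 0 ≤ c₀) (hc₁ : 0 ≤ c₁) (hθ : 0 < θ)
    (hreg : ∀ X Y : ι → ι → K → Finset W,
      ∑ i, ∑ j, ∑ a, |disc Q.q c i j a (X i j a) (Y i j a)| ≤ ε₀ * (Fintype.card W : ℝ) ^ 2)
    (herr : (#(Q.errors E) : ℝ) ≤ η * Fintype.card W ^ 3) :
    ∑ i, ∑ j, ∑ k, (#(cell c i) : ℝ) * #(cell c j) * #(cell c k) * ∑ a, ∑ b, ∑ d,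
      pdens Q.q c i j a * pdens Q.q c i k b * pdens Q.q c j k d *
        ind (¬GoodTriad E Q.q Q.F c c₀ c₁ ε θ i j k a b d) ≤
      (3 * (ε₀ / ε + c₀ * Fintype.card K + 2 * (c₁ * Fintype.card ι)) + η / θ) *
        (Fintype.card W : ℝ) ^ 3 := by
  set n : ℝ := (Fintype.card W : ℝ) with hn
  have hp := fun i j => pdens_nonneg Q.q c i j
  let f : ι → ι → K → ℝ := fun i j a => ind (¬GoodColour Q.q c c₀ c₁ ε i j a)
  have hf : ∀ i j a, 0 ≤ f i j a := fun _ _ _ => ind_nonneg _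
  have h0 := sum_not_goodColour_le Q.q c hε hc₀ hc₁ hreg
  have h1 := triad_lift₁ Q.q c f hf
  have h2 := triad_lift₂ Q.q c f hf
  have h3 := triad_lift₃ Q.q c f hf
  have h4 : ∑ i, ∑ j, ∑ k, ∑ a, ∑ b, ∑ d, (#(triadErr E Q.q Q.F c i j k a b d) : ℝ) / θ ≤
      η / θ * n ^ 3 := by
    simp only [← Finset.sum_div]
    rw [div_mul_eq_mul_div]
    gcongr
    calc _ = ((#(Q.errors E) : ℕ) : ℝ) := by
          rw [SymmColouring.errors, ← sum_triadErr E Q.q Q.F c]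
          push_cast
          rfl
      _ ≤ _ := herr
  have key : ∀ i j k a b d, (#(cell c i) : ℝ) * #(cell c j) * #(cell c k) *
      (pdens Q.q c i j a * pdens Q.q c i k b * pdens Q.q c j k d *
        ind (¬GoodTriad E Q.q Q.F c c₀ c₁ ε θ i j k a b d)) ≤
      (#(cell c i) : ℝ) * #(cell c j) * #(cell c k) *
        (pdens Q.q c i j a * pdens Q.q c i k b * pdens Q.q c j k d * f i j a) +
      (#(cell c i) : ℝ) * #(cell c j) * #(cell c k) *
        (pdens Q.q c i j a * pdens Q.q c i k b * pdens Q.q c j k d * f i k b) +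
      (#(cell c i) : ℝ) * #(cell c j) * #(cell c k) *
        (pdens Q.q c i j a * pdens Q.q c i k b * pdens Q.q c j k d * f j k d) +
      (#(triadErr E Q.q Q.F c i j k a b d) : ℝ) / θ := by
    intro i j k a b d
    have hw : 0 ≤ (#(cell c i) : ℝ) * #(cell c j) * #(cell c k) := by positivity
    have hq : 0 ≤ pdens Q.q c i j a * pdens Q.q c i k b * pdens Q.q c j k d :=
      mul_nonneg (mul_nonneg (hp _ _ _) (hp _ _ _)) (hp _ _ _)
    have e0 : 0 ≤ (#(triadErr E Q.q Q.F c i j k a b d) : ℝ) / θ := by positivity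
    have e : ∀ i' j' a', 0 ≤ (#(cell c i) : ℝ) * #(cell c j) * #(cell c k) *
      (pdens Q.q c i j a * pdens Q.q c i k b * pdens Q.q c j k d * f i' j' a') :=
      fun i' j' a' => mul_nonneg hw (mul_nonneg hq (hf _ _ _))
    have e1 := e i j a
    have e2 := e i k b
    have e3 := e j k d
    by_cases hg : GoodTriad E Q.q Q.F c c₀ c₁ ε θ i j k a b d
    · rw [ind_false (not_not.mpr hg)]; linarith
    rw [ind_true hg]
    by_cases g1 : GoodColour Q.q c c₀ c₁ ε i j a
    · by_cases g2 : GoodColour Q.q c c₀ c₁ ε i k b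
      · by_cases g3 : GoodColour Q.q c c₀ c₁ ε j k d
        · have g4 : ¬ (_ ≤ _) := fun g4 => hg ⟨g1, g2, g3, g4⟩
          have : (#(cell c i) : ℝ) * #(cell c j) * #(cell c k) *
              (pdens Q.q c i j a * pdens Q.q c i k b * pdens Q.q c j k d * 1) ≤
              (#(triadErr E Q.q Q.F c i j k a b d) : ℝ) / θ := by
            rw [le_div_iff₀ hθ]
            linarith
          linarith
        · have : f j k d = 1 := ind_true g3
          rw [this]; rw [this] at e3; linarith
      · have : f i k b = 1 := ind_true g2
        rw [this]; rw [this] at e2; linarith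
    · have : f i j a = 1 := ind_true g1
      rw [this]; rw [this] at e1; linarith
  calc _ ≤ ∑ i, ∑ j, ∑ k, ∑ a, ∑ b, ∑ d, ((#(cell c i) : ℝ) * #(cell c j) * #(cell c k) *
        (pdens Q.q c i j a * pdens Q.q c i k b * pdens Q.q c j k d * f i j a) +
      (#(cell c i) : ℝ) * #(cell c j) * #(cell c k) *
        (pdens Q.q c i j a * pdens Q.q c i k b * pdens Q.q c j k d * f i k b) +
      (#(cell c i) : ℝ) * #(cell c j) * #(cell c k) *
        (pdens Q.q c i j a * pdens Q.q c i k b * pdens Q.q c j k d * f j k d) +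
      (#(triadErr E Q.q Q.F c i j k a b d) : ℝ) / θ) := by
        refine sum_le_sum fun i _ => sum_le_sum fun j _ => sum_le_sum fun k _ => ?_
        simp only [Finset.mul_sum]
        exact sum_le_sum fun a _ => sum_le_sum fun b _ => sum_le_sum fun d _ => key i j k a b d
    _ ≤ n * _ + n * _ + n * _ + η / θ * n ^ 3 := by
        simp only [sum_add_distrib, ← Finset.mul_sum]
        exact add_le_add (add_le_add (add_le_add h1 h2) h3) h4
    _ ≤ _ := by
        have := mul_le_mul_of_nonneg_left h0 (Nat.cast_nonneg (α := ℝ) (Fintype.card W))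
        rw [← hn] at this
        simp only [f]
        linarith

end BadMass

section Clusters

/-- Every bounded family without `L + 1` separated points splits into `L` clusters. -/
lemma exists_clustering {K : Type} [Fintype K] {L : ℕ} (hL : 1 ≤ L) (d : K → K → ℝ) {r : ℝ}
    (hself : ∀ a, d a a ≤ r) (hcomm : ∀ a b, d a b = d b a)
    (htri : ∀ a b e, d a e ≤ d a b + d b e) (S : K → Prop)
    (hsep : ¬∃ u : Fin (L + 1) → K, (∀ i, S (u i)) ∧ ∀ i j, i ≠ j → r < d (u i) (u j)) :
    ∃ κ : K → Fin L, ∀ a a', S a → S a' → κ a = κ a' → d a a' ≤ 2 * r := by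
  let 𝒯 : Finset (Finset K) := univ.filter fun T =>
    (∀ a ∈ T, S a) ∧ ∀ a ∈ T, ∀ b ∈ T, a ≠ b → r < d a b
  have h𝒯 : 𝒯.Nonempty := ⟨∅, by simp [𝒯]⟩
  obtain ⟨T, hT, hmax⟩ := exists_max_image 𝒯 card h𝒯
  obtain ⟨hTS, hTd⟩ := (mem_filter.mp hT).2
  have hcard : #T ≤ L := by
    by_contra hlt
    obtain ⟨T', hT', hT'c⟩ := exists_subset_card_eq (show L + 1 ≤ #T by omega)
    let e := T'.equivFinOfCardEq hT'c
    refine hsep ⟨fun i => (e.symm i : K), fun i => hTS _ (hT' (e.symm i).2), fun i j hij => ?_⟩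
    refine hTd _ (hT' (e.symm i).2) _ (hT' (e.symm j).2) fun h => hij ?_
    exact e.symm.injective (Subtype.ext h)
  have hclose : ∀ a, S a → ∃ b ∈ T, d a b ≤ r := by
    intro a ha
    by_contra hcon
    simp only [not_exists, not_and, not_le] at hcon
    have haT : a ∉ T := fun h => (hcon a h).not_ge (hself a)
    have : insert a T ∈ 𝒯 := by
      refine mem_filter.mpr ⟨mem_univ _, ?_, ?_⟩
      · intro b hb
        rcases mem_insert.mp hb with rfl | hb
        · exact ha
        · exact hTS b hb
      · intro b hb b' hb' hne
        rcases mem_insert.mp hb with h | h <;> rcases mem_insert.mp hb' with h' | h'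
        · exact absurd (h.trans h'.symm) hne
        · rw [h]; exact hcon _ h'
        · rw [h', hcomm]; exact hcon _ h
        · exact hTd b h b' h' hne
    have := hmax _ this
    rw [card_insert_of_notMem haT] at this
    omega
  have hrep : ∀ a, ∃ b, S a → b ∈ T ∧ d a b ≤ r := by
    intro a
    by_cases ha : S a
    · obtain ⟨b, hb, hb'⟩ := hclose a ha
      exact ⟨b, fun _ => ⟨hb, hb'⟩⟩
    · exact ⟨a, fun h => absurd h ha⟩
  choose ρ hρ using hrep
  let e := T.equivFin
  refine ⟨fun a => if h : ρ a ∈ T then ⟨e ⟨ρ a, h⟩, (e ⟨ρ a, h⟩).2.trans_le hcard⟩ else ⟨0, hL⟩, ?_⟩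
  intro a a' ha ha' hκ
  obtain ⟨h1, h2⟩ := hρ a ha
  obtain ⟨h1', h2'⟩ := hρ a' ha'
  simp only [h1, h1', dif_pos, Fin.mk.injEq] at hκ
  have heq : ρ a = ρ a' := congrArg Subtype.val (e.injective (Fin.ext hκ))
  have := htri a (ρ a) a'
  rw [heq] at this h2
  rw [hcomm a'] at h2'
  linarith

/-- `E` contains all blowups of size `m` of the bipartite pattern `M`. -/
def ContainsBlowups {W U I : Type} (E : W → W → W → Prop) (m : ℕ) (M : U → I → Prop) : Prop :=
  ∀ Γ : Fin m → Fin m → U, ∃ ψ : Fin m ⊕ Fin m ⊕ (I × Fin m) → W, Function.Injective ψ ∧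
    ∀ s t v, E (ψ (Sum.inl s)) (ψ (Sum.inr (Sum.inl t))) (ψ (Sum.inr (Sum.inr v))) ↔ M (Γ s t) v.1

/-- Distinct rows of the pattern `M` are distinct. -/
def SeparatesRows {U I : Type} (M : U → I → Prop) : Prop :=
  ∀ u w, u ≠ w → ∃ v, ¬(M u v ↔ M w v)

/-- The pairs of distinct elements of `Fin k`. -/
abbrev OffDiag (k : ℕ) : Type := {p : Fin k × Fin k // p.1 ≠ p.2}

/-- `E` contains no full family of blowups of a pattern with `k` distinct rows. -/
def BlowupFree {W : Type} (E : W → W → W → Prop) (m k : ℕ) : Prop :=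
  ∀ M : Fin k → OffDiag k → Prop, SeparatesRows M → ¬ContainsBlowups E m M

/-- The mass of the contexts in which the triad on a colour is not good. -/
noncomputable def badContext {W K ι : Type} [Fintype W] [Fintype K] [Fintype ι]
    (E : W → W → W → Prop) (q : W → W → K) (F : K → K → K → Prop) (c : W → ι) (c₀ c₁ ε θ : ℝ)
    (i j : ι) (a : K) : ℝ :=
  ∑ k, #(cell c k) * ∑ b, ∑ d, pdens q c i k b * pdens q c j k d *
    ind (¬GoodTriad E q F c c₀ c₁ ε θ i j k a b d)

lemma badContext_nonneg {W K ι : Type} [Fintype W] [Fintype K] [Fintype ι]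
    (E : W → W → W → Prop) (q : W → W → K) (F : K → K → K → Prop) (c : W → ι) (c₀ c₁ ε θ : ℝ)
    (i j : ι) (a : K) : 0 ≤ badContext E q F c c₀ c₁ ε θ i j a :=
  sum_nonneg fun _ _ => mul_nonneg (by positivity) (sum_nonneg fun _ _ => sum_nonneg fun _ _ =>
    mul_nonneg (mul_nonneg (pdens_nonneg _ _ _ _ _) (pdens_nonneg _ _ _ _ _)) (ind_nonneg _))

/-- Contextually separated good colours have a context distinguishing them all of whose triads are
good. -/
lemma SymmColouring.exists_good_context {W K ι U : Type} [Fintype W] [Fintype K] [Fintype ι]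
    [Fintype U] (Q : SymmColouring W K) (E : W → W → W → Prop) (c : W → ι) {c₀ c₁ ε θ r : ℝ}
    {i j : ι} (a : U → K)
    (hgood : ∀ u, badContext E Q.q Q.F c c₀ c₁ ε θ i j (a u) ≤ r) {u u' : U}
    (hsep : Fintype.card U * r < Q.contextDist c i j (a u) (a u')) :
    ∃ k b d, ¬(Q.F (a u) b d ↔ Q.F (a u') b d) ∧
      ∀ v, GoodTriad E Q.q Q.F c c₀ c₁ ε θ i j k (a v) b d := by
  by_contra hcon
  simp only [not_exists, not_and] at hcon
  refine hsep.not_ge ?_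
  have hp := fun i j => pdens_nonneg Q.q c i j
  calc Q.contextDist c i j (a u) (a u') ≤ ∑ v, badContext E Q.q Q.F c c₀ c₁ ε θ i j (a v) := by
        unfold contextDist badContext
        rw [Finset.sum_comm]
        refine sum_le_sum fun k _ => ?_
        rw [← Finset.mul_sum]
        refine mul_le_mul_of_nonneg_left ?_ (by positivity)
        refine (sum_le_sum fun b _ => ?_).trans_eq Finset.sum_comm
        refine (sum_le_sum fun d _ => ?_).trans_eq Finset.sum_comm
        rw [← Finset.mul_sum]
        refine mul_le_mul_of_nonneg_left ?_ (mul_nonneg (hp _ _ _) (hp _ _ _))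
        by_cases h : Q.F (a u) b d ↔ Q.F (a u') b d
        · rw [ind_false (not_not.mpr h)]
          exact sum_nonneg fun _ _ => ind_nonneg _
        · obtain ⟨v, hv⟩ := not_forall.mp (hcon k b d h)
          refine (ind_le_one _).trans ?_
          rw [← ind_true hv]
          exact single_le_sum (f := fun v => ind (¬GoodTriad E Q.q Q.F c c₀ c₁ ε θ i j k (a v) b d))
            (fun _ _ => ind_nonneg _) (mem_univ v)
    _ ≤ ∑ _v : U, r := sum_le_sum fun v _ => hgood v
    _ = _ := by simp

/-- In a blowup-free structure every symmetric colouring can be coarsened to `L` classes per pair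
of cells, at a small cost. -/
theorem exists_coarsening {L : ℕ} (hL : 1 ≤ L) (m : ℕ) :
    ∃ θ : ℝ, 0 < θ ∧ ∀ c₀ : ℝ, 0 < c₀ → c₀ ≤ 1 → ∃ ε : ℝ, 0 < ε ∧ ∀ c₁ : ℝ, 0 < c₁ →
      ∃ n₀ : ℕ, ∀ {W K ι : Type} [Fintype W] [Fintype K] [Fintype ι] (Q : SymmColouring W K)
      (E : W → W → W → Prop) (c : W → ι) (η₁ η₂ : ℝ), n₀ ≤ Fintype.card W → 0 < η₂ →
      BlowupFree E m (L + 1) →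
      ∑ i, ∑ j, ∑ k, (#(cell c i) : ℝ) * #(cell c j) * #(cell c k) * ∑ a, ∑ b, ∑ d,
        pdens Q.q c i j a * pdens Q.q c i k b * pdens Q.q c j k d *
          ind (¬GoodTriad E Q.q Q.F c c₀ c₁ ε θ i j k a b d) ≤ η₁ * (Fintype.card W : ℝ) ^ 3 →
      ∃ (κ : ι → ι → K → Fin L) (φ : ι → ι → ι → Fin L → Fin L → Fin L → Prop),
        ∑ i, ∑ j, ∑ k, (#(cell c i) : ℝ) * #(cell c j) * #(cell c k) * ∑ a, ∑ b, ∑ d,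
        pdens Q.q c i j a * pdens Q.q c i k b * pdens Q.q c j k d *
          ind (¬(Q.F a b d ↔ φ i j k (κ i j a) (κ i k b) (κ j k d))) ≤
        3 * (2 * ((L + 1) * η₂) + 2 * (η₁ / η₂)) * (Fintype.card W : ℝ) ^ 3 := by
  obtain ⟨θ, hθ, H⟩ := exists_blowup (U := Fin (L + 1)) (I := OffDiag (L + 1)) m
  refine ⟨θ, hθ, fun c₀ hc₀ hc₀1 => ?_⟩
  obtain ⟨ε, hε, H⟩ := H c₀ hc₀ hc₀1
  refine ⟨ε, hε, fun c₁ hc₁ => ?_⟩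
  obtain ⟨n₀, H⟩ := H c₁ hc₁
  refine ⟨n₀ + 1, fun {W K ι} _ _ _ Q E c η₁ η₂ hn hη₂ hfree hmass => ?_⟩
  set n : ℝ := (Fintype.card W : ℝ) with hnd
  have hn0 : 0 < n := by
    have : 0 < Fintype.card W := by omega
    exact Nat.cast_pos.mpr this
  have hp := fun i j => pdens_nonneg Q.q c i j
  let good : ι → ι → K → Prop := fun i j a => badContext E Q.q Q.F c c₀ c₁ ε θ i j a ≤ η₂ * n
  have hcl : ∀ i j, ∃ κ : K → Fin L, ∀ a a', good i j a → good i j a' → κ a = κ a' →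
      Q.contextDist c i j a a' ≤ 2 * ((L + 1) * (η₂ * n)) := by
    intro i j
    refine exists_clustering hL (Q.contextDist c i j) ?_ (Q.contextDist_comm c i j)
      (Q.contextDist_triangle c i j) (good i j) ?_
    · intro a
      have : Q.contextDist c i j a a = 0 := by simp [SymmColouring.contextDist, ind]
      rw [this]; positivity
    · rintro ⟨u, hu, hsep⟩
      have hctx : ∀ p : OffDiag (L + 1), ∃ k b d, ¬(Q.F (u p.1.1) b d ↔ Q.F (u p.1.2) b d) ∧
          ∀ v, GoodTriad E Q.q Q.F c c₀ c₁ ε θ i j k (u v) b d := by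
        intro p
        refine Q.exists_good_context E c u hu ?_
        have := hsep _ _ p.2
        simpa using this
      choose k b d hne hgt using hctx
      refine hfree (fun v p => Q.F (u v) (b p) (d p)) (fun v v' h => ⟨⟨(v, v'), h⟩, hne ⟨(v, v'), h⟩⟩) ?_
      have p₀ : OffDiag (L + 1) := ⟨(0, Fin.last L), by
        intro h
        have := congrArg Fin.val h
        simp at this
        omega⟩
      exact H E Q.q Q.F c i j u k b d (by omega) (fun v => (hgt p₀ v).fst.pair)
        (fun p => (hgt p 0).snd.pair) (fun p => (hgt p 0).trd.pair) (hgt p₀ 0).fst.left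
        (hgt p₀ 0).fst.right (fun p => (hgt p 0).snd.right) (fun v p => (hgt p v).err)
  choose κ hκ using hcl
  have hbad : ∑ i, ∑ j, (#(cell c i) : ℝ) * #(cell c j) * ∑ a, pdens Q.q c i j a *
      ind (¬good i j a) ≤ η₁ / η₂ * n ^ 2 := by
    have h1 : ∀ i j a, (η₂ * n) * (pdens Q.q c i j a * ind (¬good i j a)) ≤
        pdens Q.q c i j a * badContext E Q.q Q.F c c₀ c₁ ε θ i j a := by
      intro i j a
      rw [mul_left_comm]
      refine mul_le_mul_of_nonneg_left ?_ (hp i j a)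
      by_cases hg : good i j a
      · rw [ind_false (not_not.mpr hg), mul_zero]
        exact badContext_nonneg _ _ _ _ _ _ _ _ _ _ _
      · rw [ind_true hg, mul_one]
        exact (not_le.mp hg).le
    have h2 : (η₂ * n) * ∑ i, ∑ j, (#(cell c i) : ℝ) * #(cell c j) * ∑ a, pdens Q.q c i j a *
        ind (¬good i j a) ≤ η₁ * n ^ 3 := by
      refine le_trans ?_ hmass
      rw [Finset.mul_sum]
      refine sum_le_sum fun i _ => ?_
      rw [Finset.mul_sum]
      refine sum_le_sum fun j _ => ?_
      calc _ = (#(cell c i) : ℝ) * #(cell c j) * ∑ a, (η₂ * n) * (pdens Q.q c i j a *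
            ind (¬good i j a)) := by
            rw [← Finset.mul_sum]; ring
        _ ≤ (#(cell c i) : ℝ) * #(cell c j) * ∑ a,
              pdens Q.q c i j a * badContext E Q.q Q.F c c₀ c₁ ε θ i j a := by
            refine mul_le_mul_of_nonneg_left (sum_le_sum fun a _ => h1 i j a) (by positivity)
        _ = _ := by
            simp only [badContext, Finset.mul_sum]
            rw [Finset.sum_comm]
            refine sum_congr rfl fun k _ => sum_congr rfl fun a _ => sum_congr rfl fun b _ =>
              sum_congr rfl fun d _ => by ring
    rw [div_mul_eq_mul_div, le_div_iff₀ hη₂]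
    refine le_of_mul_le_mul_right ?_ hn0
    calc _ = _ := by ring
      _ ≤ _ := h2
      _ = _ := by ring
  obtain ⟨φ, hφ⟩ := Q.exists_classRule c κ good (α := 2 * ((L + 1) * η₂)) (by positivity)
    (fun i j a a' h h' hk => (hκ i j a a' h h' hk).trans_eq (by ring)) hbad
  exact ⟨κ, φ, hφ⟩

end Clusters

section Counting

variable {W K ι : Type} [Fintype W]

lemma disc_eq_sum (q : W → W → K) (c : W → ι) (i j : ι) (a : K) (X Y : Finset W) :
    disc q c i j a X Y = ∑ x ∈ cell c i, ∑ y ∈ cell c j,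
      (colInd q a x y - pdens q c i j a) * (ind (x ∈ X) * ind (y ∈ Y)) := by
  unfold disc
  rw [← Finset.filter_mem_eq_inter, Finset.sum_filter]
  refine sum_congr rfl fun x _ => ?_
  rw [← Finset.filter_mem_eq_inter, Finset.sum_filter]
  by_cases hx : x ∈ X
  · rw [if_pos hx]
    refine sum_congr rfl fun y _ => ?_
    by_cases hy : y ∈ Y <;> simp [ind, hx, hy]
  · rw [if_neg hx]
    simp [ind, hx]

/-- The number of triangles with prescribed cells and colours. -/
noncomputable def triadCount (q : W → W → K) (c : W → ι) (i j k : ι) (a b d : K) : ℝ :=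
  ∑ x ∈ cell c i, ∑ y ∈ cell c j, ∑ z ∈ cell c k, colInd q a x y * colInd q b x z * colInd q d y z

lemma triadCount_le (q : W → W → K) (c : W → ι) (i j k : ι) (a b d : K) :
    triadCount q c i j k a b d ≤
      (∑ z ∈ cell c k, |disc q c i j a (univ.filter fun x => q x z = b)
        (univ.filter fun y => q y z = d)|) +
      (∑ y ∈ cell c j, |disc q c i k b univ (univ.filter fun z => q y z = d)|) +
      #(cell c i) * #(cell c j) * #(cell c k) *
        (pdens q c i j a * pdens q c i k b * pdens q c j k d) := by
  have h1 : ∑ z ∈ cell c k, disc q c i j a (univ.filter fun x => q x z = b)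
        (univ.filter fun y => q y z = d) = triadCount q c i j k a b d -
      pdens q c i j a * ∑ x ∈ cell c i, ∑ y ∈ cell c j, ∑ z ∈ cell c k,
        colInd q b x z * colInd q d y z := by
    unfold triadCount
    simp only [Finset.mul_sum, ← sum_sub_distrib]
    simp only [disc_eq_sum]
    rw [Finset.sum_comm]
    refine sum_congr rfl fun x _ => ?_
    rw [Finset.sum_comm]
    refine sum_congr rfl fun y _ => sum_congr rfl fun z _ => ?_
    simp only [ind, colInd, mem_filter, mem_univ, true_and]
    ring
  have h2 : ∑ y ∈ cell c j, disc q c i k b univ (univ.filter fun z => q y z = d) =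
      (∑ x ∈ cell c i, ∑ y ∈ cell c j, ∑ z ∈ cell c k, colInd q b x z * colInd q d y z) -
      pdens q c i k b * (#(cell c i) * ∑ y ∈ cell c j, ∑ z ∈ cell c k, colInd q d y z) := by
    have : (#(cell c i) : ℝ) * ∑ y ∈ cell c j, ∑ z ∈ cell c k, colInd q d y z =
        ∑ x ∈ cell c i, ∑ y ∈ cell c j, ∑ z ∈ cell c k, colInd q d y z := by
      rw [sum_const, nsmul_eq_mul]
    rw [this]
    simp only [Finset.mul_sum, ← sum_sub_distrib]
    rw [Finset.sum_comm (s := cell c i) (t := cell c j)]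
    refine sum_congr rfl fun y _ => ?_
    rw [disc_eq_sum]
    refine sum_congr rfl fun x _ => sum_congr rfl fun z _ => ?_
    simp only [ind, colInd, mem_filter, mem_univ, true_and, if_true]
    ring
  rw [← pdens_mul] at h2
  have e1 := Finset.sum_le_sum fun z (_ : z ∈ cell c k) =>
    le_abs_self (disc q c i j a (univ.filter fun x => q x z = b) (univ.filter fun y => q y z = d))
  have e2 := Finset.sum_le_sum fun y (_ : y ∈ cell c j) =>
    le_abs_self (disc q c i k b univ (univ.filter fun z => q y z = d))
  have e3 : 0 ≤ ∑ y ∈ cell c j, |disc q c i k b univ (univ.filter fun z => q y z = d)| :=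
    sum_nonneg fun _ _ => abs_nonneg _
  have e4 := mul_le_mul_of_nonneg_left e2 (pdens_nonneg q c i j a)
  have e5 := mul_le_of_le_one_left e3 (pdens_le_one q c i j a)
  rw [h2, mul_sub] at e4
  linarith

variable [Fintype K] [Fintype ι]

lemma sum_triads_reorder₁ (f : ι → ι → ι → K → K → K → ℝ) :
    ∑ i, ∑ j, ∑ k, ∑ a, ∑ b, ∑ d, f i j k a b d =
      ∑ k, ∑ b, ∑ d, ∑ i, ∑ j, ∑ a, f i j k a b d := by
  let e : (ι × ι × ι × K × K × K) ≃ (ι × K × K × ι × ι × K) :=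
    ⟨fun t => (t.2.2.1, t.2.2.2.2.1, t.2.2.2.2.2, t.1, t.2.1, t.2.2.2.1),
      fun t => (t.2.2.2.1, t.2.2.2.2.1, t.1, t.2.2.2.2.2, t.2.1, t.2.2.1), fun _ => rfl, fun _ => rfl⟩
  have := Fintype.sum_equiv e (fun t => f t.1 t.2.1 t.2.2.1 t.2.2.2.1 t.2.2.2.2.1 t.2.2.2.2.2)
    (fun t => f t.2.2.2.1 t.2.2.2.2.1 t.1 t.2.2.2.2.2 t.2.1 t.2.2.1) fun _ => rfl
  simpa only [Fintype.sum_prod_type] using this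

lemma sum_triads_reorder₂ (f : ι → ι → ι → K → K → K → ℝ) :
    ∑ i, ∑ j, ∑ k, ∑ a, ∑ b, ∑ d, f i j k a b d =
      ∑ j, ∑ a, ∑ d, ∑ i, ∑ k, ∑ b, f i j k a b d := by
  let e : (ι × ι × ι × K × K × K) ≃ (ι × K × K × ι × ι × K) :=
    ⟨fun t => (t.2.1, t.2.2.2.1, t.2.2.2.2.2, t.1, t.2.2.1, t.2.2.2.2.1),
      fun t => (t.2.2.2.1, t.1, t.2.2.2.2.1, t.2.1, t.2.2.2.2.2, t.2.2.1), fun _ => rfl, fun _ => rfl⟩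
  have := Fintype.sum_equiv e (fun t => f t.1 t.2.1 t.2.2.1 t.2.2.2.1 t.2.2.2.2.1 t.2.2.2.2.2)
    (fun t => f t.2.2.2.1 t.1 t.2.2.2.2.1 t.2.1 t.2.2.2.2.2 t.2.2.1) fun _ => rfl
  simpa only [Fintype.sum_prod_type] using this

lemma sum_triads_disc_le (c : W → ι) {r : ℝ} (g : ι → ι → K → K → K → W → ℝ)
    (hg : ∀ b d z, ∑ i, ∑ j, ∑ a, g i j a b d z ≤ r) :
    ∑ k, ∑ b, ∑ d, ∑ i, ∑ j, ∑ a, ∑ z ∈ cell c k, g i j a b d z ≤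
      (Fintype.card K : ℝ) ^ 2 * r * Fintype.card W := by
  calc _ ≤ ∑ k, ∑ _b : K, ∑ _d : K, (#(cell c k) : ℝ) * r := by
        refine sum_le_sum fun k _ => sum_le_sum fun b _ => sum_le_sum fun d _ => ?_
        calc _ = ∑ z ∈ cell c k, ∑ i, ∑ j, ∑ a, g i j a b d z := by
              symm
              rw [Finset.sum_comm]
              refine sum_congr rfl fun i _ => ?_
              rw [Finset.sum_comm]
              refine sum_congr rfl fun j _ => ?_
              rw [Finset.sum_comm]
          _ ≤ ∑ z ∈ cell c k, r := sum_le_sum fun z _ => hg b d z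
          _ = _ := by simp
    _ = _ := by
        simp only [sum_const, card_univ, nsmul_eq_mul, ← Finset.mul_sum, ← Finset.sum_mul,
          sum_card_cell]
        ring

/-- Counting the triples whose coloured triad satisfies a predicate. -/
theorem card_triads_le (q : W → W → K) (c : W → ι) {ε₀ : ℝ}
    (hreg : ∀ X Y : ι → ι → K → Finset W,
      ∑ i, ∑ j, ∑ a, |disc q c i j a (X i j a) (Y i j a)| ≤ ε₀ * (Fintype.card W : ℝ) ^ 2)
    (P : ι → ι → ι → K → K → K → Prop) :
    (#(univ.filter fun p : W × W × W => P (c p.1) (c p.2.1) (c p.2.2) (q p.1 p.2.1) (q p.1 p.2.2)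
      (q p.2.1 p.2.2)) : ℝ) ≤
    (∑ i, ∑ j, ∑ k, (#(cell c i) : ℝ) * #(cell c j) * #(cell c k) * ∑ a, ∑ b, ∑ d,
      pdens q c i j a * pdens q c i k b * pdens q c j k d * ind (P i j k a b d)) +
      2 * (Fintype.card K : ℝ) ^ 2 * ε₀ * (Fintype.card W : ℝ) ^ 3 := by
  have h1 : (#(univ.filter fun p : W × W × W => P (c p.1) (c p.2.1) (c p.2.2) (q p.1 p.2.1)
      (q p.1 p.2.2) (q p.2.1 p.2.2)) : ℝ) =
      ∑ i, ∑ j, ∑ k, ∑ a, ∑ b, ∑ d, triadCount q c i j k a b d * ind (P i j k a b d) := by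
    have := Finset.card_eq_sum_card_fiberwise (s := univ.filter fun p : W × W × W =>
        P (c p.1) (c p.2.1) (c p.2.2) (q p.1 p.2.1) (q p.1 p.2.2) (q p.2.1 p.2.2))
      (t := (univ : Finset (ι × ι × ι × K × K × K)))
      (f := fun p => (c p.1, c p.2.1, c p.2.2, q p.1 p.2.1, q p.1 p.2.2, q p.2.1 p.2.2))
      fun _ _ => mem_univ _
    rw [this]
    push_cast
    simp only [Fintype.sum_prod_type]
    refine sum_congr rfl fun i _ => sum_congr rfl fun j _ => sum_congr rfl fun k _ =>
      sum_congr rfl fun a _ => sum_congr rfl fun b _ => sum_congr rfl fun d _ => ?_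
    rw [Finset.card_filter, Finset.sum_filter]
    push_cast
    simp only [triadCount, cell, Finset.sum_filter, Fintype.sum_prod_type, Finset.sum_mul]
    refine sum_congr rfl fun x _ => ?_
    by_cases hx : c x = i
    · subst hx
      simp only [if_true, Finset.sum_mul]
      refine sum_congr rfl fun y _ => ?_
      by_cases hy : c y = j
      · subst hy
        simp only [if_true, Finset.sum_mul]
        refine sum_congr rfl fun z _ => ?_
        by_cases hz : c z = k
        · subst hz
          by_cases ha : q x y = a
          · by_cases hb : q x z = b
            · by_cases hd : q y z = d
              · subst ha hb hd
                simp [ind, colInd]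
              · simp [ind, colInd, hd]
            · simp [ind, colInd, hb]
          · simp [ind, colInd, ha]
        · simp [hz]
      · simp [hy]
    · simp [hx]
  have h2 : ∀ i j k a b d, triadCount q c i j k a b d * ind (P i j k a b d) ≤
      (∑ z ∈ cell c k, |disc q c i j a (univ.filter fun x => q x z = b)
        (univ.filter fun y => q y z = d)|) +
      (∑ y ∈ cell c j, |disc q c i k b univ (univ.filter fun z => q y z = d)|) +
      #(cell c i) * #(cell c j) * #(cell c k) *
        (pdens q c i j a * pdens q c i k b * pdens q c j k d * ind (P i j k a b d)) := by
    intro i j k a b d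
    have e1 : 0 ≤ ∑ z ∈ cell c k, |disc q c i j a (univ.filter fun x => q x z = b)
        (univ.filter fun y => q y z = d)| := sum_nonneg fun _ _ => abs_nonneg _
    have e2 : 0 ≤ ∑ y ∈ cell c j, |disc q c i k b univ (univ.filter fun z => q y z = d)| :=
      sum_nonneg fun _ _ => abs_nonneg _
    by_cases hP : P i j k a b d
    · simpa only [ind_true hP, mul_one] using triadCount_le q c i j k a b d
    · simp only [ind_false hP, mul_zero]
      linarith
  have h3 := sum_triads_disc_le c (fun i j a b d z => |disc q c i j a
    (univ.filter fun x => q x z = b) (univ.filter fun y => q y z = d)|)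
    (fun b d z => hreg (fun _ _ _ => univ.filter fun x => q x z = b)
      (fun _ _ _ => univ.filter fun y => q y z = d))
  have h4 := sum_triads_disc_le c (fun i k b _ d y => |disc q c i k b univ
    (univ.filter fun z => q y z = d)|)
    (fun a d y => hreg (fun _ _ _ => univ) (fun _ _ _ => univ.filter fun z => q y z = d))
  rw [h1]
  refine (sum_le_sum fun i _ => sum_le_sum fun j _ => sum_le_sum fun k _ => sum_le_sum fun a _ =>
    sum_le_sum fun b _ => sum_le_sum fun d _ => h2 i j k a b d).trans ?_
  simp only [sum_add_distrib]
  rw [sum_triads_reorder₁ (fun i j k a b d => ∑ z ∈ cell c k, |disc q c i j a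
    (univ.filter fun x => q x z = b) (univ.filter fun y => q y z = d)|),
    sum_triads_reorder₂ (fun i j k a b d => ∑ y ∈ cell c j, |disc q c i k b univ
    (univ.filter fun z => q y z = d)|)]
  simp only [← Finset.mul_sum] at h3 h4 ⊢
  linarith

end Counting

section Structure

/-- The discrepancy of a class of colours is the sum of the discrepancies of its members. -/
lemma disc_coarsen {W K ι C : Type} [Fintype W] [Fintype K] (q : W → W → K) (c : W → ι)
    (κ : ι → ι → K → C) (i j : ι) (γ : C) (X Y : Finset W) :
    disc (fun x y => κ (c x) (c y) (q x y)) c i j γ X Y =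
      ∑ a, ind (κ i j a = γ) * disc q c i j a X Y := by
  have h0 : ∀ x ∈ cell c i, ∀ y ∈ cell c j, colInd (fun x y => κ (c x) (c y) (q x y)) γ x y =
      ∑ a, ind (κ i j a = γ) * colInd q a x y := by
    intro x hx y hy
    rw [mem_cell] at hx hy
    simp [colInd, ind, hx, hy]
  have h1 : pdens (fun x y => κ (c x) (c y) (q x y)) c i j γ =
      ∑ a, ind (κ i j a = γ) * pdens q c i j a := by
    unfold pdens
    simp only [← mul_div_assoc, ← Finset.sum_div]
    congr 1
    simp only [Finset.mul_sum]
    symm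
    rw [Finset.sum_comm]
    refine sum_congr rfl fun x hx => ?_
    rw [Finset.sum_comm]
    exact sum_congr rfl fun y hy => (h0 x hx y hy).symm
  unfold disc
  simp only [Finset.mul_sum]
  symm
  rw [Finset.sum_comm]
  refine sum_congr rfl fun x hx => ?_
  rw [Finset.sum_comm]
  refine sum_congr rfl fun y hy => ?_
  symm
  rw [h0 x (mem_inter.mp hx).1 y (mem_inter.mp hy).1, h1, ← sum_sub_distrib]
  exact sum_congr rfl fun a _ => by ring

lemma sum_disc_coarsen_le {W K ι C : Type} [Fintype W] [Fintype K] [Fintype C]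
    (q : W → W → K) (c : W → ι) (κ : ι → ι → K → C) (i j : ι) (X Y : C → Finset W) :
    ∑ γ, |disc (fun x y => κ (c x) (c y) (q x y)) c i j γ (X γ) (Y γ)| ≤
      ∑ a, |disc q c i j a (X (κ i j a)) (Y (κ i j a))| := by
  calc _ ≤ ∑ γ, ∑ a, ind (κ i j a = γ) * |disc q c i j a (X γ) (Y γ)| := by
        refine sum_le_sum fun γ _ => ?_
        rw [disc_coarsen]
        refine (abs_sum_le_sum_abs _ _).trans_eq (sum_congr rfl fun a _ => ?_)
        rw [abs_mul, abs_of_nonneg (ind_nonneg _)]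
    _ = _ := by
        rw [Finset.sum_comm]
        refine sum_congr rfl fun a _ => ?_
        simp [ind]

/-- A blowup-free symmetric ternary relation of bounded complexity is, up to few triples, given by
the cells and `L` regular colours between each pair of cells. -/
theorem exists_regular_structure {L : ℕ} (hL : 1 ≤ L) (m k : ℕ) {ε η : ℝ} (hε : 0 < ε)
    (hη : 0 < η) :
    ∃ T n₀ : ℕ, ∀ (W : Type) [Fintype W] (E : W → W → W → Prop), n₀ ≤ Fintype.card W →
      TernarySymm E → ¬GridShattered E k → BlowupFree E m (L + 1) →
      ∃ t, 1 ≤ t ∧ t ≤ T ∧ ∃ (c : W → Fin t) (q : W → W → Fin L)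
        (φ : Fin t → Fin t → Fin t → Fin L → Fin L → Fin L → Prop),
        (∀ X Y : Fin t → Fin t → Fin L → Finset W,
          ∑ i, ∑ j, ∑ a, |disc q c i j a (X i j a) (Y i j a)| ≤ ε * (Fintype.card W : ℝ) ^ 2) ∧
        (#(univ.filter fun p : W × W × W => ¬(E p.1 p.2.1 p.2.2 ↔ φ (c p.1) (c p.2.1) (c p.2.2)
          (q p.1 p.2.1) (q p.1 p.2.2) (q p.2.1 p.2.2))) : ℝ) ≤ η * (Fintype.card W : ℝ) ^ 3 := by
  obtain ⟨θ, hθ, H⟩ := exists_coarsening hL m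
  have hL' : (0 : ℝ) < L + 1 := by positivity
  obtain ⟨η₂, hη₂⟩ : ∃ x, x = η / (24 * (L + 1)) := ⟨_, rfl⟩
  have hη₂0 : 0 < η₂ := by rw [hη₂]; positivity
  obtain ⟨η₁, hη₁⟩ : ∃ x, x = η * η₂ / 24 := ⟨_, rfl⟩
  have hη₁0 : 0 < η₁ := by rw [hη₁]; positivity
  obtain ⟨η₀, hη₀⟩ : ∃ x, x = min (η / 4) (θ * η₁ / 4) := ⟨_, rfl⟩
  have hη₀0 : 0 < η₀ := by rw [hη₀]; positivity
  have hη₀1 : η₀ ≤ η / 4 := hη₀ ▸ min_le_left _ _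
  have hη₀2 : η₀ ≤ θ * η₁ / 4 := hη₀ ▸ min_le_right _ _
  obtain ⟨K, hK, hcol⟩ := exists_symmColouring k hη₀0
  obtain ⟨κn, hκn⟩ : ∃ x : ℝ, x = (Fintype.card K : ℝ) := ⟨_, rfl⟩
  have hκ0 : 0 ≤ κn := by rw [hκn]; positivity
  obtain ⟨c₀, hc₀⟩ : ∃ x, x = min 1 (η₁ / (12 * (κn + 1))) := ⟨_, rfl⟩
  have hc₀0 : 0 < c₀ := by rw [hc₀]; positivity
  have hc₀1 : c₀ ≤ 1 := hc₀ ▸ min_le_left _ _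
  have hc₀2 : c₀ ≤ η₁ / (12 * (κn + 1)) := hc₀ ▸ min_le_right _ _
  obtain ⟨ε', hε', H⟩ := H c₀ hc₀0 hc₀1
  obtain ⟨ε₀, hε₀⟩ : ∃ x, x = min ε (min (ε' * η₁ / 12) (η / (8 * (κn ^ 2 + 1)))) := ⟨_, rfl⟩
  have hε₀0 : 0 < ε₀ := by rw [hε₀]; positivity
  have hε₀1 : ε₀ ≤ ε := hε₀ ▸ min_le_left _ _
  have hε₀2 : ε₀ ≤ ε' * η₁ / 12 := hε₀ ▸ (min_le_right _ _).trans (min_le_left _ _)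
  have hε₀3 : ε₀ ≤ η / (8 * (κn ^ 2 + 1)) := hε₀ ▸ (min_le_right _ _).trans (min_le_right _ _)
  obtain ⟨T, hT⟩ := exists_regular_labelling K hε₀0
  obtain ⟨c₁, hc₁⟩ : ∃ x : ℝ, x = η₁ / (24 * (T + 1)) := ⟨_, rfl⟩
  have hc₁0 : 0 < c₁ := by rw [hc₁]; positivity
  obtain ⟨n₀, H⟩ := H c₁ hc₁0
  refine ⟨T, n₀, fun W _ E hn hsymm hgrid hfree => ?_⟩
  obtain ⟨Q, hQ⟩ := hcol W E hsymm hgrid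
  obtain ⟨t, ht1, htT, c, hreg⟩ := hT W Q.q
  have hn3 : (0 : ℝ) ≤ (Fintype.card W : ℝ) ^ 3 := by positivity
  have hmass := Q.sum_not_goodTriad_le E c hε' hc₀0.le hc₁0.le hθ hreg hQ
  have hη₁le : 3 * (ε₀ / ε' + c₀ * Fintype.card K + 2 * (c₁ * Fintype.card (Fin t))) + η₀ / θ ≤
      η₁ := by
    have e1 : ε₀ / ε' ≤ η₁ / 12 := by
      rw [div_le_iff₀ hε']; linarith
    have e2 : c₀ * Fintype.card K ≤ η₁ / 12 := by
      rw [← hκn]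
      calc c₀ * κn ≤ η₁ / (12 * (κn + 1)) * (κn + 1) := by
            refine mul_le_mul hc₀2 (by linarith) hκ0 (by positivity)
        _ = _ := by field_simp
    have e3 : c₁ * Fintype.card (Fin t) ≤ η₁ / 24 := by
      rw [Fintype.card_fin]
      have : (t : ℝ) ≤ T + 1 := by
        have : (t : ℝ) ≤ T := by exact_mod_cast htT
        linarith
      calc c₁ * t ≤ c₁ * (T + 1) := mul_le_mul_of_nonneg_left this hc₁0.le
        _ = _ := by rw [hc₁]; field_simp
    have e4 : η₀ / θ ≤ η₁ / 4 := by
      rw [div_le_iff₀ hθ]; linarith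
    linarith
  obtain ⟨κ, φ, hφ⟩ := H Q E c η₁ η₂ hn hη₂0 hfree
    (hmass.trans (mul_le_mul_of_nonneg_right hη₁le hn3))
  refine ⟨t, ht1, htT, c, fun x y => κ (c x) (c y) (Q.q x y), φ, fun X Y => ?_, ?_⟩
  · calc _ ≤ ∑ i, ∑ j, ∑ a, |disc Q.q c i j a (X i j (κ i j a)) (Y i j (κ i j a))| :=
          sum_le_sum fun i _ => sum_le_sum fun j _ => sum_disc_coarsen_le Q.q c κ i j _ _
      _ ≤ ε₀ * (Fintype.card W : ℝ) ^ 2 := hreg _ _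
      _ ≤ _ := mul_le_mul_of_nonneg_right hε₀1 (by positivity)
  · have h1 := card_triads_le Q.q c hreg fun i j k a b d =>
      ¬(Q.F a b d ↔ φ i j k (κ i j a) (κ i k b) (κ j k d))
    have h2 : (univ.filter fun p : W × W × W => ¬(E p.1 p.2.1 p.2.2 ↔
        φ (c p.1) (c p.2.1) (c p.2.2) (κ (c p.1) (c p.2.1) (Q.q p.1 p.2.1))
        (κ (c p.1) (c p.2.2) (Q.q p.1 p.2.2)) (κ (c p.2.1) (c p.2.2) (Q.q p.2.1 p.2.2)))) ⊆
        Q.errors E ∪ univ.filter fun p : W × W × W =>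
          ¬(Q.F (Q.q p.1 p.2.1) (Q.q p.1 p.2.2) (Q.q p.2.1 p.2.2) ↔
            φ (c p.1) (c p.2.1) (c p.2.2) (κ (c p.1) (c p.2.1) (Q.q p.1 p.2.1))
              (κ (c p.1) (c p.2.2) (Q.q p.1 p.2.2)) (κ (c p.2.1) (c p.2.2) (Q.q p.2.1 p.2.2))) := by
      intro p hp
      simp only [mem_filter, mem_union, mem_univ, true_and, SymmColouring.errors] at hp ⊢
      tauto
    have h3 : (_ : ℝ) ≤ _ := Nat.cast_le.mpr ((card_le_card h2).trans (card_union_le _ _))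
    rw [Nat.cast_add] at h3
    refine h3.trans ((add_le_add hQ
      ((le_of_eq (by congr!)).trans (h1.trans (add_le_add hφ le_rfl)))).trans ?_)
    have e1 : 2 * ((L + 1) * η₂) = η / 12 := by rw [hη₂]; field_simp; norm_num
    have e2 : 2 * (η₁ / η₂) = η / 12 := by rw [hη₁]; field_simp; norm_num
    have e3 : 2 * (Fintype.card K : ℝ) ^ 2 * ε₀ ≤ η / 4 := by
      rw [← hκn]
      calc 2 * κn ^ 2 * ε₀ ≤ 2 * (κn ^ 2 + 1) * (η / (8 * (κn ^ 2 + 1))) := by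
            refine mul_le_mul (by linarith) hε₀3 hε₀0.le (by positivity)
        _ = _ := by field_simp; norm_num
    rw [e1, e2]
    have e4 := mul_le_mul_of_nonneg_right e3 hn3
    have e5 := mul_le_mul_of_nonneg_right hη₀1 hn3
    linarith

end Structure

section LabelDecomp

variable {ι K : Type}

/-- The decomposition of a vertex set given by a labelling and a colouring of the pairs. -/
noncomputable def labelDecomp {V : Finset ℕ} (c : V → ι) (q : V → V → K) : Decomp V ι K where
  part i := (cell c i).map (Function.Embedding.subtype _)
  part_sub i x hx := by
    obtain ⟨y, -, rfl⟩ := mem_map.mp hx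
    exact y.2
  part_disj i j hij := by
    rw [disjoint_map, Finset.disjoint_left]
    intro x hx hy
    rw [mem_cell] at hx hy
    exact hij (hx.symm.trans hy)
  part_cover x hx := ⟨c ⟨x, hx⟩, mem_map.mpr ⟨⟨x, hx⟩, mem_cell.mpr rfl, rfl⟩⟩
  pairs i j a := ((cell c i ×ˢ cell c j).filter fun p => q p.1 p.2 = a).map
    ((Function.Embedding.subtype _).prodMap (Function.Embedding.subtype _))
  pairs_sub i j a p hp := by
    obtain ⟨⟨x, y⟩, h, rfl⟩ := mem_map.mp hp
    rw [mem_filter, mem_product] at h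
    exact mem_product.mpr ⟨mem_map_of_mem _ h.1.1, mem_map_of_mem _ h.1.2⟩
  pairs_disj i j a b hab := by
    rw [disjoint_map, Finset.disjoint_left]
    intro x hx hy
    rw [mem_filter] at hx hy
    exact hab (hx.2.symm.trans hy.2)
  pairs_cover i j p hp := by
    obtain ⟨x, y⟩ := p
    rw [mem_product] at hp
    obtain ⟨x, hx, rfl⟩ := mem_map.mp hp.1
    obtain ⟨y, hy, rfl⟩ := mem_map.mp hp.2
    exact ⟨q x y, mem_map.mpr ⟨(x, y), mem_filter.mpr ⟨mem_product.mpr ⟨hx, hy⟩, rfl⟩, rfl⟩⟩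

variable {V : Finset ℕ} (c : V → ι) (q : V → V → K)

lemma sum_labelDecomp_part (i : ι) (f : ℕ → ℝ) :
    ∑ x ∈ (labelDecomp c q).part i, f x = ∑ x ∈ cell c i, f x := by
  simp [labelDecomp, sum_map]

lemma card_labelDecomp_part (i : ι) : #((labelDecomp c q).part i) = #(cell c i) := card_map _

lemma mem_labelDecomp_pairs {i j : ι} {a : K} {x y : V} :
    ((x : ℕ), (y : ℕ)) ∈ (labelDecomp c q).pairs i j a ↔ c x = i ∧ c y = j ∧ q x y = a := by
  simp only [labelDecomp, mem_map, mem_filter, mem_product, mem_cell]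
  constructor
  · rintro ⟨⟨x', y'⟩, h, e⟩
    simp only [Function.Embedding.coe_prodMap, Prod.map, Function.Embedding.subtype_apply,
      Prod.mk.injEq] at e
    obtain rfl := Subtype.ext e.1
    obtain rfl := Subtype.ext e.2
    exact ⟨h.1.1, h.1.2, h.2⟩
  · rintro ⟨h1, h2, h3⟩
    exact ⟨(x, y), ⟨⟨h1, h2⟩, h3⟩, rfl⟩

lemma density_labelDecomp (i j : ι) (a : K) :
    ((labelDecomp c q).pairBG i j a).density = pdens q c i j a := by
  unfold Bigraph.density pdens
  have h : (#((labelDecomp c q).pairs i j a) : ℝ) =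
      ∑ x ∈ cell c i, ∑ y ∈ cell c j, colInd q a x y := by
    simp only [labelDecomp, card_map]
    rw [← sum_product' (f := fun x y => colInd q a x y), card_filter]
    push_cast
    rfl
  rw [← h]
  simp only [Decomp.pairBG, card_labelDecomp_part]

lemma gfun_labelDecomp {i j : ι} {a : K} {x y : V} (hx : x ∈ cell c i) (hy : y ∈ cell c j) :
    ((labelDecomp c q).pairBG i j a).gfun x y = colInd q a x y - pdens q c i j a := by
  unfold Bigraph.gfun
  rw [density_labelDecomp]
  simp only [Decomp.pairBG, mem_labelDecomp_pairs]
  rw [mem_cell] at hx hy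
  unfold colInd
  simp only [hx, hy, true_and]
  split_ifs <;> ring

lemma abs_colInd_sub_pdens_le (i j : ι) (a : K) (x y : V) :
    |colInd q a x y - pdens q c i j a| ≤ 1 := by
  have h1 := pdens_nonneg q c i j a
  have h2 := pdens_le_one q c i j a
  have h3 := colInd_nonneg q a x y
  have h4 := colInd_le_one q a x y
  rw [abs_le]
  constructor <;> linarith

lemma sum_sum_mul_le_of_regPair {i j : ι} {a : K} {δ : ℝ} (h : RegPair q c i j a δ)
    (x₁ y₁ : V) :
    |∑ x ∈ cell c i, ∑ y ∈ cell c j, (colInd q a x y - pdens q c i j a) *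
      (colInd q a x y₁ - pdens q c i j a) * (colInd q a x₁ y - pdens q c i j a)| ≤
      4 * δ * (#(cell c i) * #(cell c j)) := by
  set p := pdens q c i j a with hp
  have h1 := pdens_nonneg q c i j a
  have h2 := pdens_le_one q c i j a
  rw [← hp] at h1 h2
  set S : Finset V := univ.filter fun x => q x y₁ = a with hS
  set T : Finset V := univ.filter fun y => q x₁ y = a with hT
  have e : ∑ x ∈ cell c i, ∑ y ∈ cell c j, (colInd q a x y - p) *
      (colInd q a x y₁ - p) * (colInd q a x₁ y - p) =
      disc q c i j a S T - p * disc q c i j a S univ - p * disc q c i j a univ T +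
        p ^ 2 * disc q c i j a univ univ := by
    simp only [disc_eq_sum, Finset.mul_sum, ← sum_sub_distrib, ← sum_add_distrib]
    refine sum_congr rfl fun x _ => sum_congr rfl fun y _ => ?_
    have e1 : colInd q a x y₁ = ind (x ∈ S) := by simp [colInd, ind, hS]
    have e2 : colInd q a x₁ y = ind (y ∈ T) := by simp [colInd, ind, hT]
    rw [e1, e2, ind_true (mem_univ x), ind_true (mem_univ y)]
    ring
  rw [e]
  have b := fun X Y => h X Y
  have b0 := (abs_nonneg _).trans (b S T)
  have hm : ∀ r : ℝ, 0 ≤ r → r ≤ 1 → ∀ X Y, |r * disc q c i j a X Y| ≤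
      δ * (#(cell c i) * #(cell c j)) := fun r hr hr' X Y => by
    rw [abs_mul, abs_of_nonneg hr]
    exact (mul_le_of_le_one_left (abs_nonneg _) hr').trans (b X Y)
  have m1 := hm p h1 h2 S univ
  have m2 := hm p h1 h2 univ T
  have m3 := hm (p ^ 2) (by positivity) (pow_le_one₀ h1 h2) univ univ
  have m4 := b S T
  rw [abs_le] at *
  constructor <;> linarith [m1.1, m1.2, m2.1, m2.2, m3.1, m3.2, m4.1, m4.2]

lemma dev2self_of_regPair {i j : ι} {a : K} {δ : ℝ} (hδ : 0 ≤ δ) (h : RegPair q c i j a δ) :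
    ((labelDecomp c q).pairBG i j a).dev2self (4 * δ) := by
  refine ⟨by simpa using by positivity, ?_⟩
  unfold Bigraph.devSum
  have hl : ((labelDecomp c q).pairBG i j a).left = (labelDecomp c q).part i := rfl
  have hr : ((labelDecomp c q).pairBG i j a).right = (labelDecomp c q).part j := rfl
  rw [hl, hr, card_labelDecomp_part, card_labelDecomp_part]
  simp only [sum_labelDecomp_part]
  set p := pdens q c i j a with hp
  set g : V → V → ℝ := fun x y => colInd q a x y - p with hg
  calc _ = ∑ x₀ ∈ cell c i, ∑ x₁ ∈ cell c i, ∑ y₀ ∈ cell c j, ∑ y₁ ∈ cell c j,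
        g x₀ y₀ * g x₀ y₁ * g x₁ y₀ * g x₁ y₁ := by
        refine sum_congr rfl fun x₀ h1 => sum_congr rfl fun x₁ h2 => sum_congr rfl fun y₀ h3 =>
          sum_congr rfl fun y₁ h4 => ?_
        rw [gfun_labelDecomp c q h1 h3, gfun_labelDecomp c q h1 h4, gfun_labelDecomp c q h2 h3,
          gfun_labelDecomp c q h2 h4]
    _ = ∑ x₁ ∈ cell c i, ∑ y₁ ∈ cell c j, g x₁ y₁ * ∑ x₀ ∈ cell c i, ∑ y₀ ∈ cell c j,
        g x₀ y₀ * g x₀ y₁ * g x₁ y₀ := by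
        rw [Finset.sum_comm]
        refine sum_congr rfl fun x₁ _ => ?_
        simp only [Finset.mul_sum]
        symm
        rw [Finset.sum_comm]
        refine sum_congr rfl fun x₀ _ => ?_
        rw [Finset.sum_comm]
        refine sum_congr rfl fun y₀ _ => sum_congr rfl fun y₁ _ => ?_
        ring
    _ ≤ ∑ x₁ ∈ cell c i, ∑ y₁ ∈ cell c j, 4 * δ * (#(cell c i) * #(cell c j)) := by
        refine sum_le_sum fun x₁ _ => sum_le_sum fun y₁ _ => ?_
        refine (le_abs_self _).trans ?_
        rw [abs_mul]
        refine (mul_le_of_le_one_left (abs_nonneg _) (abs_colInd_sub_pdens_le c q i j a x₁ y₁)).trans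
          (sum_sum_mul_le_of_regPair c q h x₁ y₁)
    _ = _ := by
        simp only [sum_const, nsmul_eq_mul]
        ring

end LabelDecomp

section DevSum

lemma relDensity_nonneg (R : Finset (ℕ × ℕ × ℕ)) (G : Triad) : 0 ≤ relDensity R G := by
  unfold relDensity; positivity

lemma relDensity_le_one (R : Finset (ℕ × ℕ × ℕ)) (G : Triad) : relDensity R G ≤ 1 :=
  div_le_one_of_le₀ (Nat.cast_le.mpr (card_le_card inter_subset_right)) (Nat.cast_nonneg _)

lemma abs_hFun_le_one (R : Finset (ℕ × ℕ × ℕ)) (G : Triad) (x y z : ℕ) : |hFun R G x y z| ≤ 1 := by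
  have h1 := relDensity_nonneg R G
  have h2 := relDensity_le_one R G
  unfold hFun
  split_ifs <;> rw [abs_le] <;> constructor <;> linarith

lemma abs_hFun (R : Finset (ℕ × ℕ × ℕ)) (G : Triad) (x y z : ℕ) :
    |hFun R G x y z| = (1 - relDensity R G) * (if (x, y, z) ∈ R ∩ G.K3 then 1 else 0) +
      relDensity R G * (if (x, y, z) ∈ G.K3 \ R then 1 else 0) := by
  have h1 := relDensity_nonneg R G
  have h2 := relDensity_le_one R G
  unfold hFun
  by_cases hK : (x, y, z) ∈ G.K3 <;> by_cases hR : (x, y, z) ∈ R <;>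
    simp [hK, hR, abs_of_nonneg, h1, h2]

lemma sum_ite_mem_eq_card {S X : Finset (ℕ × ℕ × ℕ)} (h : S ⊆ X) :
    ∑ p ∈ X, (if p ∈ S then 1 else 0 : ℝ) = #S := by
  rw [← sum_filter, filter_mem_eq_inter, inter_eq_right.mpr h]
  simp

lemma sum_abs_hFun_le (R : Finset (ℕ × ℕ × ℕ)) (G : Triad) {M : ℝ}
    (hM : (#(R ∩ G.K3) : ℝ) ≤ M ∨ (#(G.K3 \ R) : ℝ) ≤ M) :
    ∑ x ∈ G.X, ∑ y ∈ G.Y, ∑ z ∈ G.Z, |hFun R G x y z| ≤ 2 * M := by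
  have hsub : G.K3 ⊆ G.X ×ˢ G.Y ×ˢ G.Z := filter_subset _ _
  have e : ∑ x ∈ G.X, ∑ y ∈ G.Y, ∑ z ∈ G.Z, |hFun R G x y z| =
      (1 - relDensity R G) * #(R ∩ G.K3) + relDensity R G * #(G.K3 \ R) := by
    rw [← sum_ite_mem_eq_card (inter_subset_right.trans hsub : R ∩ G.K3 ⊆ _),
      ← sum_ite_mem_eq_card (sdiff_subset.trans hsub : G.K3 \ R ⊆ _)]
    simp only [sum_product, Finset.mul_sum, ← sum_add_distrib]
    exact sum_congr rfl fun x _ => sum_congr rfl fun y _ => sum_congr rfl fun z _ => abs_hFun _ _ _ _ _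
  rw [e]
  have hN : (#(R ∩ G.K3) : ℝ) + #(G.K3 \ R) = #G.K3 := by
    rw [← card_inter_add_card_sdiff G.K3 R, inter_comm]
    push_cast
    rfl
  have hd : relDensity R G * #G.K3 = #(R ∩ G.K3) := by
    unfold relDensity
    by_cases h0 : (#G.K3 : ℝ) = 0
    · have : (0 : ℝ) ≤ #(G.K3 \ R) := Nat.cast_nonneg _
      have : (0 : ℝ) ≤ #(R ∩ G.K3) := Nat.cast_nonneg _
      rw [h0]; linarith
    · rw [div_mul_cancel₀ _ h0]
  have h1 := relDensity_nonneg R G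
  have h2 := relDensity_le_one R G
  have ha : (0 : ℝ) ≤ #(R ∩ G.K3) := Nat.cast_nonneg _
  have hb : (0 : ℝ) ≤ #(G.K3 \ R) := Nat.cast_nonneg _
  rw [← hN] at hd
  rcases hM with hM | hM <;> nlinarith

/-- Triads on which the relation is nearly constant have small octahedral deviation. -/
lemma devSum3_le (R : Finset (ℕ × ℕ × ℕ)) (G : Triad) {M : ℝ}
    (hM : (#(R ∩ G.K3) : ℝ) ≤ M ∨ (#(G.K3 \ R) : ℝ) ≤ M) :
    devSum3 R G ≤ 2 * M * (#G.X * #G.Y * #G.Z) := by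
  have h1 := abs_hFun_le_one R G
  calc devSum3 R G ≤ ∑ x₀ ∈ G.X, ∑ x₁ ∈ G.X, ∑ y₀ ∈ G.Y, ∑ y₁ ∈ G.Y, ∑ z₀ ∈ G.Z, ∑ z₁ ∈ G.Z,
        |hFun R G x₀ y₀ z₀| := by
        refine sum_le_sum fun x₀ _ => sum_le_sum fun x₁ _ => sum_le_sum fun y₀ _ =>
          sum_le_sum fun y₁ _ => sum_le_sum fun z₀ _ => sum_le_sum fun z₁ _ => ?_
        refine (le_abs_self _).trans ?_
        simp only [abs_mul]
        refine (mul_le_of_le_one_right (by positivity) (h1 _ _ _)).trans ?_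
        refine (mul_le_of_le_one_right (by positivity) (h1 _ _ _)).trans ?_
        refine (mul_le_of_le_one_right (by positivity) (h1 _ _ _)).trans ?_
        refine (mul_le_of_le_one_right (by positivity) (h1 _ _ _)).trans ?_
        refine (mul_le_of_le_one_right (by positivity) (h1 _ _ _)).trans ?_
        refine (mul_le_of_le_one_right (by positivity) (h1 _ _ _)).trans ?_
        exact mul_le_of_le_one_right (by positivity) (h1 _ _ _)
    _ = (∑ x ∈ G.X, ∑ y ∈ G.Y, ∑ z ∈ G.Z, |hFun R G x y z|) * (#G.X * #G.Y * #G.Z) := by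
        simp only [sum_const, nsmul_eq_mul, Finset.sum_mul, Finset.mul_sum]
        refine sum_congr rfl fun x _ => sum_congr rfl fun y _ => sum_congr rfl fun z _ => by ring
    _ ≤ _ := mul_le_mul_of_nonneg_right (sum_abs_hFun_le R G hM) (by positivity)

end DevSum

section UpperBound

variable {ι K : Type} {V : Finset ℕ} (c : V → ι) (q : V → V → K)

lemma Triad.mem_K3 {G : Triad} {x y z : ℕ} : (x, y, z) ∈ G.K3 ↔ (x ∈ G.X ∧ y ∈ G.Y ∧ z ∈ G.Z) ∧
    (x, y) ∈ G.EXY ∧ (y, z) ∈ G.EYZ ∧ (x, z) ∈ G.EXZ := by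
  rw [Triad.K3, mem_filter, mem_product, mem_product]

lemma mem_labelDecomp_K3 {i j k : ι} {a b d : K} {x y z : V} :
    ((x : ℕ), (y : ℕ), (z : ℕ)) ∈ ((labelDecomp c q).triadOf i j k a b d).K3 ↔
      (c x = i ∧ c y = j ∧ c z = k) ∧ q x y = a ∧ q x z = b ∧ q y z = d := by
  rw [Triad.mem_K3]
  simp only [Decomp.triadOf, mem_labelDecomp_pairs]
  have h : ∀ (l : ι) (w : V), (w : ℕ) ∈ (labelDecomp c q).part l ↔ c w = l := by
    intro l w
    simp [labelDecomp, mem_cell]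
  rw [h, h, h]
  tauto

lemma card_inter_K3_le_or (R : Finset (ℕ × ℕ × ℕ)) (i j k : ι) (a b d : K) (P : Prop) {N : ℕ}
    (hN : #(univ.filter fun p : V × V × V => ¬((p.1.1, p.2.1.1, p.2.2.1) ∈ R ↔ P) ∧
      (c p.1 = i ∧ c p.2.1 = j ∧ c p.2.2 = k) ∧
      q p.1 p.2.1 = a ∧ q p.1 p.2.2 = b ∧ q p.2.1 p.2.2 = d) ≤ N) :
    #(R ∩ ((labelDecomp c q).triadOf i j k a b d).K3) ≤ N ∨
      #(((labelDecomp c q).triadOf i j k a b d).K3 \ R) ≤ N := by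
  obtain ⟨G, hG⟩ : ∃ G, G = (labelDecomp c q).triadOf i j k a b d := ⟨_, rfl⟩
  rw [← hG]
  have key : ∀ S ⊆ G.K3, (∀ p ∈ S, ¬(p ∈ R ↔ P)) → #S ≤ N := by
    intro S hS hP
    refine (card_le_card ?_).trans ((card_image_le
      (f := fun p : V × V × V => (p.1.1, p.2.1.1, p.2.2.1))).trans hN)
    rintro ⟨x, y, z⟩ hp
    have hK := hS hp
    rw [hG] at hK
    have hK' := (Triad.mem_K3.mp hK).1
    have hx := (labelDecomp c q).part_sub _ hK'.1
    have hy := (labelDecomp c q).part_sub _ hK'.2.1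
    have hz := (labelDecomp c q).part_sub _ hK'.2.2
    have hK2 := (mem_labelDecomp_K3 c q (x := ⟨x, hx⟩) (y := ⟨y, hy⟩) (z := ⟨z, hz⟩)).mp hK
    exact mem_image.mpr ⟨(⟨x, hx⟩, ⟨y, hy⟩, ⟨z, hz⟩),
      mem_filter.mpr ⟨mem_univ _, hP _ hp, hK2⟩, rfl⟩
  by_cases hP : P
  · exact Or.inr (key _ sdiff_subset fun p hp h => (mem_sdiff.mp hp).2 (h.mpr hP))
  · exact Or.inl (key _ inter_subset_right fun p hp h => hP (h.mp (mem_inter.mp hp).1))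

lemma sum_labels_heavy_le {A T : Type} [Fintype A] [Fintype T] (lab : A → T) (err : A → Prop)
    (size : T → ℝ) {μ : ℝ} (hμ : 0 < μ) (hsize : ∀ τ, (#(univ.filter fun p => lab p = τ) : ℝ) ≤ size τ) :
    μ * #(univ.filter fun p => μ * size (lab p) < #(univ.filter fun p' => err p' ∧ lab p' = lab p)) ≤
      (#(univ.filter err) : ℝ) := by
  set heavy : Finset T := univ.filter fun τ =>
    μ * size τ < #(univ.filter fun p' => err p' ∧ lab p' = τ) with hh
  have h1 : (#(univ.filter fun p => μ * size (lab p) <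
      #(univ.filter fun p' => err p' ∧ lab p' = lab p)) : ℝ) =
      ∑ τ ∈ heavy, (#(univ.filter fun p => lab p = τ) : ℝ) := by
    rw [Finset.card_eq_sum_card_fiberwise (f := lab) (t := heavy)]
    · push_cast
      refine sum_congr rfl fun τ hτ => ?_
      congr 2
      ext p
      simp only [mem_filter, mem_univ, true_and, hh] at hτ ⊢
      constructor
      · exact fun h => h.2
      · rintro rfl
        exact ⟨hτ, rfl⟩
    · intro p hp
      simpa [hh] using hp
  have h2 : (#(univ.filter err) : ℝ) = ∑ τ, (#(univ.filter fun p' => err p' ∧ lab p' = τ) : ℝ) := by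
    rw [Finset.card_eq_sum_card_fiberwise (f := lab) (t := univ) (fun _ _ => mem_univ _)]
    push_cast
    refine sum_congr rfl fun τ _ => ?_
    rw [filter_filter]
  rw [h1, h2, Finset.mul_sum]
  refine le_trans (sum_le_sum fun τ hτ => ?_)
    (sum_le_sum_of_subset_of_nonneg (subset_univ heavy) fun _ _ _ => Nat.cast_nonneg _)
  exact (mul_le_mul_of_nonneg_left (hsize τ) hμ.le).trans (mem_filter.mp hτ).2.le

lemma card_filter_pair_triple (B : Finset (V × V)) (f : V × V × V → (V × V) × V)
    (hf : Function.Injective f) :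
    (#(univ.filter fun p : V × V × V => (f p).1 ∈ B) : ℝ) ≤ #B * Fintype.card V := by
  rw [← card_univ, ← Nat.cast_mul, ← card_product]
  refine Nat.cast_le.mpr (card_le_card_of_injOn f (fun p hp => ?_) hf.injOn)
  simpa using hp

variable [Fintype ι] [Fintype K]

lemma card_filter_pairs_eq (P : ι → ι → K → Prop) :
    (#(univ.filter fun p : V × V => P (c p.1) (c p.2) (q p.1 p.2)) : ℝ) =
      ∑ i, ∑ j, (#(cell c i) : ℝ) * #(cell c j) * ∑ a, pdens q c i j a * ind (P i j a) := by
  have h : ∀ i j, (#(cell c i) : ℝ) * #(cell c j) * ∑ a, pdens q c i j a * ind (P i j a) =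
      ∑ x ∈ cell c i, ∑ y ∈ cell c j, ind (P (c x) (c y) (q x y)) := by
    intro i j
    rw [Finset.mul_sum]
    have : ∀ a, (#(cell c i) : ℝ) * #(cell c j) * (pdens q c i j a * ind (P i j a)) =
        ∑ x ∈ cell c i, ∑ y ∈ cell c j, colInd q a x y * ind (P i j a) := by
      intro a
      rw [← mul_assoc, mul_comm (_ * _) (pdens q c i j a), pdens_mul]
      simp only [Finset.sum_mul]
    simp only [this]
    rw [Finset.sum_comm]
    refine sum_congr rfl fun x hx => ?_
    rw [Finset.sum_comm]
    refine sum_congr rfl fun y hy => ?_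
    rw [mem_cell] at hx hy
    simp [colInd, hx, hy]
  simp only [h]
  rw [← sum_sum_cell c, card_filter]
  push_cast
  rw [Fintype.sum_prod_type]
  rfl

variable {c q} in
lemma card_not_goodColour_le {c₀ δ ε₀ : ℝ} (hδ : 0 < δ) (hc₀ : 0 ≤ c₀)
    (hreg : ∀ X Y : ι → ι → K → Finset V,
      ∑ i, ∑ j, ∑ a, |disc q c i j a (X i j a) (Y i j a)| ≤ ε₀ * (Fintype.card V : ℝ) ^ 2) :
    (#(univ.filter fun p : V × V => ¬GoodColour q c c₀ 0 δ (c p.1) (c p.2) (q p.1 p.2)) : ℝ) ≤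
      (ε₀ / δ + c₀ * Fintype.card K) * (Fintype.card V : ℝ) ^ 2 := by
  refine (le_of_eq ?_).trans ((card_filter_pairs_eq c q
    fun i j a => ¬GoodColour q c c₀ 0 δ i j a).le.trans ?_)
  · congr!
  refine (sum_not_goodColour_le q c hδ hc₀ le_rfl hreg).trans_eq ?_
  ring

variable {c q} in
lemma isReg_labelDecomp {c₀ δ ε₀ ε₁ : ℝ} (hδ : 0 < δ) (hc₀ : 0 ≤ c₀)
    (hreg : ∀ X Y : ι → ι → K → Finset V,
      ∑ i, ∑ j, ∑ a, |disc q c i j a (X i j a) (Y i j a)| ≤ ε₀ * (Fintype.card V : ℝ) ^ 2)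
    (hε : ε₀ / δ + c₀ * Fintype.card K ≤ ε₁) :
    (labelDecomp c q).isReg ε₁ (4 * δ) := by
  have hb := card_not_goodColour_le hδ hc₀ hreg
  have hc := card_filter_add_card_filter_not (s := (univ : Finset (V × V)))
    (fun p : V × V => GoodColour q c c₀ 0 δ (c p.1) (c p.2) (q p.1 p.2))
  have hn : (Fintype.card V : ℝ) = #V := by rw [Fintype.card_coe]
  have hc' : (#(univ.filter fun p : V × V => GoodColour q c c₀ 0 δ (c p.1) (c p.2) (q p.1 p.2)) : ℝ) +
      #(univ.filter fun p : V × V => ¬GoodColour q c c₀ 0 δ (c p.1) (c p.2) (q p.1 p.2)) =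
      (Fintype.card V : ℝ) ^ 2 := by
    rw [← Nat.cast_add, hc, card_univ, Fintype.card_prod, Nat.cast_mul, sq]
  have hm : (#(univ.filter fun p : V × V =>
      GoodColour q c c₀ 0 δ (c p.1) (c p.2) (q p.1 p.2)) : ℝ) ≤
      #((V ×ˢ V).filter fun p => ∃ i j α, p ∈ (labelDecomp c q).pairs i j α ∧
        ((labelDecomp c q).pairBG i j α).dev2self (4 * δ)) := by
    refine Nat.cast_le.mpr (card_le_card_of_injOn (fun p => ((p.1 : ℕ), (p.2 : ℕ))) ?_ ?_)
    · intro p hp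
      rw [mem_coe, mem_filter] at hp ⊢
      exact ⟨mem_product.mpr ⟨p.1.2, p.2.2⟩, _, _, _,
        (mem_labelDecomp_pairs c q).mpr ⟨rfl, rfl, rfl⟩,
        dev2self_of_regPair c q hδ.le hp.2.pair.reg⟩
    · rintro ⟨x, y⟩ - ⟨x', y'⟩ - h
      simp only [Prod.mk.injEq] at h
      rw [Subtype.ext h.1, Subtype.ext h.2]
  refine le_trans ?_ (hm.trans_eq (by congr!))
  rw [← hn]
  have := mul_le_mul_of_nonneg_right hε (sq_nonneg (Fintype.card V : ℝ))
  linarith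

end UpperBound

section UpperBoundTriples

variable {ι K : Type} {V : Finset ℕ} {c : V → ι} {q : V → V → K}

lemma dev23_labelDecomp {c₀ δ μ ε₁ : ℝ} (hδ : 0 ≤ δ) (hc₀ : 0 < c₀) (hε₁ : 0 ≤ ε₁)
    (hμ : 2 * μ ≤ ε₁ * c₀ ^ 12) (R : Finset (ℕ × ℕ × ℕ)) (P : Prop) {i j k : ι} {a b d : K}
    (h₁ : GoodColour q c c₀ 0 δ i j a) (h₂ : GoodColour q c c₀ 0 δ i k b)
    (h₃ : GoodColour q c c₀ 0 δ j k d)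
    (hN : (#(univ.filter fun p : V × V × V => ¬((p.1.1, p.2.1.1, p.2.2.1) ∈ R ↔ P) ∧
      (c p.1 = i ∧ c p.2.1 = j ∧ c p.2.2 = k) ∧
      q p.1 p.2.1 = a ∧ q p.1 p.2.2 = b ∧ q p.2.1 p.2.2 = d) : ℝ) ≤
      μ * (#(cell c i) * #(cell c j) * #(cell c k))) :
    dev23 R ((labelDecomp c q).triadOf i j k a b d) ε₁ (4 * δ) := by
  have hd : ∀ {i j a}, GoodColour q c c₀ 0 δ i j a →
      ((labelDecomp c q).pairBG i j a).dev2 (4 * δ) (pdens q c i j a) := by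
    intro i j a h
    have := dev2self_of_regPair c q hδ h.pair.reg
    rwa [Bigraph.dev2self, density_labelDecomp] at this
  refine ⟨pdens q c i j a, pdens q c j k d, pdens q c i k b, hc₀.trans_le h₁.pair.dens,
    hc₀.trans_le h₃.pair.dens, hc₀.trans_le h₂.pair.dens, hd h₁, hd h₂, hd h₃, ?_⟩
  have e := devSum3_le R ((labelDecomp c q).triadOf i j k a b d)
    (M := μ * (#(cell c i) * #(cell c j) * #(cell c k)))
    ((card_inter_K3_le_or c q R i j k a b d P le_rfl).imp
      (fun h => (Nat.cast_le.mpr h).trans hN) fun h => (Nat.cast_le.mpr h).trans hN)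
  have hX : #((labelDecomp c q).triadOf i j k a b d).X = #(cell c i) := card_labelDecomp_part c q i
  have hY : #((labelDecomp c q).triadOf i j k a b d).Y = #(cell c j) := card_labelDecomp_part c q j
  have hZ : #((labelDecomp c q).triadOf i j k a b d).Z = #(cell c k) := card_labelDecomp_part c q k
  rw [hX, hY, hZ] at e ⊢
  refine e.trans ?_
  have hp : c₀ ^ 12 ≤ pdens q c i j a ^ 4 * pdens q c j k d ^ 4 * pdens q c i k b ^ 4 := by
    calc c₀ ^ 12 = c₀ ^ 4 * c₀ ^ 4 * c₀ ^ 4 := by ring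
      _ ≤ _ := by
        have := h₁.pair.dens
        have := h₂.pair.dens
        have := h₃.pair.dens
        gcongr
  have hs : (0 : ℝ) ≤ (#(cell c i) * #(cell c j) * #(cell c k)) ^ 2 := by positivity
  have := mul_le_mul_of_nonneg_right (hμ.trans (mul_le_mul_of_nonneg_left hp hε₁)) hs
  linarith

lemma regWrt_labelDecomp [Fintype ι] [Fintype K] {c₀ δ ε₀ ε₁ μ η : ℝ} (hδ : 0 < δ) (hc₀ : 0 < c₀) (hε₁ : 0 ≤ ε₁)
    (hμ0 : 0 < μ) (hμ : 2 * μ ≤ ε₁ * c₀ ^ 12)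
    (hreg : ∀ X Y : ι → ι → K → Finset V,
      ∑ i, ∑ j, ∑ a, |disc q c i j a (X i j a) (Y i j a)| ≤ ε₀ * (Fintype.card V : ℝ) ^ 2)
    (R : Finset (ℕ × ℕ × ℕ)) (φ : ι → ι → ι → K → K → K → Prop)
    (herr : (#(univ.filter fun p : V × V × V => ¬((p.1.1, p.2.1.1, p.2.2.1) ∈ R ↔
      φ (c p.1) (c p.2.1) (c p.2.2) (q p.1 p.2.1) (q p.1 p.2.2) (q p.2.1 p.2.2))) : ℝ) ≤
      η * (Fintype.card V : ℝ) ^ 3)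
    (hε : 3 * (ε₀ / δ + c₀ * Fintype.card K) + η / μ ≤ ε₁) :
    (labelDecomp c q).regWrt R ε₁ (4 * δ) := by
  set β := ε₀ / δ + c₀ * Fintype.card K with hβ
  set n : ℝ := (Fintype.card V : ℝ) with hn
  have hn0 : 0 ≤ n := Nat.cast_nonneg _
  have hnV : n = #V := by rw [hn, Fintype.card_coe]
  set bad : Finset (V × V) := univ.filter fun p =>
    ¬GoodColour q c c₀ 0 δ (c p.1) (c p.2) (q p.1 p.2) with hbad
  have hb : (#bad : ℝ) ≤ β * n ^ 2 := card_not_goodColour_le hδ hc₀.le hreg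
  set lab : V × V × V → ι × ι × ι × K × K × K := fun p =>
    (c p.1, c p.2.1, c p.2.2, q p.1 p.2.1, q p.1 p.2.2, q p.2.1 p.2.2) with hlab
  set size : ι × ι × ι × K × K × K → ℝ := fun τ =>
    #(cell c τ.1) * #(cell c τ.2.1) * #(cell c τ.2.2.1) with hsize
  set err : V × V × V → Prop := fun p => ¬((p.1.1, p.2.1.1, p.2.2.1) ∈ R ↔
      φ (c p.1) (c p.2.1) (c p.2.2) (q p.1 p.2.1) (q p.1 p.2.2) (q p.2.1 p.2.2)) with herr'
  set heavy : Finset (V × V × V) := univ.filter fun p =>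
    μ * size (lab p) < #(univ.filter fun p' => err p' ∧ lab p' = lab p) with hheavy
  have h4 : (#heavy : ℝ) ≤ η / μ * n ^ 3 := by
    have := sum_labels_heavy_le lab err size hμ0 fun τ => by
      simp only [hsize]
      rw [← Nat.cast_mul, ← Nat.cast_mul, mul_assoc, ← card_product, ← card_product]
      refine Nat.cast_le.mpr (card_le_card fun p hp => ?_)
      simp only [mem_filter, mem_univ, true_and, hlab] at hp
      subst hp
      simp [mem_cell]
    rw [div_mul_eq_mul_div, le_div_iff₀ hμ0, mul_comm]
    refine (le_of_eq ?_).trans (this.trans ((le_of_eq (by congr!)).trans herr))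
    simp only [hheavy]
    congr!
  set good : V × V × V → Prop := fun p => (p.1, p.2.1) ∉ bad ∧ (p.1, p.2.2) ∉ bad ∧
    (p.2.1, p.2.2) ∉ bad ∧ p ∉ heavy with hgood
  have h1 := card_filter_pair_triple (V := V) bad (fun p => ((p.1, p.2.1), p.2.2))
    fun p p' h => by
      simp only [Prod.mk.injEq] at h
      exact Prod.ext h.1.1 (Prod.ext h.1.2 h.2)
  have h2 := card_filter_pair_triple (V := V) bad (fun p => ((p.1, p.2.2), p.2.1))
    fun p p' h => by
      simp only [Prod.mk.injEq] at h
      exact Prod.ext h.1.1 (Prod.ext h.2 h.1.2)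
  have h3 := card_filter_pair_triple (V := V) bad (fun p => ((p.2.1, p.2.2), p.1))
    fun p p' h => by
      simp only [Prod.mk.injEq] at h
      exact Prod.ext h.2 (Prod.ext h.1.1 h.1.2)
  have hng : (#(univ.filter fun p => ¬good p) : ℝ) ≤ (3 * β + η / μ) * n ^ 3 := by
    have hsub : (univ.filter fun p => ¬good p) ⊆
        (univ.filter fun p : V × V × V => (p.1, p.2.1) ∈ bad) ∪
        ((univ.filter fun p : V × V × V => (p.1, p.2.2) ∈ bad) ∪
        ((univ.filter fun p : V × V × V => (p.2.1, p.2.2) ∈ bad) ∪ heavy)) := by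
      intro p hp
      simp only [mem_filter, mem_univ, true_and, hgood, not_and_or, not_not] at hp
      simp only [mem_union, mem_filter, mem_univ, true_and]
      exact hp
    have := (card_le_card hsub).trans ((card_union_le _ _).trans (Nat.add_le_add_left
      ((card_union_le _ _).trans (Nat.add_le_add_left (card_union_le _ _) _)) _))
    have := Nat.cast_le (α := ℝ).mpr this
    push_cast at this
    have hbn := mul_le_mul_of_nonneg_right hb hn0
    refine this.trans ((add_le_add h1 (add_le_add h2 (add_le_add h3 h4))).trans ?_)
    rw [← hn]
    linarith
  have hc := card_filter_add_card_filter_not (s := (univ : Finset (V × V × V))) good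
  have hc' : (#(univ.filter good) : ℝ) + #(univ.filter fun p => ¬good p) = n ^ 3 := by
    rw [← Nat.cast_add, hc, card_univ, Fintype.card_prod, Fintype.card_prod, Nat.cast_mul,
      Nat.cast_mul, ← hn]
    ring
  have hm : (#(univ.filter good) : ℝ) ≤ #((V ×ˢ V ×ˢ V).filter fun p =>
      ∃ i j k α β γ, p ∈ ((labelDecomp c q).triadOf i j k α β γ).K3 ∧
        dev23 R ((labelDecomp c q).triadOf i j k α β γ) ε₁ (4 * δ)) := by
    refine Nat.cast_le.mpr (card_le_card_of_injOn (fun p => (p.1.1, p.2.1.1, p.2.2.1)) ?_ ?_)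
    · intro p hp
      rw [mem_coe, mem_filter] at hp ⊢
      obtain ⟨-, g1, g2, g3, g4⟩ := hp
      simp only [hbad, mem_filter, mem_univ, true_and, not_not] at g1 g2 g3
      simp only [hheavy, mem_filter, mem_univ, true_and, not_lt] at g4
      refine ⟨mem_product.mpr ⟨p.1.2, mem_product.mpr ⟨p.2.1.2, p.2.2.2⟩⟩, _, _, _, _, _, _,
        (mem_labelDecomp_K3 c q).mpr ⟨⟨rfl, rfl, rfl⟩, rfl, rfl, rfl⟩,
        dev23_labelDecomp hδ.le hc₀ hε₁ hμ R
          (φ (c p.1) (c p.2.1) (c p.2.2) (q p.1 p.2.1) (q p.1 p.2.2) (q p.2.1 p.2.2))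
          g1 g2 g3 (le_trans (Nat.cast_le.mpr (card_le_card fun p' hp' => ?_)) g4)⟩
      simp only [mem_filter, mem_univ, true_and] at hp' ⊢
      obtain ⟨he, ⟨e1, e2, e3⟩, e4, e5, e6⟩ := hp'
      refine ⟨?_, ?_⟩
      · simp only [herr', e1, e2, e3, e4, e5, e6]
        exact he
      · simp only [hlab, e1, e2, e3, e4, e5, e6]
    · rintro ⟨x, y, z⟩ - ⟨x', y', z'⟩ - h
      simp only [Prod.mk.injEq] at h
      rw [Subtype.ext h.1, Subtype.ext h.2.1, Subtype.ext h.2.2]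
  refine le_trans ?_ (hm.trans_eq (by congr!))
  rw [← hnV]
  have := mul_le_mul_of_nonneg_right hε (pow_nonneg hn0 3)
  linarith

end UpperBoundTriples

section GoodDecomposition

/-- The edge relation of a 3-graph on its vertex set. -/
def ThreeGraph.rel (H : ThreeGraph) (x y z : H.verts) : Prop := ({x.1, y.1, z.1} : Finset ℕ) ∈ H.edges

lemma ThreeGraph.ternarySymm_rel (H : ThreeGraph) : TernarySymm H.rel where
  swap₁₂ x y z h := by
    unfold ThreeGraph.rel at *
    rwa [Finset.insert_comm]
  swap₂₃ x y z h := by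
    unfold ThreeGraph.rel at *
    rwa [Finset.pair_comm z.1 y.1]

/-- Large 3-graphs of bounded complexity that are free of blowups have regular decompositions with
`L` classes of pairs. -/
theorem exists_goodDecomp {L : ℕ} (hL : 1 ≤ L) (m k : ℕ) {ε₁ ε₂ : ℝ} (hε₁ : 0 < ε₁)
    (hε₂ : 0 < ε₂) :
    ∃ T n₀ : ℕ, ∀ H : ThreeGraph, n₀ ≤ #H.verts → ¬GridShattered H.rel k →
      BlowupFree H.rel m (L + 1) → ∃ t, 1 ≤ t ∧ t ≤ T ∧ GoodDecomp H t L ε₁ ε₂ := by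
  have hL0 : (0 : ℝ) < L := by exact_mod_cast hL
  obtain ⟨δ, hδ⟩ : ∃ δ, δ = ε₂ / 4 := ⟨_, rfl⟩
  have hδ0 : 0 < δ := by rw [hδ]; positivity
  obtain ⟨c₀, hc₀⟩ : ∃ c₀, c₀ = ε₁ / (12 * L) := ⟨_, rfl⟩
  have hc₀0 : 0 < c₀ := by rw [hc₀]; positivity
  obtain ⟨μ, hμ⟩ : ∃ μ, μ = ε₁ * c₀ ^ 12 / 2 := ⟨_, rfl⟩
  have hμ0 : 0 < μ := by rw [hμ]; positivity
  obtain ⟨T, n₀, h⟩ := exists_regular_structure hL m k (ε := δ * ε₁ / 12) (η := μ * ε₁ / 2)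
    (by positivity) (by positivity)
  refine ⟨T, n₀, fun H hn hgrid hfree => ?_⟩
  obtain ⟨t, ht1, htT, c, q, φ, hreg, herr⟩ := h H.verts H.rel (by rwa [Fintype.card_coe])
    H.ternarySymm_rel hgrid hfree
  have e1 : δ * ε₁ / 12 / δ = ε₁ / 12 := by field_simp
  have e2 : c₀ * Fintype.card (Fin L) = ε₁ / 12 := by
    rw [hc₀, Fintype.card_fin]; field_simp
  have e3 : μ * ε₁ / 2 / μ = ε₁ / 2 := by field_simp
  have e4 : ε₂ = 4 * δ := by rw [hδ]; ring
  refine ⟨t, ht1, htT, labelDecomp c q, ?_, ?_⟩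
  · rw [e4]
    exact isReg_labelDecomp hδ0 hc₀0.le hreg (by rw [e1, e2]; linarith)
  · rw [e4]
    refine regWrt_labelDecomp hδ0 hc₀0 hε₁.le hμ0 (by rw [hμ]; linarith) hreg H.obar φ ?_
      (by rw [e1, e2, e3]; linarith)
    refine le_trans (Nat.cast_le.mpr (card_le_card fun p hp => ?_)) herr
    simp only [mem_filter, mem_univ, true_and] at hp ⊢
    have hR : (p.1.1, p.2.1.1, p.2.2.1) ∈ H.obar ↔ H.rel p.1 p.2.1 p.2.2 := by
      simp [ThreeGraph.obar, ThreeGraph.rel]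
    rwa [hR] at hp

end GoodDecomposition

section Pullback

/-- The 3-graph on `S` obtained by pulling back along an injection. -/
noncomputable def ThreeGraph.pullback (H : ThreeGraph) (g : ℕ → ℕ) (S : Finset ℕ)
    (hg : Set.InjOn g S) : ThreeGraph where
  verts := S
  edges := S.powerset.filter fun e => e.image g ∈ H.edges
  edges_sub e he := by
    rw [mem_filter, mem_powerset] at he
    refine ⟨he.1, ?_⟩
    rw [← (H.edges_sub _ he.2).2, card_image_of_injOn (hg.mono (coe_subset.mpr he.1))]

lemma ThreeGraph.containsInduced_pullback (H : ThreeGraph) (g : ℕ → ℕ) (S : Finset ℕ)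
    (hg : Set.InjOn g S) (hS : ∀ x ∈ S, g x ∈ H.verts) :
    H.ContainsInduced (H.pullback g S hg) := by
  have hinv : ∀ x ∈ S, Function.invFunOn g S (g x) = x := fun x hx =>
    hg.leftInvOn_invFunOn (mem_coe.mpr hx)
  refine ⟨S.image g, Function.invFunOn g S, ⟨?_, ?_, ?_⟩, ?_⟩
  · intro y hy
    simp only [ThreeGraph.induce, coe_inter, coe_image, Set.mem_inter_iff, Set.mem_image] at hy
    obtain ⟨-, x, hx, rfl⟩ := hy
    rw [hinv x hx]
    exact hx
  · intro y hy y' hy' h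
    simp only [ThreeGraph.induce, coe_inter, coe_image, Set.mem_inter_iff, Set.mem_image] at hy hy'
    obtain ⟨-, x, hx, rfl⟩ := hy
    obtain ⟨-, x', hx', rfl⟩ := hy'
    rw [hinv x hx, hinv x' hx'] at h
    rw [h]
  · intro x hx
    refine ⟨g x, ?_, hinv x hx⟩
    simp only [ThreeGraph.induce, coe_inter, coe_image, Set.mem_inter_iff]
    exact ⟨hS x hx, Set.mem_image_of_mem g hx⟩
  · intro a' ha' b' hb' c' hc'
    have key : ∀ y ∈ (H.induce (S.image g)).verts, ∃ x ∈ S, g x = y := fun y hy => by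
      simpa using (mem_inter.mp hy).2
    obtain ⟨a, ha, rfl⟩ := key a' ha'
    obtain ⟨b, hb, rfl⟩ := key b' hb'
    obtain ⟨c, hc, rfl⟩ := key c' hc'
    rw [hinv a ha, hinv b hb, hinv c hc]
    have e : ({a, b, c} : Finset ℕ).image g = {g a, g b, g c} := by simp [image_insert]
    have hs : ({a, b, c} : Finset ℕ) ⊆ S := by
      simp [insert_subset_iff, ha, hb, hc]
    simp only [ThreeGraph.induce, ThreeGraph.pullback, mem_filter, mem_powerset, e, hs, true_and]
    refine and_iff_left ?_
    rw [← e]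
    exact image_subset_image hs

lemma ThreeGraph.rel_ne {H : ThreeGraph} {x y z : H.verts} (h : H.rel x y z) :
    x ≠ y ∧ x ≠ z ∧ y ≠ z := by
  have h3 := (H.edges_sub _ h).2
  refine ⟨?_, ?_, ?_⟩ <;> rintro rfl
  · rw [insert_eq_of_mem (mem_insert_self _ _)] at h3
    exact absurd h3 (by have := card_le_two (a := x.1) (b := z.1); omega)
  · rw [Finset.insert_comm, insert_eq_of_mem (by simp : x.1 ∈ ({x.1} : Finset ℕ)),
      ] at h3
    exact absurd h3 (by have := card_le_two (a := y.1) (b := x.1); omega)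
  · rw [pair_eq_singleton] at h3
    exact absurd h3 (by have := card_le_two (a := x.1) (b := y.1); omega)

end Pullback

section MatrixBigraph

variable {k : ℕ} {I : Type}

/-- The rows in which a column of a matrix is nonzero. -/
noncomputable def column (M : Fin k → I → Prop) (v : I) : Finset (Fin k) :=
  univ.filter fun u => M u v

/-- A natural number identifying the column `v` up to repetition. -/
noncomputable def columnCode (M : Fin k → I → Prop) (v : I) : ℕ := Encodable.encode (column M v)

lemma columnCode_eq_iff {M : Fin k → I → Prop} {v v' : I} :
    columnCode M v = columnCode M v' ↔ ∀ u, M u v ↔ M u v' := by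
  rw [columnCode, columnCode, Encodable.encode_inj, Finset.ext_iff]
  simp [column]

variable [Fintype I]

/-- The bigraph of a zero-one matrix, with repeated columns removed. -/
noncomputable def matrixBigraph (M : Fin k → I → Prop) : Bigraph where
  left := range k
  right := univ.image (columnCode M)
  edges := (univ.filter fun p : Fin k × I => M p.1 p.2).image fun p => (p.1.1, columnCode M p.2)
  edges_sub p hp := by
    obtain ⟨⟨u, v⟩, -, rfl⟩ := mem_image.mp hp
    exact mem_product.mpr ⟨mem_range.mpr u.2, mem_image_of_mem _ (mem_univ v)⟩

lemma mem_matrixBigraph_edges {M : Fin k → I → Prop} (u : Fin k) (v : I) :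
    (u.1, columnCode M v) ∈ (matrixBigraph M).edges ↔ M u v := by
  simp only [matrixBigraph, mem_image, mem_filter, mem_univ, true_and, Prod.mk.injEq, Prod.exists]
  constructor
  · rintro ⟨u', v', h, h1, h2⟩
    rw [Fin.ext h1] at h
    exact (columnCode_eq_iff.mp h2 u).mp h
  · exact fun h => ⟨u, v, h, rfl, rfl⟩

lemma irreducible_matrixBigraph {M : Fin k → I → Prop} (hM : SeparatesRows M) :
    (matrixBigraph M).Irreducible := by
  constructor
  · intro u hu u' hu' h
    obtain ⟨u, rfl⟩ : ∃ i : Fin k, i.1 = u := ⟨⟨u, mem_range.mp hu⟩, rfl⟩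
    obtain ⟨u', rfl⟩ : ∃ i : Fin k, i.1 = u' := ⟨⟨u', mem_range.mp hu'⟩, rfl⟩
    by_contra hne
    obtain ⟨v, hv⟩ := hM u u' fun e => hne (by rw [e])
    refine hv ?_
    rw [← mem_matrixBigraph_edges (M := M), ← mem_matrixBigraph_edges (M := M)]
    exact h _
  · intro v hv v' hv' h
    obtain ⟨v, -, rfl⟩ := mem_image.mp hv
    obtain ⟨v', -, rfl⟩ := mem_image.mp hv'
    rw [columnCode_eq_iff]
    intro u
    rw [← mem_matrixBigraph_edges (M := M), ← mem_matrixBigraph_edges (M := M)]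
    exact h u

lemma exists_injOn_fin {A : Finset ℕ} {m : ℕ} (hA : #A = m) :
    ∃ e : ℕ → Fin (m + 1), Set.InjOn e A := by
  refine ⟨fun x => if h : x ∈ A then (A.equivFinOfCardEq hA ⟨x, h⟩).castSucc else 0, ?_⟩
  intro x hx y hy h
  simp only [dif_pos (mem_coe.mp hx), dif_pos (mem_coe.mp hy), Fin.castSucc_inj,
    EmbeddingLike.apply_eq_iff_eq, Subtype.mk.injEq] at h
  exact h

end MatrixBigraph

section BlowupDimension

variable {k : ℕ} {I : Type} [Fintype I]

/-- The colour of a pair of indices under a colouring of a complete bipartite graph. -/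
noncomputable def indexColour (Q : ℕ → Finset (Finset ℕ)) (A B : Finset ℕ) (m : ℕ)
    (eA eB : ℕ → Fin m) (s t : Fin m) : Fin (k + 1) :=
  if h : ∃ u : Fin (k + 1), ∃ a ∈ A, ∃ b ∈ B, eA a = s ∧ eB b = t ∧ ({a, b} : Finset ℕ) ∈ Q u
  then h.choose else 0

lemma indexColour_eq {Q : ℕ → Finset (Finset ℕ)} {A B : Finset ℕ} {m : ℕ} {eA eB : ℕ → Fin m}
    (hA : Set.InjOn eA A) (hB : Set.InjOn eB B)
    (hQ : ∀ u ∈ range (k + 1), ∀ u' ∈ range (k + 1), u ≠ u' → Disjoint (Q u) (Q u'))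
    {a b : ℕ} (ha : a ∈ A) (hb : b ∈ B) {u : Fin (k + 1)} (hu : ({a, b} : Finset ℕ) ∈ Q u) :
    indexColour Q A B m eA eB (eA a) (eB b) = u := by
  have h : ∃ u : Fin (k + 1), ∃ a' ∈ A, ∃ b' ∈ B, eA a' = eA a ∧ eB b' = eB b ∧
      ({a', b'} : Finset ℕ) ∈ Q u := ⟨u, a, ha, b, hb, rfl, rfl, hu⟩
  rw [indexColour, dif_pos h]
  obtain ⟨a', ha', b', hb', h1, h2, h3⟩ := h.choose_spec
  rw [hA ha' ha h1, hB hb' hb h2] at h3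
  by_contra hne
  exact disjoint_left.mp (hQ _ (mem_range.mpr h.choose.2) _ (mem_range.mpr u.2)
    fun e => hne (Fin.ext e)) h3 hu

lemma gDimAtLeast_of_containsBlowups [Nonempty I] {H : ThreeGraph} {m : ℕ}
    {M : Fin (k + 1) → I → Prop} (h : ContainsBlowups H.rel (m + 1) M) :
    GDimAtLeast (matrixBigraph M) H m := by
  intro Γ hA hB
  obtain ⟨eA, heA⟩ := exists_injOn_fin hA
  obtain ⟨eB, heB⟩ := exists_injOn_fin hB
  obtain ⟨ψ, hψ, hE⟩ := h (indexColour Γ.P Γ.A Γ.B (m + 1) eA eB)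
  set base : ℕ := (Γ.A ∪ Γ.B).sup id + 1 with hbase
  have hlt : ∀ x ∈ Γ.A ∪ Γ.B, x < base := fun x hx =>
    Nat.lt_succ_of_le (Finset.le_sup (f := id) hx)
  have hrep : ∀ w ∈ (matrixBigraph M).right, ∃ v : I, columnCode M v = w := fun w hw => by
    obtain ⟨v, -, hv⟩ := mem_image.mp hw
    exact ⟨v, hv⟩
  obtain ⟨rep, hrep⟩ : ∃ rep : ℕ → I, ∀ w ∈ (matrixBigraph M).right, columnCode M (rep w) = w :=
    ⟨fun w => if hw : w ∈ (matrixBigraph M).right then (hrep w hw).choose else Classical.arbitrary I,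
      fun w hw => by simp only [dif_pos hw]; exact (hrep w hw).choose_spec⟩
  set code : ℕ → Fin (m + 1) ⊕ Fin (m + 1) ⊕ (I × Fin (m + 1)) := fun x =>
    if x ∈ Γ.A then Sum.inl (eA x) else if x ∈ Γ.B then Sum.inr (Sum.inl (eB x))
    else Sum.inr (Sum.inr (rep (Nat.unpair (x - base)).1,
      Fin.ofNat (m + 1) (Nat.unpair (x - base)).2)) with hcode
  set C : ℕ → Finset ℕ := fun w => (range m).image fun s => base + Nat.pair w s with hC
  have codeA : ∀ a ∈ Γ.A, code a = Sum.inl (eA a) := fun a ha => by simp [hcode, ha]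
  have codeB : ∀ b ∈ Γ.B, code b = Sum.inr (Sum.inl (eB b)) := fun b hb => by
    have : b ∉ Γ.A := disjoint_right.mp Γ.disjAB hb
    simp [hcode, hb, this]
  have hCdisj : ∀ w, ∀ x ∈ C w, base ≤ x ∧ x ∉ Γ.A ∪ Γ.B := fun w x hx => by
    obtain ⟨s, -, rfl⟩ := mem_image.mp hx
    exact ⟨Nat.le_add_right _ _, fun hx => absurd (hlt _ hx) (by omega)⟩
  have codeC : ∀ w s, code (base + Nat.pair w s) =
      Sum.inr (Sum.inr (rep w, Fin.ofNat (m + 1) s)) := fun w s => by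
    have h1 : base + Nat.pair w s ∉ Γ.A ∪ Γ.B := fun hx => absurd (hlt _ hx) (by omega)
    rw [mem_union, not_or] at h1
    simp [hcode, h1.1, h1.2]
  set S : Finset ℕ := Γ.A ∪ Γ.B ∪ (matrixBigraph M).right.biUnion C with hS
  have hcodeinj : Set.InjOn code S := by
    intro x hx y hy hxy
    simp only [hS, mem_coe, mem_union, mem_biUnion, hC, mem_image, mem_range] at hx hy
    rcases hx with (hx | hx) | ⟨w, hw, s, hs, rfl⟩ <;>
      rcases hy with (hy | hy) | ⟨w', hw', s', hs', rfl⟩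
    · rw [codeA _ hx, codeA _ hy] at hxy
      exact heA hx hy (by simpa using hxy)
    · rw [codeA _ hx, codeB _ hy] at hxy
      simp at hxy
    · rw [codeA _ hx, codeC] at hxy
      simp at hxy
    · rw [codeB _ hx, codeA _ hy] at hxy
      simp at hxy
    · rw [codeB _ hx, codeB _ hy] at hxy
      exact heB hx hy (by simpa using hxy)
    · rw [codeB _ hx, codeC] at hxy
      simp at hxy
    · rw [codeC, codeA _ hy] at hxy
      simp at hxy
    · rw [codeC, codeB _ hy] at hxy
      simp at hxy
    · rw [codeC, codeC] at hxy
      simp only [Sum.inr.injEq, Prod.mk.injEq] at hxy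
      have e1 : w = w' := by rw [← hrep w hw, ← hrep w' hw', hxy.1]
      have e2 : s = s' := by
        have := congrArg Fin.val hxy.2
        rw [Fin.val_ofNat, Fin.val_ofNat, Nat.mod_eq_of_lt (by omega),
          Nat.mod_eq_of_lt (by omega)] at this
        exact this
      rw [e1, e2]
  have hg : Set.InjOn (fun x => (ψ (code x)).1) S := fun x hx y hy hxy =>
    hcodeinj hx hy (hψ (Subtype.ext hxy))
  refine ⟨H.pullback (fun x => (ψ (code x)).1) S hg, ⟨C, ?_, ?_, ?_, rfl, ?_⟩,
    ThreeGraph.containsInduced_pullback _ _ _ _ fun x _ => Subtype.coe_prop _⟩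
  · intro w _
    rw [hC, card_image_of_injective, card_range]
    intro s s' hs
    have : Nat.pair w s = Nat.pair w s' := by simpa using hs
    exact (Nat.pair_eq_pair.mp this).2
  · intro w _ w' _ hne
    rw [disjoint_left]
    intro x hx hx'
    obtain ⟨s, -, rfl⟩ := mem_image.mp hx
    obtain ⟨s', -, h'⟩ := mem_image.mp hx'
    have : Nat.pair w' s' = Nat.pair w s := by simpa using h'
    exact hne (Nat.pair_eq_pair.mp this).1.symm
  · intro w _
    exact disjoint_left.mpr fun x hx => (hCdisj w x hx).2
  · intro u hu w hw e he z hz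
    obtain ⟨u, rfl⟩ : ∃ i : Fin (k + 1), i.1 = u := ⟨⟨u, mem_range.mp hu⟩, rfl⟩
    have hmem : e ∈ pairsAB Γ.A Γ.B := by
      rw [← Γ.P_cover]
      exact mem_biUnion.mpr ⟨u, hu, he⟩
    obtain ⟨⟨a, b⟩, hab, rfl⟩ := mem_image.mp hmem
    obtain ⟨ha, hb⟩ := mem_product.mp hab
    simp only at he ha hb ⊢
    have hzS : z ∈ S := mem_union_right _ (mem_biUnion.mpr ⟨w, hw, hz⟩)
    obtain ⟨s, -, rfl⟩ := mem_image.mp hz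
    have hsub : ({base + Nat.pair w s, a, b} : Finset ℕ) ⊆ S := by
      have haS : a ∈ S := mem_union_left _ (mem_union_left _ ha)
      have hbS : b ∈ S := mem_union_left _ (mem_union_right _ hb)
      simp [insert_subset_iff, hzS, haS, hbS]
    have key : ({base + Nat.pair w s, a, b} : Finset ℕ) ∈
        (H.pullback (fun x => (ψ (code x)).1) S hg).edges ↔ (u.1, w) ∈ (matrixBigraph M).edges := by
      rw [ThreeGraph.pullback, mem_filter, mem_powerset, and_iff_right hsub, image_insert,
        image_insert, image_singleton, codeC, codeA _ ha, codeB _ hb]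
      have h1 := hE (eA a) (eB b) (rep w, Fin.ofNat (m + 1) s)
      rw [indexColour_eq heA heB Γ.P_disj ha hb he, ← mem_matrixBigraph_edges (M := M), hrep w hw] at h1
      rw [← h1, ThreeGraph.rel]
      refine iff_of_eq (congrArg (· ∈ H.edges) ?_)
      ext x
      simp only [mem_insert, mem_singleton]
      tauto
    exact ⟨key.mpr, fun h => mt key.mp h⟩

end BlowupDimension

lemma ContainsBlowups.mono {W U I : Type} [Nonempty U] {E : W → W → W → Prop} {m m' : ℕ}
    (hm : m ≤ m') {M : U → I → Prop} (h : ContainsBlowups E m' M) : ContainsBlowups E m M := by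
  intro Γ
  obtain ⟨ψ, hψ, hE⟩ := h fun s t =>
    if hs : s.1 < m ∧ t.1 < m then Γ ⟨s, hs.1⟩ ⟨t, hs.2⟩ else Classical.arbitrary U
  refine ⟨fun p => ψ (p.map (Fin.castLE hm) (Sum.map (Fin.castLE hm)
    (Prod.map id (Fin.castLE hm)))), hψ.comp ?_, fun s t v => ?_⟩
  · have hc := Fin.castLE_injective hm
    exact hc.sumMap (hc.sumMap (Function.injective_id.prodMap hc))
  · have := hE (Fin.castLE hm s) (Fin.castLE hm t) (v.1, Fin.castLE hm v.2)
    simp only [Fin.val_castLE, Fin.is_lt, and_self, dite_true] at this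
    simpa [Prod.map] using this

/-- Blowups of a separating matrix that occur in all orders in a property witness an irreducible
bigraph in `B_ℋ`. -/
lemma exists_blowupFree {ℋ : Set ThreeGraph} {L : ℕ} (hL : 1 ≤ L)
    (hub : ∀ K : ℕ, (∃ G : Bigraph, InBH ℋ G ∧ G.left.card = K) → K ≤ L) :
    ∃ m, ∀ H ∈ ℋ, BlowupFree H.rel m (L + 1) := by
  by_contra! hcon
  have h : ∀ m, ∃ M : Fin (L + 1) → OffDiag (L + 1) → Prop, SeparatesRows M ∧
      ∃ H ∈ ℋ, ContainsBlowups H.rel m M := fun m => by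
    obtain ⟨H, hH, hm⟩ := hcon m
    simp only [BlowupFree, not_forall, not_not] at hm
    obtain ⟨M, hM, hc⟩ := hm
    exact ⟨M, hM, H, hH, hc⟩
  choose M hM H hH hc using h
  have : Nonempty (OffDiag (L + 1)) :=
    ⟨⟨(⟨0, by omega⟩, ⟨1, by omega⟩), by simp [Fin.ext_iff]⟩⟩
  obtain ⟨M₀, hM₀⟩ := Finite.exists_infinite_fiber M
  have hinf : (M ⁻¹' {M₀}).Infinite := Set.infinite_coe_iff.mp hM₀
  have hsep : SeparatesRows M₀ := by
    obtain ⟨m, hm⟩ := hinf.nonempty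
    rw [← (hm : M m = M₀)]
    exact hM m
  have := hub (L + 1) ⟨matrixBigraph M₀, ⟨irreducible_matrixBigraph hsep, fun m => ?_⟩,
    by simp [matrixBigraph]⟩
  · omega
  · obtain ⟨m', hm', hlt⟩ := hinf.exists_gt (m + 1)
    refine ⟨H m', hH m', gDimAtLeast_of_containsBlowups (ContainsBlowups.mono hlt.le ?_)⟩
    rw [← (hm' : M m' = M₀)]
    exact hc m'

section Shattering

/-- The incidence pattern on a grid used to embed a blowup in a shattered grid: the first block
carries the matrix, and the others make the vertices distinct. -/
def gridPattern {U I : Type} {m : ℕ} (M : U → I → Prop) (Γ : Fin m → Fin m → U)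
    (v : I × Fin m) : Fin m ⊕ Unit ⊕ (I × Fin m) → Fin m ⊕ Unit ⊕ (I × Fin m) → Prop
  | Sum.inl s, Sum.inl t => M (Γ s t) v.1
  | Sum.inl _, Sum.inr (Sum.inl _) => True
  | Sum.inr (Sum.inl _), Sum.inl _ => True
  | Sum.inr (Sum.inl _), Sum.inr (Sum.inr i) => i = v
  | _, _ => False

lemma GridShattered.containsBlowups {W U I : Type} [Fintype I] {E : W → W → W → Prop} {k m : ℕ}
    (hne : ∀ x y z, E x y z → x ≠ y ∧ x ≠ z ∧ y ≠ z) (h : GridShattered E k)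
    (hk : Fintype.card (Fin m ⊕ Unit ⊕ (I × Fin m)) ≤ k) (M : U → I → Prop) :
    ContainsBlowups E m M := by
  intro Γ
  obtain ⟨x, y, hxy⟩ := h
  obtain ⟨f⟩ : Nonempty (Fin m ⊕ Unit ⊕ (I × Fin m) ↪ Fin k) :=
    Function.Embedding.nonempty_of_card_le (by simpa using hk)
  have hxinj : Function.Injective x := fun i j hij => by
    obtain ⟨z, hz⟩ := hxy {(i, i)}
    have h1 := (hz i i).mpr (mem_singleton_self _)
    rw [hij, hz j i, mem_singleton] at h1
    exact (congrArg Prod.fst h1).symm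
  have hyinj : Function.Injective y := fun i j hij => by
    obtain ⟨z, hz⟩ := hxy {(i, i)}
    have h1 := (hz i i).mpr (mem_singleton_self _)
    rw [hij, hz i j, mem_singleton] at h1
    exact (congrArg Prod.snd h1).symm
  have hxney : ∀ i j, x i ≠ y j := fun i j => by
    obtain ⟨z, hz⟩ := hxy {(i, j)}
    exact (hne _ _ _ ((hz i j).mpr (mem_singleton_self _))).1
  have hz : ∀ v, ∃ z, ∀ i j, E (x (f i)) (y (f j)) z ↔ gridPattern M Γ v i j := fun v => by
    obtain ⟨z, hz⟩ := hxy ((univ.filter fun p : (Fin m ⊕ Unit ⊕ (I × Fin m)) ×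
      (Fin m ⊕ Unit ⊕ (I × Fin m)) => gridPattern M Γ v p.1 p.2).image fun p => (f p.1, f p.2))
    refine ⟨z, fun i j => (hz _ _).trans ?_⟩
    simp only [mem_image, mem_filter, mem_univ, true_and, Prod.exists, Prod.mk.injEq,
      EmbeddingLike.apply_eq_iff_eq]
    exact ⟨by rintro ⟨a, b, h, rfl, rfl⟩; exact h, fun h => ⟨i, j, h, rfl, rfl⟩⟩
  choose z hz using hz
  have hzx : ∀ v s, x (f (Sum.inl s)) ≠ z v := fun v s =>
    (hne _ _ _ ((hz v (Sum.inl s) (Sum.inr (Sum.inl ()))).mpr trivial)).2.1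
  have hzy : ∀ v t, y (f (Sum.inl t)) ≠ z v := fun v t =>
    (hne _ _ _ ((hz v (Sum.inr (Sum.inl ())) (Sum.inl t)).mpr trivial)).2.2
  have hzinj : Function.Injective z := fun v v' hvv => by
    have h1 := (hz v (Sum.inr (Sum.inl ())) (Sum.inr (Sum.inr v))).mpr rfl
    rw [hvv, hz v'] at h1
    exact h1
  refine ⟨Sum.elim (fun s => x (f (Sum.inl s))) (Sum.elim (fun t => y (f (Sum.inl t))) z),
    ?_, fun s t v => hz v (Sum.inl s) (Sum.inl t)⟩
  have hinl : Function.Injective fun s : Fin m => f (Sum.inl s) :=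
    f.injective.comp Sum.inl_injective
  refine (hxinj.comp hinl).sumElim ((hyinj.comp hinl).sumElim hzinj fun t v => hzy v t) ?_
  rintro s (t | v)
  · exact hxney _ _
  · exact hzx _ _

lemma exists_not_gridShattered (m L : ℕ) :
    ∃ k, ∀ H : ThreeGraph, BlowupFree H.rel m (L + 1) → ¬GridShattered H.rel k := by
  refine ⟨Fintype.card (Fin m ⊕ Unit ⊕ (OffDiag (L + 1) × Fin m)), fun H hH hs => ?_⟩
  refine hH (fun u v => v.1.1 = u) (fun u u' hu => ⟨⟨(u, u'), hu⟩, fun h => hu (h.mp rfl)⟩) ?_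
  exact hs.containsBlowups (fun x y z h => ThreeGraph.rel_ne h) le_rfl _

/-- If `B_ℋ` has no member with more than `L` left vertices, then `ℓ = L` suffices. -/
lemma exists_psi {ℋ : Set ThreeGraph} {L : ℕ} (hL : 1 ≤ L)
    (hub : ∀ K : ℕ, (∃ G : Bigraph, InBH ℋ G ∧ G.left.card = K) → K ≤ L) {ε₁ : ℝ} {ε₂ : ℕ → ℝ}
    (hε₁ : 0 < ε₁) (hε₂ : InZeroOne ε₂) : ∃ T : ℕ, 1 ≤ T ∧ psi ε₁ ε₂ T L ℋ := by
  obtain ⟨m, hm⟩ := exists_blowupFree hL hub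
  obtain ⟨k, hk⟩ := exists_not_gridShattered m L
  obtain ⟨T, n₀, h⟩ := exists_goodDecomp hL m k hε₁ (hε₂ L).1
  refine ⟨max T 1, le_max_right _ _, n₀, fun H hH hn => ?_⟩
  obtain ⟨t, ht, htT, hG⟩ := h H hn (hk H (hm H hH)) (hm H hH)
  exact ⟨t, L, ht, htT.trans (le_max_left _ _), hL, le_rfl, hG⟩

end Shattering

section CutNorm

variable {α β γ : Type*}

lemma sq_sum_weighted_le (s : Finset α) (a f : α → ℝ) (ha : ∀ i ∈ s, |a i| ≤ 1) :
    (∑ i ∈ s, a i * f i) ^ 2 ≤ (#s : ℝ) * ∑ i ∈ s, f i ^ 2 := by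
  refine (sum_mul_sq_le_sq_mul_sq s a f).trans ?_
  refine mul_le_mul_of_nonneg_right ?_ (sum_nonneg fun i _ => sq_nonneg _)
  calc ∑ i ∈ s, a i ^ 2 ≤ ∑ _i ∈ s, (1 : ℝ) :=
        sum_le_sum fun i hi => (sq_le_one_iff_abs_le_one _).mpr (ha i hi)
    _ = #s := by simp

lemma pow_four_sum_le (X : Finset α) (Y : Finset β) (g : α → β → ℝ) (a : α → ℝ) (b : β → ℝ)
    (ha : ∀ x ∈ X, |a x| ≤ 1) (hb : ∀ y ∈ Y, |b y| ≤ 1) :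
    (∑ x ∈ X, ∑ y ∈ Y, g x y * a x * b y) ^ 4 ≤ (#X : ℝ) ^ 2 * (#Y : ℝ) ^ 2 *
      ∑ x₀ ∈ X, ∑ x₁ ∈ X, ∑ y₀ ∈ Y, ∑ y₁ ∈ Y, g x₀ y₀ * g x₀ y₁ * g x₁ y₀ * g x₁ y₁ := by
  have h1 : (∑ x ∈ X, ∑ y ∈ Y, g x y * a x * b y) ^ 2 ≤
      (#X : ℝ) * ∑ y₀ ∈ Y, ∑ y₁ ∈ Y, (b y₀ * b y₁) * ∑ x ∈ X, g x y₀ * g x y₁ := by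
    have e : ∑ x ∈ X, ∑ y ∈ Y, g x y * a x * b y = ∑ x ∈ X, a x * ∑ y ∈ Y, g x y * b y := by
      refine sum_congr rfl fun x _ => ?_
      rw [mul_sum]
      exact sum_congr rfl fun y _ => by ring
    rw [e]
    refine (sq_sum_weighted_le X a _ ha).trans (le_of_eq ?_)
    congr 1
    simp_rw [pow_two, sum_mul_sum, mul_sum]
    rw [sum_comm]
    refine sum_congr rfl fun y _ => ?_
    rw [sum_comm]
    exact sum_congr rfl fun _ _ => sum_congr rfl fun _ _ => by ring
  have h2 : (∑ y₀ ∈ Y, ∑ y₁ ∈ Y, (b y₀ * b y₁) * ∑ x ∈ X, g x y₀ * g x y₁) ^ 2 ≤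
      (#Y : ℝ) ^ 2 *
        ∑ x₀ ∈ X, ∑ x₁ ∈ X, ∑ y₀ ∈ Y, ∑ y₁ ∈ Y, g x₀ y₀ * g x₀ y₁ * g x₁ y₀ * g x₁ y₁ := by
    have e : ∑ y₀ ∈ Y, ∑ y₁ ∈ Y, (b y₀ * b y₁) * ∑ x ∈ X, g x y₀ * g x y₁ =
        ∑ p ∈ Y ×ˢ Y, (b p.1 * b p.2) * ∑ x ∈ X, g x p.1 * g x p.2 := by
      rw [sum_product]
    rw [e]
    refine (sq_sum_weighted_le (Y ×ˢ Y) _ _ fun p hp => ?_).trans (le_of_eq ?_)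
    · rw [abs_mul]
      exact mul_le_one₀ (hb _ (mem_product.mp hp).1) (abs_nonneg _) (hb _ (mem_product.mp hp).2)
    · rw [card_product, Nat.cast_mul, ← pow_two]
      congr 1
      simp_rw [pow_two, sum_mul_sum]
      rw [sum_comm]
      refine sum_congr rfl fun x _ => ?_
      rw [sum_comm]
      refine sum_congr rfl fun x' _ => ?_
      rw [sum_product]
      exact sum_congr rfl fun _ _ => sum_congr rfl fun _ _ => by ring
  calc (∑ x ∈ X, ∑ y ∈ Y, g x y * a x * b y) ^ 4
      = ((∑ x ∈ X, ∑ y ∈ Y, g x y * a x * b y) ^ 2) ^ 2 := by ring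
    _ ≤ ((#X : ℝ) * ∑ y₀ ∈ Y, ∑ y₁ ∈ Y, (b y₀ * b y₁) * ∑ x ∈ X, g x y₀ * g x y₁) ^ 2 :=
        pow_le_pow_left₀ (sq_nonneg _) h1 2
    _ = (#X : ℝ) ^ 2 *
          (∑ y₀ ∈ Y, ∑ y₁ ∈ Y, (b y₀ * b y₁) * ∑ x ∈ X, g x y₀ * g x y₁) ^ 2 := by ring
    _ ≤ _ := by
        rw [mul_assoc]
        exact mul_le_mul_of_nonneg_left h2 (sq_nonneg _)

lemma pow_eight_sum_le (X : Finset α) (Y : Finset β) (Z : Finset γ) (h : α → β → γ → ℝ)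
    (a : α → β → ℝ) (c : γ → ℝ) (ha : ∀ x ∈ X, ∀ y ∈ Y, |a x y| ≤ 1)
    (hc : ∀ z ∈ Z, |c z| ≤ 1) :
    (∑ x ∈ X, ∑ y ∈ Y, ∑ z ∈ Z, h x y z * a x y * c z) ^ 8 ≤
      ((#X : ℝ) * (#Y : ℝ) * (#Z : ℝ)) ^ 6 *
      ∑ x₀ ∈ X, ∑ x₁ ∈ X, ∑ y₀ ∈ Y, ∑ y₁ ∈ Y, ∑ z₀ ∈ Z, ∑ z₁ ∈ Z,
        h x₀ y₀ z₀ * h x₀ y₀ z₁ * h x₀ y₁ z₀ * h x₀ y₁ z₁ *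
          h x₁ y₀ z₀ * h x₁ y₀ z₁ * h x₁ y₁ z₀ * h x₁ y₁ z₁ := by
  set K : γ × γ → ℝ := fun q => ∑ x ∈ X, ∑ y ∈ Y, h x y q.1 * h x y q.2 with hK
  have h1 : (∑ x ∈ X, ∑ y ∈ Y, ∑ z ∈ Z, h x y z * a x y * c z) ^ 2 ≤
      ((#X : ℝ) * #Y) * ∑ q ∈ Z ×ˢ Z, (c q.1 * c q.2) * K q := by
    have e : ∑ x ∈ X, ∑ y ∈ Y, ∑ z ∈ Z, h x y z * a x y * c z =
        ∑ p ∈ X ×ˢ Y, a p.1 p.2 * ∑ z ∈ Z, h p.1 p.2 z * c z := by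
      rw [sum_product]
      refine sum_congr rfl fun x _ => sum_congr rfl fun y _ => ?_
      rw [mul_sum]
      exact sum_congr rfl fun z _ => by ring
    rw [e]
    refine (sq_sum_weighted_le (X ×ˢ Y) _ _ fun p hp =>
      ha _ (mem_product.mp hp).1 _ (mem_product.mp hp).2).trans (le_of_eq ?_)
    rw [card_product, Nat.cast_mul]
    congr 1
    simp_rw [hK, ← sum_product' X Y, pow_two, sum_mul_sum, ← sum_product' Z Z, mul_sum]
    rw [sum_comm]
    exact sum_congr rfl fun _ _ => sum_congr rfl fun _ _ => by ring
  have h2 : (∑ q ∈ Z ×ˢ Z, (c q.1 * c q.2) * K q) ^ 2 ≤ (#Z : ℝ) ^ 2 * ∑ q ∈ Z ×ˢ Z, K q ^ 2 := by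
    refine (sq_sum_weighted_le (Z ×ˢ Z) _ _ fun p hp => ?_).trans (le_of_eq ?_)
    · rw [abs_mul]
      exact mul_le_one₀ (hc _ (mem_product.mp hp).1) (abs_nonneg _) (hc _ (mem_product.mp hp).2)
    · rw [card_product, Nat.cast_mul, ← pow_two]
  have h3 : (∑ q ∈ Z ×ˢ Z, K q ^ 2) ^ 2 ≤ (#Z : ℝ) ^ 2 * ∑ q ∈ Z ×ˢ Z, K q ^ 4 := by
    have := sq_sum_weighted_le (Z ×ˢ Z) (fun _ => 1) (fun q => K q ^ 2) fun _ _ => by simp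
    simp only [one_mul, card_product, Nat.cast_mul, ← pow_mul] at this
    rw [← pow_two] at this
    exact this
  have h4 : ∑ q ∈ Z ×ˢ Z, K q ^ 4 ≤ (#X : ℝ) ^ 2 * (#Y : ℝ) ^ 2 *
      ∑ x₀ ∈ X, ∑ x₁ ∈ X, ∑ y₀ ∈ Y, ∑ y₁ ∈ Y, ∑ z₀ ∈ Z, ∑ z₁ ∈ Z,
        h x₀ y₀ z₀ * h x₀ y₀ z₁ * h x₀ y₁ z₀ * h x₀ y₁ z₁ *
          h x₁ y₀ z₀ * h x₁ y₀ z₁ * h x₁ y₁ z₀ * h x₁ y₁ z₁ := by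
    have h5 : ∀ q ∈ Z ×ˢ Z, K q ^ 4 ≤ (#X : ℝ) ^ 2 * (#Y : ℝ) ^ 2 *
        ∑ x₀ ∈ X, ∑ x₁ ∈ X, ∑ y₀ ∈ Y, ∑ y₁ ∈ Y,
          (h x₀ y₀ q.1 * h x₀ y₀ q.2) * (h x₀ y₁ q.1 * h x₀ y₁ q.2) *
            (h x₁ y₀ q.1 * h x₁ y₀ q.2) * (h x₁ y₁ q.1 * h x₁ y₁ q.2) := fun q _ => by
      have := pow_four_sum_le X Y (fun x y => h x y q.1 * h x y q.2) (fun _ => 1) (fun _ => 1)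
        (fun _ _ => by simp) (fun _ _ => by simp)
      simpa only [mul_one] using this
    refine (sum_le_sum h5).trans (le_of_eq ?_)
    rw [← mul_sum]
    congr 1
    rw [sum_comm]
    refine sum_congr rfl fun x₀ _ => ?_
    rw [sum_comm]
    refine sum_congr rfl fun x₁ _ => ?_
    rw [sum_comm]
    refine sum_congr rfl fun y₀ _ => ?_
    rw [sum_comm]
    refine sum_congr rfl fun y₁ _ => ?_
    rw [sum_product]
    exact sum_congr rfl fun _ _ => sum_congr rfl fun _ _ => by ring
  have hx : (0 : ℝ) ≤ (#X : ℝ) * #Y := by positivity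
  calc (∑ x ∈ X, ∑ y ∈ Y, ∑ z ∈ Z, h x y z * a x y * c z) ^ 8
      = ((∑ x ∈ X, ∑ y ∈ Y, ∑ z ∈ Z, h x y z * a x y * c z) ^ 2) ^ 4 := by ring
    _ ≤ (((#X : ℝ) * #Y) * ∑ q ∈ Z ×ˢ Z, (c q.1 * c q.2) * K q) ^ 4 :=
        pow_le_pow_left₀ (sq_nonneg _) h1 4
    _ = ((#X : ℝ) * #Y) ^ 4 * ((∑ q ∈ Z ×ˢ Z, (c q.1 * c q.2) * K q) ^ 2) ^ 2 := by ring
    _ ≤ ((#X : ℝ) * #Y) ^ 4 * ((#Z : ℝ) ^ 2 * ∑ q ∈ Z ×ˢ Z, K q ^ 2) ^ 2 :=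
        mul_le_mul_of_nonneg_left (pow_le_pow_left₀ (sq_nonneg _) h2 2) (pow_nonneg hx 4)
    _ = ((#X : ℝ) * #Y) ^ 4 * (#Z : ℝ) ^ 4 * (∑ q ∈ Z ×ˢ Z, K q ^ 2) ^ 2 := by ring
    _ ≤ ((#X : ℝ) * #Y) ^ 4 * (#Z : ℝ) ^ 4 * ((#Z : ℝ) ^ 2 * ∑ q ∈ Z ×ˢ Z, K q ^ 4) :=
        mul_le_mul_of_nonneg_left h3 (by positivity)
    _ = ((#X : ℝ) * #Y) ^ 4 * (#Z : ℝ) ^ 6 * ∑ q ∈ Z ×ˢ Z, K q ^ 4 := by ring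
    _ ≤ ((#X : ℝ) * #Y) ^ 4 * (#Z : ℝ) ^ 6 * _ := mul_le_mul_of_nonneg_left h4 (by positivity)
    _ = _ := by ring

end CutNorm

section TriadCounting

lemma abs_le_of_even_pow_le {S T : ℝ} {n : ℕ} (hn : Even n) (h0 : n ≠ 0) (hT : 0 ≤ T)
    (h : S ^ n ≤ T ^ n) : |S| ≤ T := by
  rw [← hn.pow_abs] at h
  exact (pow_le_pow_iff_left₀ (abs_nonneg _) hT h0).mp h

lemma Bigraph.abs_sum_gfun_le {B : Bigraph} {κ : ℝ} (hκ : 0 ≤ κ)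
    (hB : B.devSum ≤ κ ^ 4 * (#B.left : ℝ) ^ 2 * (#B.right : ℝ) ^ 2) (a b : ℕ → ℝ)
    (ha : ∀ x, |a x| ≤ 1) (hb : ∀ y, |b y| ≤ 1) :
    |∑ x ∈ B.left, ∑ y ∈ B.right, B.gfun x y * a x * b y| ≤ κ * #B.left * #B.right := by
  refine abs_le_of_even_pow_le (n := 4) (by decide) (by norm_num) (by positivity) ?_
  refine (pow_four_sum_le B.left B.right B.gfun a b (fun x _ => ha x) fun y _ => hb y).trans ?_
  refine (mul_le_mul_of_nonneg_left hB (by positivity)).trans (le_of_eq ?_)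
  ring

lemma abs_ite_one_zero_le (p : Prop) [Decidable p] : |(if p then 1 else 0 : ℝ)| ≤ 1 := by
  split_ifs <;> simp

/-- The triangles of a triad whose first two vertices lie in `F` and whose third lies in `D`. -/
noncomputable def Triad.count (G : Triad) (F : Finset (ℕ × ℕ)) (D : Finset ℕ) :
    Finset (ℕ × ℕ × ℕ) :=
  G.K3.filter fun p => (p.1, p.2.1) ∈ F ∧ p.2.2 ∈ D

lemma Triad.card_count (G : Triad) {F : Finset (ℕ × ℕ)} (hF : F ⊆ G.EXY) (D : Finset ℕ) :
    (#(G.count F D) : ℝ) = ∑ x ∈ G.X, ∑ y ∈ G.Y, ∑ z ∈ G.Z,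
      (if (x, z) ∈ G.EXZ then 1 else 0) * (if (x, y) ∈ F then 1 else 0) *
        ((if (y, z) ∈ G.EYZ then 1 else 0) * (if z ∈ D then 1 else 0) : ℝ) := by
  have e : G.count F D = (G.X ×ˢ G.Y ×ˢ G.Z).filter fun p =>
      ((p.1, p.2.2) ∈ G.EXZ ∧ (p.1, p.2.1) ∈ F) ∧ (p.2.1, p.2.2) ∈ G.EYZ ∧ p.2.2 ∈ D := by
    ext ⟨x, y, z⟩
    rw [Triad.count, mem_filter, mem_filter, Triad.mem_K3, mem_product, mem_product]
    have := @hF (x, y)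
    tauto
  rw [e, card_filter, Nat.cast_sum, sum_product]
  refine sum_congr rfl fun x _ => ?_
  rw [sum_product]
  refine sum_congr rfl fun y _ => sum_congr rfl fun z _ => ?_
  simp only [ite_and, Nat.cast_ite, Nat.cast_one, Nat.cast_zero]
  split_ifs <;> simp

lemma Bigraph.ite_eq_gfun (B : Bigraph) (x y : ℕ) :
    (if (x, y) ∈ B.edges then 1 else 0 : ℝ) = B.gfun x y + B.density := by
  rw [Bigraph.gfun]
  split_ifs <;> ring

lemma Triad.abs_card_count_sub_le (G : Triad) {κ : ℝ} (hκ : 0 ≤ κ)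
    (hXZ : G.bXZ.devSum ≤ κ ^ 4 * (#G.X : ℝ) ^ 2 * (#G.Z : ℝ) ^ 2)
    (hYZ : G.bYZ.devSum ≤ κ ^ 4 * (#G.Y : ℝ) ^ 2 * (#G.Z : ℝ) ^ 2)
    (hd : |G.bXZ.density| ≤ 1) {F : Finset (ℕ × ℕ)} (hF : F ⊆ G.EXY) {D : Finset ℕ}
    (hD : D ⊆ G.Z) :
    |(#(G.count F D) : ℝ) - G.bXZ.density * G.bYZ.density * #F * #D| ≤
      2 * κ * #G.X * #G.Y * #G.Z := by
  set dX := G.bXZ.density with hdX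
  set dY := G.bYZ.density with hdY
  set f : ℕ → ℕ → ℝ := fun x y => if (x, y) ∈ F then 1 else 0 with hf
  set e : ℕ → ℕ → ℝ := fun y z => if (y, z) ∈ G.EYZ then 1 else 0 with he
  set c : ℕ → ℝ := fun z => if z ∈ D then 1 else 0 with hc
  have h1 : |∑ y ∈ G.Y, ∑ x ∈ G.X, ∑ z ∈ G.Z, G.bXZ.gfun x z * f x y * (e y z * c z)| ≤
      κ * #G.X * #G.Y * #G.Z := by
    refine (abs_sum_le_sum_abs _ _).trans ?_
    refine (sum_le_sum fun y _ => Bigraph.abs_sum_gfun_le (B := G.bXZ) hκ hXZ (fun x => f x y)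
      (fun z => e y z * c z) (fun x => abs_ite_one_zero_le _) fun z => ?_).trans (le_of_eq ?_)
    · rw [abs_mul]
      exact mul_le_one₀ (abs_ite_one_zero_le _) (abs_nonneg _) (abs_ite_one_zero_le _)
    · rw [sum_const, nsmul_eq_mul]
      simp only [Triad.bXZ]
      ring
  have h2 : |∑ x ∈ G.X, ∑ y ∈ G.Y, ∑ z ∈ G.Z, G.bYZ.gfun y z * f x y * c z| ≤
      κ * #G.X * #G.Y * #G.Z := by
    refine (abs_sum_le_sum_abs _ _).trans ?_
    refine (sum_le_sum fun x _ => Bigraph.abs_sum_gfun_le (B := G.bYZ) hκ hYZ (fun y => f x y)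
      c (fun x => abs_ite_one_zero_le _) fun z => abs_ite_one_zero_le _).trans (le_of_eq ?_)
    rw [sum_const, nsmul_eq_mul]
    simp only [Triad.bYZ]
    ring
  have hFc : ∑ x ∈ G.X, ∑ y ∈ G.Y, f x y = #F := by
    rw [← sum_product' G.X G.Y, hf]
    simp only [sum_ite, sum_const_zero, add_zero, sum_const, nsmul_eq_mul, mul_one]
    rw [filter_mem_eq_inter, inter_eq_right.mpr (hF.trans G.hXY)]
  have hDc : ∑ z ∈ G.Z, c z = #D := by
    rw [hc]
    simp only [sum_ite, sum_const_zero, add_zero, sum_const, nsmul_eq_mul, mul_one]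
    rw [filter_mem_eq_inter, inter_eq_right.mpr hD]
  have key : (#(G.count F D) : ℝ) - dX * dY * #F * #D =
      ∑ y ∈ G.Y, ∑ x ∈ G.X, ∑ z ∈ G.Z, G.bXZ.gfun x z * f x y * (e y z * c z) +
        dX * ∑ x ∈ G.X, ∑ y ∈ G.Y, ∑ z ∈ G.Z, G.bYZ.gfun y z * f x y * c z := by
    have h3 : dX * dY * #F * #D = ∑ x ∈ G.X, ∑ y ∈ G.Y, ∑ z ∈ G.Z, dX * dY * f x y * c z := by
      simp only [← mul_sum, ← sum_mul]
      rw [← hFc, ← hDc]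
    rw [G.card_count hF, h3, sum_comm (s := G.Y), mul_sum, ← sum_sub_distrib, ← sum_add_distrib]
    refine sum_congr rfl fun x _ => ?_
    rw [mul_sum, ← sum_sub_distrib, ← sum_add_distrib]
    refine sum_congr rfl fun y _ => ?_
    rw [mul_sum, ← sum_sub_distrib, ← sum_add_distrib]
    refine sum_congr rfl fun z _ => ?_
    have e1 := G.bXZ.ite_eq_gfun x z
    have e2 : e y z = G.bYZ.gfun y z + dY := G.bYZ.ite_eq_gfun y z
    rw [← hdX] at e1
    change (if (x, z) ∈ G.bXZ.edges then 1 else 0 : ℝ) * f x y * (e y z * c z) - _ = _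
    rw [e1]
    have : (G.bXZ.gfun x z + dX) * f x y * (e y z * c z) =
        G.bXZ.gfun x z * f x y * (e y z * c z) + dX * f x y * c z * e y z := by ring
    rw [this, e2]
    ring
  rw [key]
  refine (abs_add_le _ _).trans ?_
  rw [abs_mul]
  have := mul_le_mul hd h2 (abs_nonneg _) zero_le_one
  linarith

lemma Triad.abs_sum_hFun_le (G : Triad) (R : Finset (ℕ × ℕ × ℕ)) {κ : ℝ} (hκ : 0 ≤ κ)
    (hG : devSum3 R G ≤ κ ^ 8 * (#G.X : ℝ) ^ 2 * (#G.Y : ℝ) ^ 2 * (#G.Z : ℝ) ^ 2)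
    (F : Finset (ℕ × ℕ)) (D : Finset ℕ) :
    |∑ p ∈ G.count F D, hFun R G p.1 p.2.1 p.2.2| ≤ κ * #G.X * #G.Y * #G.Z := by
  refine abs_le_of_even_pow_le (n := 8) (by decide) (by norm_num) (by positivity) ?_
  have e : ∑ p ∈ G.count F D, hFun R G p.1 p.2.1 p.2.2 = ∑ x ∈ G.X, ∑ y ∈ G.Y, ∑ z ∈ G.Z,
      hFun R G x y z * (if (x, y) ∈ F then 1 else 0) * (if z ∈ D then 1 else 0) := by
    rw [Triad.count, Triad.K3, filter_filter, sum_filter, sum_product]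
    refine sum_congr rfl fun x hx => ?_
    rw [sum_product]
    refine sum_congr rfl fun y hy => sum_congr rfl fun z hz => ?_
    by_cases hK : (x, y, z) ∈ G.K3
    · have h := (Triad.mem_K3.mp hK).2
      simp only [h, and_self, true_and]
      split_ifs <;> simp_all
    · have h0 : hFun R G x y z = 0 := by rw [hFun, if_neg hK]
      simp [h0]
  rw [e]
  refine (pow_eight_sum_le G.X G.Y G.Z (hFun R G)
    (fun x y => if (x, y) ∈ F then 1 else 0) (fun z => if z ∈ D then 1 else 0)
    (fun x _ y _ => abs_ite_one_zero_le _) fun z _ => abs_ite_one_zero_le _).trans ?_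
  refine (mul_le_mul_of_nonneg_left hG (by positivity)).trans (le_of_eq ?_)
  ring

end TriadCounting

section TriadColours

lemma Bigraph.density_mem_unit (B : Bigraph) : 0 ≤ B.density ∧ B.density ≤ 1 := by
  refine ⟨by unfold Bigraph.density; positivity, div_le_one_of_le₀ ?_ (by positivity)⟩
  have := card_le_card B.edges_sub
  rw [card_product] at this
  exact_mod_cast this

lemma Bigraph.dev2.le_two {B : Bigraph} {ε d : ℝ} (h : B.dev2 ε d) (hε : ε ≤ 1) : d ≤ 2 := by
  have := (abs_le.mp h.1).1
  have := B.density_mem_unit.2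
  linarith

/-- In a regular triad whose first bigraph contains a set `F` all of whose triangles over `D` are
edges, and a set `F'` none of whose triangles over `D` are edges, there are few triangles. -/
lemma Triad.card_count_le_of_dev23 {G : Triad} {R : Finset (ℕ × ℕ × ℕ)} {ε₁ ε₂ κ c : ℝ}
    (hG : dev23 R G ε₁ ε₂) (hκ : 0 ≤ κ) (hκ1 : κ ≤ 1) (hε₁ : 0 ≤ ε₁)
    (h₁ : 2 ^ 12 * ε₁ ≤ κ ^ 8) (h₂ : ε₂ ≤ κ ^ 4)
    {F F' : Finset (ℕ × ℕ)} (hF : F ⊆ G.EXY) (hF' : F' ⊆ G.EXY) {D : Finset ℕ} (hD : D ⊆ G.Z)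
    (hin : ∀ p ∈ G.count F D, p ∈ R) (hout : ∀ p ∈ G.count F' D, p ∉ R)
    (hc : 1 ≤ c) (hFF : (#F : ℝ) ≤ c * #F') :
    (#(G.count F D) : ℝ) ≤ (4 * c + 2) * κ * #G.X * #G.Y * #G.Z := by
  obtain ⟨dXY, dYZ, dXZ, h1, h2, h3, hXY, hXZ, hYZ, hdev⟩ := hG
  have hε₂1 : ε₂ ≤ 1 := h₂.trans (pow_le_one₀ hκ hκ1)
  set V : ℝ := (#G.X : ℝ) * #G.Y * #G.Z with hV
  have hV0 : 0 ≤ V := by positivity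
  have hdens : devSum3 R G ≤ κ ^ 8 * (#G.X : ℝ) ^ 2 * (#G.Y : ℝ) ^ 2 * (#G.Z : ℝ) ^ 2 := by
    refine hdev.trans ?_
    have e1 := pow_le_pow_left₀ h1.le (hXY.le_two hε₂1) 4
    have e2 := pow_le_pow_left₀ h2.le (hYZ.le_two hε₂1) 4
    have e3 := pow_le_pow_left₀ h3.le (hXZ.le_two hε₂1) 4
    have e4 : ε₁ * dXY ^ 4 * dYZ ^ 4 * dXZ ^ 4 ≤ κ ^ 8 := by
      calc ε₁ * dXY ^ 4 * dYZ ^ 4 * dXZ ^ 4 ≤ ε₁ * 2 ^ 4 * 2 ^ 4 * 2 ^ 4 := by gcongr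
        _ = 2 ^ 12 * ε₁ := by ring
        _ ≤ κ ^ 8 := h₁
    gcongr
  have hX' : G.bXZ.devSum ≤ κ ^ 4 * (#G.X : ℝ) ^ 2 * (#G.Z : ℝ) ^ 2 :=
    hXZ.2.trans (by simp only [Triad.bXZ]; gcongr)
  have hY' : G.bYZ.devSum ≤ κ ^ 4 * (#G.Y : ℝ) ^ 2 * (#G.Z : ℝ) ^ 2 :=
    hYZ.2.trans (by simp only [Triad.bYZ]; gcongr)
  have hX01 := G.bXZ.density_mem_unit
  have hY01 := G.bYZ.density_mem_unit
  have habs : |G.bXZ.density| ≤ 1 := abs_le.mpr ⟨by linarith, hX01.2⟩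
  have hcF := abs_le.mp (G.abs_card_count_sub_le hκ hX' hY' habs hF hD)
  have hcF' := abs_le.mp (G.abs_card_count_sub_le hκ hX' hY' habs hF' hD)
  have hsF := G.abs_sum_hFun_le R hκ hdens F D
  have hsF' := G.abs_sum_hFun_le R hκ hdens F' D
  have hd0 := relDensity_nonneg R G
  have hd1 := relDensity_le_one R G
  have eF : ∑ p ∈ G.count F D, hFun R G p.1 p.2.1 p.2.2 =
      #(G.count F D) * (1 - relDensity R G) := by
    rw [← nsmul_eq_mul, ← sum_const]
    refine sum_congr rfl fun p hp => ?_
    rw [hFun, if_pos (mem_filter.mp hp).1, if_pos (hin p hp)]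
  have eF' : ∑ p ∈ G.count F' D, hFun R G p.1 p.2.1 p.2.2 =
      -(#(G.count F' D) * relDensity R G) := by
    rw [← mul_neg, ← nsmul_eq_mul, ← sum_const]
    refine sum_congr rfl fun p hp => ?_
    rw [hFun, if_pos (mem_filter.mp hp).1, if_neg (hout p hp)]
  rw [eF] at hsF
  rw [eF', abs_neg] at hsF'
  have hsF := le_of_abs_le hsF
  have hsF' := le_of_abs_le hsF'
  have hVκ : κ * #G.X * #G.Y * #G.Z = κ * V := by rw [hV]; ring
  have hVκ2 : 2 * κ * #G.X * #G.Y * #G.Z = 2 * (κ * V) := by rw [hV]; ring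
  have hgoal : (4 * c + 2) * κ * #G.X * #G.Y * #G.Z = (4 * c + 2) * (κ * V) := by rw [hV]; ring
  rw [hVκ] at hsF hsF'
  rw [hVκ2] at hcF hcF'
  rw [hgoal]
  have hκV : 0 ≤ κ * V := mul_nonneg hκ hV0
  have hn : (0 : ℝ) ≤ #(G.count F D) := Nat.cast_nonneg _
  have hn' : (0 : ℝ) ≤ #(G.count F' D) := Nat.cast_nonneg _
  rcases le_total (relDensity R G) (1 / 2) with h | h
  · have : (#(G.count F D) : ℝ) * (1 / 2) ≤ κ * V :=
      (mul_le_mul_of_nonneg_left (by linarith) hn).trans hsF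
    nlinarith
  · have h5 : (#(G.count F' D) : ℝ) * (1 / 2) ≤ κ * V :=
      (mul_le_mul_of_nonneg_left h hn').trans hsF'
    have h6 : G.bXZ.density * G.bYZ.density * #F' * #D ≤ 4 * (κ * V) := by linarith [hcF'.1]
    have h7 : G.bXZ.density * G.bYZ.density * #F * #D ≤
        c * (G.bXZ.density * G.bYZ.density * #F' * #D) := by
      calc G.bXZ.density * G.bYZ.density * #F * #D
          ≤ G.bXZ.density * G.bYZ.density * (c * #F') * #D := by
            have := mul_nonneg hX01.1 hY01.1
            gcongr
        _ = _ := by ring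
    have h8 := mul_le_mul_of_nonneg_left h6 (by linarith : (0 : ℝ) ≤ c)
    linarith [hcF.2]

end TriadColours

section IrregularTriples

variable {V : Finset ℕ} {t ℓ : ℕ}

/-- A triple is covered by a regular triad of the decomposition. -/
def Decomp.RegTriple (P : Decomp V (Fin t) (Fin ℓ)) (R : Finset (ℕ × ℕ × ℕ)) (ε₁ ε₂ : ℝ)
    (p : ℕ × ℕ × ℕ) : Prop :=
  ∃ i j k α β γ, p ∈ (P.triadOf i j k α β γ).K3 ∧ dev23 R (P.triadOf i j k α β γ) ε₁ ε₂

lemma Decomp.eq_of_mem_part (P : Decomp V (Fin t) (Fin ℓ)) {i j : Fin t} {x : ℕ}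
    (hi : x ∈ P.part i) (hj : x ∈ P.part j) : i = j := by
  by_contra h
  exact disjoint_left.mp (P.part_disj i j h) hi hj

lemma Decomp.eq_of_mem_pairs (P : Decomp V (Fin t) (Fin ℓ)) {i j : Fin t} {α β : Fin ℓ}
    {p : ℕ × ℕ} (hα : p ∈ P.pairs i j α) (hβ : p ∈ P.pairs i j β) : α = β := by
  by_contra h
  exact disjoint_left.mp (P.pairs_disj i j α β h) hα hβ

lemma Decomp.sum_card_inter_part (P : Decomp V (Fin t) (Fin ℓ)) {A : Finset ℕ} (hA : A ⊆ V) :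
    ∑ i, #(A ∩ P.part i) = #A := by
  rw [← card_biUnion]
  · congr 1
    ext x
    simp only [mem_biUnion, mem_univ, true_and, mem_inter]
    exact ⟨fun ⟨_, h, _⟩ => h, fun h => (P.part_cover x (hA h)).imp fun i hi => ⟨h, hi⟩⟩
  · intro i _ j _ hij
    exact (P.part_disj i j hij).mono inter_subset_right inter_subset_right

lemma Decomp.sum_card_part (P : Decomp V (Fin t) (Fin ℓ)) : ∑ i, #(P.part i) = #V := by
  rw [← P.sum_card_inter_part (Subset.refl V)]
  exact sum_congr rfl fun i _ => by rw [inter_eq_right.mpr (P.part_sub i)]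

lemma Decomp.card_regTriple_le (P : Decomp V (Fin t) (Fin ℓ)) (R : Finset (ℕ × ℕ × ℕ))
    {ε₁ ε₂ μ : ℝ} (hμ : 0 ≤ μ) (j k : Fin t) (α : Fin ℓ) {F : Finset (ℕ × ℕ)}
    (hF : F ⊆ P.pairs j k α) {D : Finset ℕ}
    (h : ∀ i β γ, dev23 R (P.triadOf j k i α β γ) ε₁ ε₂ →
      (#((P.triadOf j k i α β γ).count F (D ∩ P.part i)) : ℝ) ≤
        μ * #(P.part j) * #(P.part k) * #(P.part i)) :
    (#(((F ×ˢ D).image fun q => (q.1.1, q.1.2, q.2)).filter (P.RegTriple R ε₁ ε₂)) : ℝ) ≤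
      ℓ ^ 2 * μ * #(P.part j) * #(P.part k) * #V := by
  have hsub : ((F ×ˢ D).image fun q => (q.1.1, q.1.2, q.2)).filter (P.RegTriple R ε₁ ε₂) ⊆
      (univ : Finset (Fin t × Fin ℓ × Fin ℓ)).biUnion fun q =>
        if dev23 R (P.triadOf j k q.1 α q.2.1 q.2.2) ε₁ ε₂ then
          (P.triadOf j k q.1 α q.2.1 q.2.2).count F (D ∩ P.part q.1) else ∅ := by
    intro p hp
    obtain ⟨hp, hreg⟩ := mem_filter.mp hp
    obtain ⟨⟨⟨x, y⟩, z⟩, hq, rfl⟩ := mem_image.mp hp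
    obtain ⟨hxy, hz⟩ := mem_product.mp hq
    obtain ⟨j', k', i, α', β, γ, hK, hdev⟩ := hreg
    have hK' := Triad.mem_K3.mp hK
    simp only [Decomp.triadOf] at hK'
    obtain ⟨⟨hx', hy', hz'⟩, hxy', hyz', hxz'⟩ := hK'
    have hpair := hF hxy
    obtain ⟨hxj, hyk⟩ := mem_product.mp (P.pairs_sub j k α hpair)
    obtain rfl := P.eq_of_mem_part hxj hx'
    obtain rfl := P.eq_of_mem_part hyk hy'
    obtain rfl := P.eq_of_mem_pairs hpair hxy'
    refine mem_biUnion.mpr ⟨(i, β, γ), mem_univ _, ?_⟩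
    simp only
    rw [if_pos hdev, Triad.count, mem_filter]
    exact ⟨hK, hxy, mem_inter.mpr ⟨hz, hz'⟩⟩
  have h1 : ∀ q : Fin t × Fin ℓ × Fin ℓ,
      (#(if dev23 R (P.triadOf j k q.1 α q.2.1 q.2.2) ε₁ ε₂ then
          (P.triadOf j k q.1 α q.2.1 q.2.2).count F (D ∩ P.part q.1) else ∅) : ℝ) ≤
        μ * #(P.part j) * #(P.part k) * #(P.part q.1) := fun q => by
    split_ifs with hd
    · exact h _ _ _ hd
    · rw [card_empty, Nat.cast_zero]
      positivity
  calc _ ≤ ∑ q : Fin t × Fin ℓ × Fin ℓ, μ * #(P.part j) * #(P.part k) * #(P.part q.1) := by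
        refine (Nat.cast_le.mpr ((card_le_card hsub).trans card_biUnion_le)).trans ?_
        rw [Nat.cast_sum]
        exact sum_le_sum fun q _ => h1 q
    _ = _ := by
        rw [Fintype.sum_prod_type]
        simp only [sum_const, card_univ, Fintype.card_prod, Fintype.card_fin, nsmul_eq_mul]
        rw [← mul_sum, ← mul_sum, ← Nat.cast_sum, P.sum_card_part]
        push_cast
        ring

variable {U I : Type} [Fintype U]

/-- A pair of cells in which every colour is frequent spans many irregular triples, when there are
fewer labels than colours. -/
lemma Decomp.card_not_regTriple_pair_ge (P : Decomp V (Fin t) (Fin ℓ)) (hℓ : ℓ < Fintype.card U)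
    {R : Finset (ℕ × ℕ × ℕ)} {ε₁ ε₂ κ : ℝ} (hκ : 0 ≤ κ) (hκ1 : κ ≤ 1) (hε₁ : 0 ≤ ε₁)
    (h₁ : 2 ^ 12 * ε₁ ≤ κ ^ 8) (h₂ : ε₂ ≤ κ ^ 4) {n : ℕ} {C : I → Finset ℕ}
    (hCV : ∀ v, C v ⊆ V) (hC : ∀ v, #(C v) = n) {M : U → I → Prop} (hM : SeparatesRows M)
    {col : ℕ → ℕ → U} (j k : Fin t) {X Y : Finset ℕ} (hX : X ⊆ P.part j) (hY : Y ⊆ P.part k)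
    (hR : ∀ x ∈ X, ∀ y ∈ Y, ∀ v, ∀ z ∈ C v, (x, y, z) ∈ R ↔ M (col x y) v)
    (hcol : ∀ u, (#X : ℝ) * #Y ≤
      2 * Fintype.card U * #((X ×ˢ Y).filter fun p => col p.1 p.2 = u)) :
    (#X : ℝ) * #Y * n ≤ 2 * (Fintype.card U : ℝ) ^ 2 *
      (#((V ×ˢ V ×ˢ V).filter fun p => (p.1 ∈ X ∧ p.2.1 ∈ Y) ∧ ¬P.RegTriple R ε₁ ε₂ p) +
        10 * (Fintype.card U : ℝ) ^ 4 * κ * #(P.part j) * #(P.part k) * #V) := by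
  set L : ℝ := (Fintype.card U : ℝ) with hLdef
  have hL1 : (1 : ℝ) ≤ L := by
    rw [hLdef]
    exact_mod_cast (by omega : 1 ≤ Fintype.card U)
  set S : U → Finset (ℕ × ℕ) := fun u => (X ×ˢ Y).filter fun p => col p.1 p.2 = u with hS
  rcases (Nat.cast_nonneg (#X * #Y) : (0 : ℝ) ≤ _).eq_or_lt with h0 | hpos
  · rw [Nat.cast_mul] at h0
    rw [← h0, zero_mul]
    positivity
  rw [Nat.cast_mul] at hpos
  have hpig : ∀ u, ∃ α, (#X : ℝ) * #Y ≤ 2 * L ^ 2 * #(S u ∩ P.pairs j k α) := fun u => by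
    by_contra! hcon
    have hcard : #(S u) ≤ ∑ α, #(S u ∩ P.pairs j k α) := by
      refine (card_le_card fun p hp => ?_).trans card_biUnion_le
      have hp' := mem_product.mp (mem_filter.mp hp).1
      obtain ⟨α, hα⟩ := P.pairs_cover j k p (mem_product.mpr ⟨hX hp'.1, hY hp'.2⟩)
      exact mem_biUnion.mpr ⟨α, mem_univ _, mem_inter.mpr ⟨hp, hα⟩⟩
    have h2 : L * ((#X : ℝ) * #Y) ≤ ℓ * ((#X : ℝ) * #Y) := by
      calc L * ((#X : ℝ) * #Y) ≤ L * (2 * L * #(S u)) :=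
            mul_le_mul_of_nonneg_left (hcol u) (by linarith)
        _ ≤ L * (2 * L * ∑ α, (#(S u ∩ P.pairs j k α) : ℝ)) := by
            have : (#(S u) : ℝ) ≤ ∑ α, (#(S u ∩ P.pairs j k α) : ℝ) := by exact_mod_cast hcard
            gcongr
        _ = ∑ α, 2 * L ^ 2 * (#(S u ∩ P.pairs j k α) : ℝ) := by
            rw [← mul_sum]
            ring
        _ ≤ ∑ _α : Fin ℓ, (#X : ℝ) * #Y := sum_le_sum fun α _ => (hcon α).le
        _ = ℓ * ((#X : ℝ) * #Y) := by simp
    have h3 : (ℓ : ℝ) < L := Nat.cast_lt.mpr hℓ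
    nlinarith
  choose f hf using hpig
  obtain ⟨u, u', hne, hfu⟩ := Fintype.exists_ne_map_eq_of_card_lt f (by simpa using hℓ)
  have hLℓ : (ℓ : ℝ) ≤ L := Nat.cast_le.mpr hℓ.le
  have main : ∀ u u' : U, ∀ v, f u = f u' → M u v → ¬M u' v → (#X : ℝ) * #Y * n ≤ 2 * L ^ 2 *
      (#((V ×ˢ V ×ˢ V).filter fun p => (p.1 ∈ X ∧ p.2.1 ∈ Y) ∧ ¬P.RegTriple R ε₁ ε₂ p) +
        10 * L ^ 4 * κ * #(P.part j) * #(P.part k) * #V) := by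
    intro u u' v hfu hu hu'
    have hFu := hf u
    have hFu' := hf u'
    rw [← hfu] at hFu'
    set F := S u ∩ P.pairs j k (f u) with hFdef
    set F' := S u' ∩ P.pairs j k (f u) with hFdef'
    set Ω : Finset (ℕ × ℕ × ℕ) := (F ×ˢ C v).image fun q => (q.1.1, q.1.2, q.2) with hΩ
    have hΩcard : #Ω = #F * n := by
      rw [hΩ, card_image_of_injective, card_product, hC]
      rintro ⟨⟨a, b⟩, c⟩ ⟨⟨a', b'⟩, c'⟩ h
      simp only [Prod.mk.injEq] at h
      simp [h]
    have hFS : ∀ w, ∀ x y, (x, y) ∈ S w ∩ P.pairs j k (f u) → x ∈ X ∧ y ∈ Y ∧ col x y = w :=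
      fun w x y h => by
        obtain ⟨h1, h2⟩ := mem_filter.mp (mem_inter.mp h).1
        exact ⟨(mem_product.mp h1).1, (mem_product.mp h1).2, h2⟩
    have hFF : (#F : ℝ) ≤ 2 * L ^ 2 * #F' := by
      refine le_trans ?_ hFu'
      have := card_le_card ((inter_subset_left (s₁ := S u) (s₂ := P.pairs j k (f u))).trans
        (filter_subset _ _))
      rw [card_product] at this
      exact_mod_cast this
    have hreg : (#(Ω.filter (P.RegTriple R ε₁ ε₂)) : ℝ) ≤
        ℓ ^ 2 * (10 * L ^ 2 * κ) * #(P.part j) * #(P.part k) * #V := by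
      refine P.card_regTriple_le R (by positivity) j k (f u) inter_subset_right
        fun i β γ hdev => ?_
      refine (Triad.card_count_le_of_dev23 (F' := F') (c := 2 * L ^ 2) hdev hκ hκ1 hε₁ h₁ h₂
        inter_subset_right inter_subset_right inter_subset_right ?_ ?_ (by nlinarith) hFF).trans ?_
      · rintro ⟨x, y, z⟩ hp
        obtain ⟨-, hxy, hz⟩ := mem_filter.mp hp
        obtain ⟨hx, hy, hc⟩ := hFS u x y hxy
        rw [hR x hx y hy v z (mem_inter.mp hz).1, hc]
        exact hu
      · rintro ⟨x, y, z⟩ hp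
        obtain ⟨-, hxy, hz⟩ := mem_filter.mp hp
        obtain ⟨hx, hy, hc⟩ := hFS u' x y hxy
        rw [hR x hx y hy v z (mem_inter.mp hz).1, hc]
        exact hu'
      · have : (4 * (2 * L ^ 2) + 2) * κ ≤ 10 * L ^ 2 * κ :=
          mul_le_mul_of_nonneg_right (by nlinarith) hκ
        simp only [Decomp.triadOf]
        gcongr
    have hbad : #(Ω.filter fun p => ¬P.RegTriple R ε₁ ε₂ p) ≤
        #((V ×ˢ V ×ˢ V).filter fun p => (p.1 ∈ X ∧ p.2.1 ∈ Y) ∧ ¬P.RegTriple R ε₁ ε₂ p) := by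
      refine card_le_card fun p hp => ?_
      obtain ⟨hp, hn⟩ := mem_filter.mp hp
      obtain ⟨⟨⟨x, y⟩, z⟩, hq, rfl⟩ := mem_image.mp hp
      obtain ⟨hxy, hz⟩ := mem_product.mp hq
      obtain ⟨hx, hy, -⟩ := hFS u x y hxy
      rw [mem_filter, mem_product, mem_product]
      exact ⟨⟨P.part_sub _ (hX hx), P.part_sub _ (hY hy), hCV v hz⟩, ⟨hx, hy⟩, hn⟩
    have hsplit : (#F : ℝ) * n = #(Ω.filter (P.RegTriple R ε₁ ε₂)) +
        #(Ω.filter fun p => ¬P.RegTriple R ε₁ ε₂ p) := by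
      rw [← Nat.cast_add, card_filter_add_card_filter_not, hΩcard, Nat.cast_mul]
    have hL4 : (ℓ : ℝ) ^ 2 * (10 * L ^ 2 * κ) * #(P.part j) * #(P.part k) * #V ≤
        10 * L ^ 4 * κ * #(P.part j) * #(P.part k) * #V := by
      have : (ℓ : ℝ) ^ 2 * (10 * L ^ 2 * κ) ≤ 10 * L ^ 4 * κ := by
        calc (ℓ : ℝ) ^ 2 * (10 * L ^ 2 * κ) ≤ L ^ 2 * (10 * L ^ 2 * κ) := by gcongr
          _ = _ := by ring
      gcongr
    calc (#X : ℝ) * #Y * n ≤ 2 * L ^ 2 * #F * n :=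
          mul_le_mul_of_nonneg_right hFu (Nat.cast_nonneg _)
      _ = 2 * L ^ 2 * (#F * n) := by ring
      _ ≤ _ := by
          refine mul_le_mul_of_nonneg_left ?_ (by positivity)
          rw [hsplit]
          have : (#(Ω.filter fun p => ¬P.RegTriple R ε₁ ε₂ p) : ℝ) ≤ _ := Nat.cast_le.mpr hbad
          linarith
  obtain ⟨v, hv⟩ := hM u u' hne
  by_cases hu : M u v
  · exact main u u' v hfu hu fun h => hv ⟨fun _ => h, fun _ => hu⟩
  · refine main u' u v hfu.symm ?_ hu
    by_contra h
    exact hv ⟨fun h' => absurd h' hu, fun h' => absurd h' h⟩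

end IrregularTriples

section NotRegular

variable {V : Finset ℕ} {t ℓ : ℕ} {U I : Type} [Fintype U]

lemma Decomp.sum_card_pair_filter_le (P : Decomp V (Fin t) (Fin ℓ)) (A B : Finset ℕ)
    (Q : ℕ × ℕ × ℕ → Prop) :
    ∑ j, ∑ k, #((V ×ˢ V ×ˢ V).filter fun p =>
      (p.1 ∈ A ∩ P.part j ∧ p.2.1 ∈ B ∩ P.part k) ∧ Q p) ≤ #((V ×ˢ V ×ˢ V).filter Q) := by
  rw [← sum_product', ← card_biUnion]
  · refine card_le_card fun p hp => ?_
    obtain ⟨q, -, hp⟩ := mem_biUnion.mp hp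
    rw [mem_filter] at hp ⊢
    exact ⟨hp.1, hp.2.2⟩
  · intro q _ q' _ hne
    rw [Function.onFun, disjoint_left]
    intro p hp hp'
    obtain ⟨h1, h2⟩ := (mem_filter.mp hp).2.1
    obtain ⟨h1', h2'⟩ := (mem_filter.mp hp').2.1
    exact hne (Prod.ext (P.eq_of_mem_part (mem_inter.mp h1).2 (mem_inter.mp h1').2)
      (P.eq_of_mem_part (mem_inter.mp h2).2 (mem_inter.mp h2').2))

/-- A decomposition with fewer labels than colours of a quasirandom blowup is not regular. -/
lemma Decomp.not_regWrt (P : Decomp V (Fin t) (Fin ℓ)) (hℓ : ℓ < Fintype.card U)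
    {R : Finset (ℕ × ℕ × ℕ)} {ε₁ ε₂ κ : ℝ} (hκ : 0 ≤ κ) (hκ1 : κ ≤ 1) (hε₁ : 0 ≤ ε₁)
    (h₁ : 2 ^ 12 * ε₁ ≤ κ ^ 8) (h₂ : ε₂ ≤ κ ^ 4) {n : ℕ} (hn : 1 ≤ n) {A B : Finset ℕ}
    (hAV : A ⊆ V) (hBV : B ⊆ V) (hA : #A = n) (hB : #B = n) {C : I → Finset ℕ}
    (hCV : ∀ v, C v ⊆ V) (hC : ∀ v, #(C v) = n) {M : U → I → Prop} (hM : SeparatesRows M)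
    {col : ℕ → ℕ → U}
    (hR : ∀ x ∈ A, ∀ y ∈ B, ∀ v, ∀ z ∈ C v, (x, y, z) ∈ R ↔ M (col x y) v)
    {η ρ : ℝ} (hη : 4 * (Fintype.card U : ℝ) * t ^ 2 * η ≤ 1) (hη0 : 0 ≤ η)
    (hcol : ∀ u, ∀ X ⊆ A, ∀ Y ⊆ B, (#X : ℝ) * #Y ≤ Fintype.card U *
      (#((X ×ˢ Y).filter fun p => col p.1 p.2 = u) + η * n ^ 2))
    (hρ : (#V : ℝ) ≤ ρ * n)
    (hsmall : 4 * (Fintype.card U : ℝ) ^ 2 * ρ ^ 3 *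
      (10 * (Fintype.card U : ℝ) ^ 4 * κ + ε₁) < 1) : ¬P.regWrt R ε₁ ε₂ := by
  intro hreg
  set L : ℝ := (Fintype.card U : ℝ) with hLdef
  have hL0 : 0 ≤ L := Nat.cast_nonneg _
  set bad : Fin t → Fin t → ℝ := fun j k => (#((V ×ˢ V ×ˢ V).filter fun p =>
    (p.1 ∈ A ∩ P.part j ∧ p.2.1 ∈ B ∩ P.part k) ∧ ¬P.RegTriple R ε₁ ε₂ p) : ℝ) with hbad
  have hpair : ∀ j k, ((#(A ∩ P.part j) : ℝ) * #(B ∩ P.part k) - 2 * L * η * n ^ 2) * n ≤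
      2 * L ^ 2 * (bad j k + 10 * L ^ 4 * κ * #(P.part j) * #(P.part k) * #V) := fun j k => by
    have hrhs : 0 ≤ 2 * L ^ 2 * (bad j k + 10 * L ^ 4 * κ * #(P.part j) * #(P.part k) * #V) := by
      have : 0 ≤ bad j k := Nat.cast_nonneg _
      positivity
    rcases le_total ((#(A ∩ P.part j) : ℝ) * #(B ∩ P.part k)) (2 * L * η * n ^ 2) with h | h
    · exact (mul_nonpos_of_nonpos_of_nonneg (by linarith) (Nat.cast_nonneg _)).trans hrhs
    · refine le_trans (mul_le_mul_of_nonneg_right ?_ (Nat.cast_nonneg _))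
        (P.card_not_regTriple_pair_ge hℓ hκ hκ1 hε₁ h₁ h₂ hCV hC hM j k inter_subset_right
          inter_subset_right (fun x hx y hy => hR x (mem_inter.mp hx).1 y (mem_inter.mp hy).1)
          fun u => ?_)
      · have : 0 ≤ 2 * L * η * n ^ 2 := by positivity
        linarith
      · have := hcol u _ (inter_subset_left (s₁ := A) (s₂ := P.part j)) _
          (inter_subset_left (s₁ := B) (s₂ := P.part k))
        linarith
  have hbadsum : ∑ j, ∑ k, bad j k ≤ ε₁ * (#V : ℝ) ^ 3 := by
    have h1 : (∑ j, ∑ k, bad j k) ≤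
        (#((V ×ˢ V ×ˢ V).filter fun p => ¬P.RegTriple R ε₁ ε₂ p) : ℝ) := by
      have := P.sum_card_pair_filter_le A B fun p => ¬P.RegTriple R ε₁ ε₂ p
      simp only [hbad, ← Nat.cast_sum]
      exact Nat.cast_le.mpr (by convert this)
    have h2 : (#((V ×ˢ V ×ˢ V).filter (P.RegTriple R ε₁ ε₂)) : ℝ) +
        #((V ×ˢ V ×ˢ V).filter fun p => ¬P.RegTriple R ε₁ ε₂ p) = (#V : ℝ) ^ 3 := by
      rw [← Nat.cast_add, card_filter_add_card_filter_not, card_product, card_product]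
      push_cast
      ring
    have h3 : (1 - ε₁) * (#V : ℝ) ^ 3 ≤ (#((V ×ˢ V ×ˢ V).filter (P.RegTriple R ε₁ ε₂)) : ℝ) :=
      hreg
    linarith
  have hsum := sum_le_sum fun j (_ : j ∈ univ) => sum_le_sum fun k (_ : k ∈ univ) => hpair j k
  have hleft : ∑ j, ∑ k, ((#(A ∩ P.part j) : ℝ) * #(B ∩ P.part k) - 2 * L * η * n ^ 2) * n =
      ((n : ℝ) ^ 2 - t ^ 2 * (2 * L * η * n ^ 2)) * n := by
    have h1 : ∑ j, (#(A ∩ P.part j) : ℝ) = n := by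
      rw [← hA, ← P.sum_card_inter_part hAV, Nat.cast_sum]
    have h2 : ∑ k, (#(B ∩ P.part k) : ℝ) = n := by
      rw [← hB, ← P.sum_card_inter_part hBV, Nat.cast_sum]
    simp only [← sum_mul, sum_sub_distrib, ← mul_sum, h1, h2, sum_const, card_univ,
      Fintype.card_fin, nsmul_eq_mul]
    ring
  have hright : ∑ j, ∑ k,
      2 * L ^ 2 * (bad j k + 10 * L ^ 4 * κ * #(P.part j) * #(P.part k) * #V) =
      2 * L ^ 2 * (∑ j, ∑ k, bad j k + 10 * L ^ 4 * κ * (#V : ℝ) ^ 3) := by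
    have h1 : ∑ j, (#(P.part j) : ℝ) = #V := by
      rw [← P.sum_card_part, Nat.cast_sum]
    simp only [← mul_sum, sum_add_distrib, ← sum_mul, h1]
    ring
  rw [hleft, hright] at hsum
  have hn' : (0 : ℝ) < (n : ℝ) ^ 3 := by
    have : (0 : ℝ) < n := Nat.cast_pos.mpr hn
    positivity
  have h5 : (n : ℝ) ^ 3 / 2 ≤ ((n : ℝ) ^ 2 - t ^ 2 * (2 * L * η * n ^ 2)) * n := by
    have : ((n : ℝ) ^ 2 - t ^ 2 * (2 * L * η * n ^ 2)) * n - (n : ℝ) ^ 3 / 2 =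
      (n : ℝ) ^ 3 / 2 * (1 - 4 * L * t ^ 2 * η) := by ring
    have h6 : 0 ≤ (n : ℝ) ^ 3 / 2 * (1 - 4 * L * t ^ 2 * η) :=
      mul_nonneg (by positivity) (by linarith)
    linarith
  have h7 : 2 * L ^ 2 * (∑ j, ∑ k, bad j k + 10 * L ^ 4 * κ * (#V : ℝ) ^ 3) ≤
      2 * L ^ 2 * ((10 * L ^ 4 * κ + ε₁) * (ρ * n) ^ 3) := by
    refine mul_le_mul_of_nonneg_left ?_ (by positivity)
    calc ∑ j, ∑ k, bad j k + 10 * L ^ 4 * κ * (#V : ℝ) ^ 3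
        ≤ (10 * L ^ 4 * κ + ε₁) * (#V : ℝ) ^ 3 := by linarith
      _ ≤ _ := by gcongr
  have h8 : (n : ℝ) ^ 3 ≤ (4 * L ^ 2 * ρ ^ 3 * (10 * L ^ 4 * κ + ε₁)) * (n : ℝ) ^ 3 := by
    have : 2 * L ^ 2 * ((10 * L ^ 4 * κ + ε₁) * (ρ * n) ^ 3) =
      (4 * L ^ 2 * ρ ^ 3 * (10 * L ^ 4 * κ + ε₁)) * (n : ℝ) ^ 3 / 2 := by ring
    linarith
  nlinarith

end NotRegular

section Colouring

lemma sum_indicator_sub_eq_zero {L : ℕ} (hL : 1 ≤ L) (u : Fin L) :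
    ∑ b : Fin L, ((if b = u then 1 else 0) - 1 / L : ℝ) = 0 := by
  have : (L : ℝ) ≠ 0 := by positivity
  rw [sum_sub_distrib, sum_ite_eq' univ u, if_pos (mem_univ u), sum_const, card_univ,
    Fintype.card_fin, nsmul_eq_mul]
  field_simp
  ring

lemma sum_product_of_coordinates {L s : ℕ} (F G : Fin L → ℝ) (hF : ∑ b, F b = 0) {i i' : Fin s}
    (hi : i ≠ i') : ∑ φ : Fin s → Fin L, F (φ i) * G (φ i') = 0 := by
  rw [← (Equiv.funSplitAt i (Fin L)).symm.sum_comp, Fintype.sum_prod_type, sum_comm]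
  refine sum_eq_zero fun φ _ => ?_
  have h1 : ∀ b, (Equiv.funSplitAt i (Fin L)).symm (b, φ) i = b := fun b => by
    simp [Equiv.funSplitAt]
  have h2 : ∀ b, (Equiv.funSplitAt i (Fin L)).symm (b, φ) i' = φ ⟨i', hi.symm⟩ := fun b => by
    simp [Equiv.funSplitAt, hi.symm]
  simp only [h1, h2, ← sum_mul, hF, zero_mul]

/-- There are quasirandom colourings of arbitrarily large complete bipartite graphs. -/
lemma exists_quasirandom_colouring {L : ℕ} (hL : 1 ≤ L) {η : ℝ} (hη : 0 < η) (n₀ : ℕ) :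
    ∃ n, n₀ ≤ n ∧ 1 ≤ n ∧ ∃ col : Fin n → Fin n → Fin L, ∀ u, ∀ X Y : Finset (Fin n),
      (#X : ℝ) * #Y ≤ L * (#((X ×ˢ Y).filter fun p => col p.1 p.2 = u) + η * n ^ 2) := by
  obtain ⟨s, hs⟩ := exists_nat_gt (1 / η ^ 2)
  have hs0 : (0 : ℝ) < s := lt_of_le_of_lt (by positivity) hs
  have hs1 : 1 ≤ s := Nat.cast_pos.mp hs0
  set m := n₀ + 1
  set n := s * (L ^ s * m) with hn
  have hLs : 1 ≤ L ^ s := Nat.one_le_pow _ _ hL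
  have hmn : m ≤ n := by
    rw [hn, ← mul_assoc]
    exact Nat.le_mul_of_pos_left _ (by positivity)
  obtain ⟨eA⟩ : Nonempty (Fin n ≃ Fin s × Fin (L ^ s * m)) :=
    ⟨Fintype.equivOfCardEq (by simp [hn])⟩
  obtain ⟨eB⟩ : Nonempty (Fin n ≃ (Fin s → Fin L) × Fin (s * m)) :=
    ⟨Fintype.equivOfCardEq (by simp [hn]; ring)⟩
  refine ⟨n, by omega, by omega, fun x y => (eB y).1 (eA x).1, fun u X Y => ?_⟩
  set f : Fin L → ℝ := fun b => (if b = u then 1 else 0) - 1 / L with hf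
  set g : Fin n → Fin n → ℝ := fun x y => f ((eB y).1 (eA x).1) with hg
  have hf1 : ∀ b, |f b| ≤ 1 := fun b => by
    have h1 : (1 : ℝ) / L ≤ 1 := div_le_one_of_le₀ (by exact_mod_cast hL) (by positivity)
    have h2 : (0 : ℝ) ≤ 1 / L := by positivity
    simp only [hf]
    rw [abs_le]
    split_ifs <;> constructor <;> linarith
  have horth : ∀ x x', (eA x).1 ≠ (eA x').1 → ∑ y, g x y * g x' y = 0 := fun x x' hne => by
    rw [← eB.symm.sum_comp, Fintype.sum_prod_type]
    simp only [hg, Equiv.apply_symm_apply, sum_const, nsmul_eq_mul, ← mul_sum]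
    rw [sum_product_of_coordinates f f (sum_indicator_sub_eq_zero hL u) hne, mul_zero]
  have hdiag : ∀ x x', ∑ y, g x y * g x' y ≤ if (eA x).1 = (eA x').1 then (n : ℝ) else 0 :=
    fun x x' => by
      split_ifs with h
      · calc ∑ y, g x y * g x' y ≤ ∑ _y : Fin n, (1 : ℝ) := sum_le_sum fun y _ => by
              refine (le_abs_self _).trans ?_
              rw [abs_mul]
              exact mul_le_one₀ (hf1 _) (abs_nonneg _) (hf1 _)
          _ = n := by simp
      · exact (horth x x' h).le
  have hcount : ∑ x : Fin n, ∑ x' : Fin n, (if (eA x).1 = (eA x').1 then (n : ℝ) else 0) =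
      (n : ℝ) ^ 3 / s := by
    have h1 : ∀ x : Fin n, ∑ x' : Fin n, (if (eA x).1 = (eA x').1 then (n : ℝ) else 0) =
        (n : ℝ) ^ 2 / s := fun x => by
      rw [← eA.symm.sum_comp, Fintype.sum_prod_type]
      simp only [Equiv.apply_symm_apply, sum_const, nsmul_eq_mul, ← mul_sum]
      rw [sum_ite_eq univ (eA x).1, if_pos (mem_univ _), card_univ, Fintype.card_fin]
      have : (n : ℝ) = s * ((L ^ s * m : ℕ) : ℝ) := by rw [hn, Nat.cast_mul]
      rw [this]
      field_simp
    rw [sum_congr rfl fun x _ => h1 x, sum_const, card_univ, Fintype.card_fin, nsmul_eq_mul]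
    ring
  have hsq : (∑ x ∈ X, ∑ y ∈ Y, g x y) ^ 2 ≤ (η * (n : ℝ) ^ 2) ^ 2 := by
    calc (∑ x ∈ X, ∑ y ∈ Y, g x y) ^ 2
        = (∑ y, (if y ∈ Y then 1 else 0) * ∑ x ∈ X, g x y) ^ 2 := by
          rw [sum_comm]
          simp [ite_mul, sum_ite_mem]
      _ ≤ n * ∑ y : Fin n, (∑ x ∈ X, g x y) ^ 2 := by
          have := sq_sum_weighted_le (univ : Finset (Fin n)) (fun y => if y ∈ Y then 1 else 0)
            (fun y => ∑ x ∈ X, g x y) fun y _ => abs_ite_one_zero_le _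
          simpa using this
      _ = n * ∑ x ∈ X, ∑ x' ∈ X, ∑ y, g x y * g x' y := by
          congr 1
          simp_rw [pow_two, sum_mul_sum]
          rw [sum_comm]
          exact sum_congr rfl fun x _ => sum_comm
      _ ≤ n * ∑ x ∈ X, ∑ x' ∈ X, (if (eA x).1 = (eA x').1 then (n : ℝ) else 0) :=
          mul_le_mul_of_nonneg_left (sum_le_sum fun x _ => sum_le_sum fun x' _ => hdiag x x')
            (Nat.cast_nonneg _)
      _ ≤ n * ∑ x, ∑ x', (if (eA x).1 = (eA x').1 then (n : ℝ) else 0) := by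
          refine mul_le_mul_of_nonneg_left ?_ (Nat.cast_nonneg _)
          have hnn : ∀ x x' : Fin n, (0 : ℝ) ≤ if (eA x).1 = (eA x').1 then (n : ℝ) else 0 :=
            fun x x' => by split_ifs <;> positivity
          refine (sum_le_sum fun x _ => sum_le_sum_of_subset_of_nonneg (subset_univ X)
            fun x' _ _ => hnn x x').trans ?_
          exact sum_le_sum_of_subset_of_nonneg (subset_univ X)
            fun x _ _ => sum_nonneg fun x' _ => hnn x x'
      _ = (n : ℝ) ^ 4 / s := by rw [hcount]; ring
      _ ≤ (η * (n : ℝ) ^ 2) ^ 2 := by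
          rw [div_le_iff₀ hs0]
          have : 1 ≤ η ^ 2 * s := by
            rw [div_lt_iff₀ (by positivity)] at hs
            linarith
          calc (n : ℝ) ^ 4 = 1 * (n : ℝ) ^ 4 := (one_mul _).symm
            _ ≤ (η ^ 2 * s) * (n : ℝ) ^ 4 := by gcongr
            _ = _ := by ring
  have habs := abs_le_of_even_pow_le (n := 2) (by decide) (by norm_num) (by positivity) hsq
  have heq : ∑ x ∈ X, ∑ y ∈ Y, g x y =
      #((X ×ˢ Y).filter fun p => (eB p.2).1 (eA p.1).1 = u) - (#X : ℝ) * #Y / L := by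
    rw [card_filter, ← sum_product' X Y]
    simp only [hg, hf, sum_sub_distrib, sum_const, nsmul_eq_mul, card_product]
    push_cast
    ring
  rw [heq] at habs
  have h1 := (abs_le.mp habs).1
  have hL0 : (0 : ℝ) < L := by exact_mod_cast hL
  have h2 : (#X : ℝ) * #Y / L ≤
      #((X ×ˢ Y).filter fun p => (eB p.2).1 (eA p.1).1 = u) + η * n ^ 2 := by linarith
  rw [div_le_iff₀ hL0] at h2
  linarith

end Colouring

section LowerBound

lemma pair_eq_pair_of_disjoint {A B : Finset ℕ} (h : Disjoint A B) {a a' b b' : ℕ} (ha : a ∈ A)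
    (ha' : a' ∈ A) (hb : b ∈ B) (hb' : b' ∈ B) (hab : ({a, b} : Finset ℕ) = {a', b'}) :
    a = a' ∧ b = b' := by
  have hne : ∀ x ∈ A, ∀ y ∈ B, x ≠ y := fun x hx y hy hxy =>
    disjoint_left.mp h hx (hxy ▸ hy)
  have h1 : a ∈ ({a', b'} : Finset ℕ) := hab ▸ by simp
  have h2 : b ∈ ({a', b'} : Finset ℕ) := hab ▸ by simp
  simp only [mem_insert, mem_singleton] at h1 h2
  exact ⟨h1.resolve_right (hne a ha b' hb'), h2.resolve_left (hne a' ha' b hb).symm⟩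

/-- The bipartite coloured graph in which the pair `{a, b}` receives colour `c a b`. -/
def BipColored.ofColouring {S : Finset ℕ} (A B : Finset ℕ) (h : Disjoint A B) (c : ℕ → ℕ → ℕ)
    (hc : ∀ x ∈ A, ∀ y ∈ B, c x y ∈ S) : BipColored S where
  A := A
  B := B
  disjAB := h
  P u := ((A ×ˢ B).filter fun p => c p.1 p.2 = u).image fun p => ({p.1, p.2} : Finset ℕ)
  P_disj := by
    intro u _ u' _ huu
    rw [disjoint_left]
    intro e he he'
    simp only [mem_image, mem_filter, mem_product] at he he'
    obtain ⟨p, ⟨⟨hpA, hpB⟩, hpu⟩, rfl⟩ := he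
    obtain ⟨q, ⟨⟨hqA, hqB⟩, hqu⟩, hqp⟩ := he'
    obtain ⟨h1, h2⟩ := pair_eq_pair_of_disjoint h hqA hpA hqB hpB hqp
    exact huu (by rw [← hpu, ← hqu, h1, h2])
  P_cover := by
    ext e
    simp only [mem_biUnion, pairsAB, mem_image, mem_filter]
    constructor
    · rintro ⟨u, _, p, ⟨hp, _⟩, rfl⟩
      exact ⟨p, hp, rfl⟩
    · rintro ⟨p, hp, rfl⟩
      exact ⟨_, hc _ (mem_product.mp hp).1 _ (mem_product.mp hp).2, p, ⟨hp, rfl⟩, rfl⟩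

/-- A hereditary property of infinite `G`-dimension contains a blowup of `G` along every colouring
of a complete bipartite graph. -/
lemma InBH.exists_blowup {ℋ : Set ThreeGraph} (hH : Hereditary ℋ) {G : Bigraph} (hG : InBH ℋ G)
    {n : ℕ} {A B : Finset ℕ} (h : Disjoint A B) (hA : #A = n) (hB : #B = n) {c : ℕ → ℕ → ℕ}
    (hc : ∀ x ∈ A, ∀ y ∈ B, c x y ∈ G.left) :
    ∃ H ∈ ℋ, ∃ C : ℕ → Finset ℕ, A ⊆ H.verts ∧ B ⊆ H.verts ∧ (∀ v ∈ G.right, C v ⊆ H.verts) ∧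
      (∀ v ∈ G.right, #(C v) = n) ∧ #H.verts ≤ (#G.right + 2) * n ∧
      ∀ x ∈ A, ∀ y ∈ B, ∀ v ∈ G.right, ∀ z ∈ C v,
        ((x, y, z) ∈ H.obar ↔ (c x y, v) ∈ G.edges) := by
  obtain ⟨H, hHℋ, hdim⟩ := hG.2 n
  obtain ⟨H', ⟨C, hC, -, -, hverts, hedge⟩, W, hW⟩ :=
    hdim (BipColored.ofColouring A B h c hc) hA hB
  have hAV : A ⊆ H'.verts := by
    rw [hverts]
    exact subset_union_left.trans subset_union_left
  have hBV : B ⊆ H'.verts := by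
    rw [hverts]
    exact (subset_union_right (s₁ := A)).trans subset_union_left
  have hCV : ∀ v ∈ G.right, C v ⊆ H'.verts := fun v hv => by
    rw [hverts]
    exact (subset_biUnion_of_mem C hv).trans subset_union_right
  refine ⟨H', hH.1 _ _ hW (hH.2 H hHℋ W), C, hAV, hBV, hCV, hC, ?_, ?_⟩
  · have h1 : #(G.right.biUnion C) ≤ #G.right * n :=
      card_biUnion_le_card_mul _ _ _ fun v hv => (hC v hv).le
    have h2 : #(A ∪ B) ≤ n + n := (card_union_le _ _).trans (by rw [hA, hB])
    rw [hverts]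
    calc _ ≤ #(A ∪ B) + #(G.right.biUnion C) := card_union_le _ _
      _ ≤ n + n + #G.right * n := add_le_add h2 h1
      _ = _ := by ring
  · intro x hx y hy v hv z hz
    have hmem : ({x, y} : Finset ℕ) ∈ (BipColored.ofColouring A B h c hc).P (c x y) :=
      mem_image.mpr ⟨(x, y), mem_filter.mpr ⟨mem_product.mpr ⟨hx, hy⟩, rfl⟩, rfl⟩
    have hed := hedge _ (hc x hx y hy) v hv _ hmem z hz
    have hset : ({x, y, z} : Finset ℕ) = insert z {x, y} := by
      ext w
      simp only [mem_insert, mem_singleton]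
      tauto
    simp only [ThreeGraph.obar, mem_filter, mem_product, hAV hx, hBV hy, hCV v hv hz, true_and,
      hset]
    tauto

/-- Transfer of a colouring of `Fin n × Fin n` to `[0, n) × [n, 2 * n)`. -/
def shiftColouring {n L : ℕ} (hL : 1 ≤ L) (col : Fin n → Fin n → Fin L) (x y : ℕ) : Fin L :=
  if h : x < n ∧ y - n < n then col ⟨x, h.1⟩ ⟨y - n, h.2⟩ else ⟨0, hL⟩

lemma card_mul_card_le_shiftColouring {n L : ℕ} (hL : 1 ≤ L) {col : Fin n → Fin n → Fin L} {η : ℝ}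
    (hcol : ∀ u, ∀ X Y : Finset (Fin n), (#X : ℝ) * #Y ≤
      L * (#((X ×ˢ Y).filter fun p => col p.1 p.2 = u) + η * n ^ 2)) (u : Fin L)
    {X Y : Finset ℕ} (hX : X ⊆ range n) (hY : Y ⊆ Ico n (2 * n)) :
    (#X : ℝ) * #Y ≤
      L * (#((X ×ˢ Y).filter fun p => shiftColouring hL col p.1 p.2 = u) + η * n ^ 2) := by
  set X' : Finset (Fin n) := univ.filter fun a => (a : ℕ) ∈ X with hX'
  set Y' : Finset (Fin n) := univ.filter fun b => n + (b : ℕ) ∈ Y with hY'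
  have hXc : #X' = #X := by
    refine card_bij (fun a _ => (a : ℕ)) (fun a ha => (mem_filter.mp ha).2)
      (fun a _ b _ hab => Fin.ext hab) fun x hx => ?_
    exact ⟨⟨x, mem_range.mp (hX hx)⟩, mem_filter.mpr ⟨mem_univ _, hx⟩, rfl⟩
  have hYc : #Y' = #Y := by
    refine card_bij (fun b _ => n + (b : ℕ)) (fun a ha => (mem_filter.mp ha).2)
      (fun a _ b _ hab => Fin.ext (Nat.add_left_cancel hab)) fun y hy => ?_
    have := mem_Ico.mp (hY hy)
    refine ⟨⟨y - n, by omega⟩, mem_filter.mpr ⟨mem_univ _, ?_⟩, ?_⟩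
    · simpa [Nat.add_sub_cancel' this.1] using hy
    · simp [Nat.add_sub_cancel' this.1]
  have hle : #((X' ×ˢ Y').filter fun p => col p.1 p.2 = u) ≤
      #((X ×ˢ Y).filter fun p => shiftColouring hL col p.1 p.2 = u) := by
    refine card_le_card_of_injOn (fun p => ((p.1 : ℕ), n + (p.2 : ℕ))) ?_ ?_
    · intro p hp
      rw [mem_coe, mem_filter, mem_product] at hp
      obtain ⟨⟨h1, h2⟩, h3⟩ := hp
      rw [mem_coe, mem_filter, mem_product]
      refine ⟨⟨(mem_filter.mp h1).2, (mem_filter.mp h2).2⟩, ?_⟩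
      simp [shiftColouring, h3]
    · intro p _ q _ hpq
      simp only [Prod.mk.injEq] at hpq
      exact Prod.ext (Fin.ext hpq.1) (Fin.ext (Nat.add_left_cancel hpq.2))
  have := hcol u X' Y'
  rw [hXc, hYc] at this
  refine this.trans ?_
  have hle' : ((#((X' ×ˢ Y').filter fun p => col p.1 p.2 = u) : ℕ) : ℝ) ≤
    #((X ×ˢ Y).filter fun p => shiftColouring hL col p.1 p.2 = u) := Nat.cast_le.mpr hle
  gcongr

/-- If `ℋ` has infinite `G`-dimension for an irreducible `G` with `L` left vertices, then fewer
than `L` pieces never suffice. -/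
lemma InBH.not_psi {ℋ : Set ThreeGraph} (hH : Hereditary ℋ) {G : Bigraph} (hG : InBH ℋ G)
    {L : ℕ} (hL : 1 ≤ L) (hGL : #G.left = L) :
    ∃ e₁ δ : ℝ, 0 < e₁ ∧ 0 < δ ∧ δ ≤ 1 ∧ ∀ ε₁ : ℝ, 0 < ε₁ → ε₁ < e₁ → ∀ ε₂ : ℕ → ℝ,
      (∀ x, ε₂ x ≤ δ) → ∀ L' < L, ∀ T, ¬psi ε₁ ε₂ T L' ℋ := by
  set ρ : ℝ := #G.right + 2 with hρ
  have hρ1 : 1 ≤ ρ := by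
    have : (0 : ℝ) ≤ #G.right := Nat.cast_nonneg _
    linarith
  have hL1 : (1 : ℝ) ≤ L := Nat.one_le_cast.mpr hL
  set D : ℝ := 4 * (L : ℝ) ^ 2 * ρ ^ 3 with hD
  have hD0 : 1 ≤ D := by
    have h1 := one_le_pow₀ hL1 (n := 2)
    have h2 := one_le_pow₀ hρ1 (n := 3)
    rw [hD]
    nlinarith
  set E : ℝ := 10 * (L : ℝ) ^ 4 with hE
  have hE0 : 1 ≤ E := by
    have h1 := one_le_pow₀ hL1 (n := 4)
    linarith
  set κ : ℝ := 1 / (4 * D * E) with hκ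
  have hκ0 : 0 < κ := by positivity
  have hκ1 : κ ≤ 1 := by
    rw [hκ, div_le_one (by positivity)]
    nlinarith
  refine ⟨min (κ ^ 8 / 2 ^ 12) (1 / (4 * D)), κ ^ 4, by positivity, by positivity,
    pow_le_one₀ hκ0.le hκ1, fun ε₁ hε₁ hlt ε₂ hε₂ L' hL' T hpsi => ?_⟩
  have he1 : 2 ^ 12 * ε₁ ≤ κ ^ 8 := by
    have := (lt_min_iff.mp hlt).1.le
    rw [le_div_iff₀ (by positivity)] at this
    linarith
  have hsmall : D * (E * κ + ε₁) < 1 := by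
    have h1 : D * (E * κ) = 1 / 4 := by
      rw [hκ]
      field_simp
    have h2 : D * ε₁ < 1 / 4 := by
      have := (lt_min_iff.mp hlt).2
      rw [lt_div_iff₀ (by positivity)] at this
      linarith
    rw [mul_add]
    linarith
  obtain ⟨n₀, hn₀⟩ := hpsi
  set η : ℝ := 1 / (4 * L * (T + 1) ^ 2) with hη
  have hη0 : 0 < η := by positivity
  obtain ⟨n, hnn, hn1, col, hcol⟩ := exists_quasirandom_colouring hL hη0 n₀
  set e := (G.left.equivFinOfCardEq hGL).symm with he
  set c := shiftColouring hL col with hc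
  have hdisj : Disjoint (range n) (Ico n (2 * n)) := by
    rw [disjoint_left]
    intro x hx hx'
    exact absurd (mem_range.mp hx) (not_lt.mpr (mem_Ico.mp hx').1)
  obtain ⟨H, hHℋ, C, hAV, hBV, hCV, hC, hcard, hR⟩ :=
    hG.exists_blowup hH hdisj (card_range n) (by rw [Nat.card_Ico]; omega)
      (c := fun x y => (e (c x y) : ℕ)) fun x _ y _ => (e (c x y)).2
  have hVn : n₀ ≤ #H.verts := hnn.trans (by simpa using card_le_card hAV)
  obtain ⟨t, ℓ, -, htT, -, hℓ, P, -, hP⟩ := hn₀ H hHℋ hVn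
  have hsep : SeparatesRows fun (u : Fin L) (v : {v // v ∈ G.right}) =>
      ((e u : ℕ), (v : ℕ)) ∈ G.edges := by
    intro u u' huu
    by_contra! hall
    refine huu (e.injective (Subtype.ext (hG.1.1 _ (e u).2 _ (e u').2 fun v => ?_)))
    by_cases hv : v ∈ G.right
    · exact hall ⟨v, hv⟩
    · exact ⟨fun h => absurd (mem_product.mp (G.edges_sub h)).2 hv,
        fun h => absurd (mem_product.mp (G.edges_sub h)).2 hv⟩
  refine P.not_regWrt (U := Fin L) (I := {v // v ∈ G.right}) (ρ := ρ) (η := η) (κ := κ)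
    (by rw [Fintype.card_fin]; omega) hκ0.le hκ1 hε₁.le he1 (hε₂ ℓ) hn1 hAV hBV (card_range n)
    (by rw [Nat.card_Ico]; omega) (C := fun v => C v) (fun v => hCV v v.2) (fun v => hC v v.2)
    hsep (col := c) (fun x hx y hy v z hz => hR x hx y hy v v.2 z hz) ?_ hη0.le ?_ ?_ ?_ hP
  · rw [Fintype.card_fin, hη]
    have : (t : ℝ) ≤ T := Nat.cast_le.mpr htT
    have h2 : (t : ℝ) ^ 2 ≤ (T + 1) ^ 2 := by gcongr; linarith
    rw [mul_one_div, div_le_one (by positivity)]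
    gcongr
  · intro u X hX Y hY
    rw [Fintype.card_fin]
    convert card_mul_card_le_shiftColouring hL hcol u hX hY
  · rw [hρ]
    exact_mod_cast hcard
  · rw [Fintype.card_fin]
    exact hsmall

end LowerBound

/-- Corollary 6.1: the constant value of `L_ℋ`. -/
theorem stmt_17 (ℋ : Set ThreeGraph) (hH : Hereditary ℋ) (L : ℕ) (hL : 1 ≤ L)
    (hmax : ∃ G : Bigraph, InBH ℋ G ∧ G.left.card = L)
    (hub : ∀ K : ℕ, (∃ G : Bigraph, InBH ℋ G ∧ G.left.card = K) → K ≤ L) :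
    SmallEps fun ε₁ ε₂ => Lfun ℋ ε₁ ε₂ = L := by
  obtain ⟨G, hG, hGL⟩ := hmax
  obtain ⟨e₁, δ, he₁, hδ, hδ1, hnot⟩ := hG.not_psi hH hL hGL
  refine ⟨e₁, he₁, fun ε₁ hε₁ hlt => ⟨fun _ => δ, fun _ => ⟨hδ, hδ1⟩, fun ε₂ hε₂ hle => ?_⟩⟩
  have hmem : L ∈ {L : ℕ | ∃ T : ℕ, 1 ≤ T ∧ psi ε₁ ε₂ T L ℋ} := exists_psi hL hub hε₁ hε₂
  refine le_antisymm (Nat.sInf_le hmem) ?_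
  obtain ⟨T, -, hT⟩ := Nat.sInf_mem ⟨L, hmem⟩
  by_contra! h
  exact hnot ε₁ hε₁ hlt ε₂ hle _ h T hT
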